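/- arXiv:1805.01998 — 6 statements merged into one kernel-verified Lean document; each statement's English description precedes it below -/
import Mathlib

section
/- Let p be an odd prime, n ≥ 2 an integer, and A an integer with 0 < |A| < p/2. Let k be an integer (positive or negative) with k ≠ 1, |k| < (p−1)/2, and gcd(k, p−1) = 1, and let f(x) = (A x^k mod p) on I, where for negative k, x^k means (x^{-1})^{|k|} with x^{-1} the inverse of x mod p. If p ≥ 16.2·|k−1|²·n⁴, then f is not of Type (iv): for every pair i, j with 0 ≤ i, j ≤ n−1 one has f(I_i) ∩ I_j ≠ ∅. -/
/-- `Iclass p n j` is the residue class `I_j = {x : 1 ≤ x ≤ p-1, x ≡ j (mod n)}`. -/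
def Iclass (p n j : ℕ) : Finset ℕ :=
  (Finset.Icc 1 (p - 1)).filter fun x => x % n = j

/-- `fmapz p A k x` is `A x^k mod p` for an integer exponent `k`, the least residue in
`{0, …, p-1}`, where for negative `k`, `x^k` means `(x⁻¹)^|k|` with `x⁻¹` the inverse
of `x` mod `p`. -/
def fmapz (p : ℕ) (A : ℤ) (k : ℤ) (x : ℕ) : ℕ :=
  ((A : ZMod p) *
    (if 0 ≤ k then (x : ZMod p) ^ k.toNat else ((x : ZMod p)⁻¹) ^ (-k).toNat)).val

open Polynomial

theorem exists_algClosed_valuation (F : Type) [Field F] :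
    ∃ (L : Type) (_ : Field L) (_ : Algebra F L) (_ : IsAlgClosed L)
      (A : ValuationSubring L) (x : L), 1 < A.valuation x ∧
        ∀ c : F, c ≠ 0 → A.valuation (algebraMap F L c) = 1 := by
  let L := AlgebraicClosure (LaurentSeries F)
  let φ : PowerSeries F →+* L :=
    (algebraMap (LaurentSeries F) L).comp (algebraMap (PowerSeries F) (LaurentSeries F))
  obtain ⟨A, hA, hloc⟩ := IsLocalRing.exists_factor_valuationRing φ
  have hle : ∀ g, A.valuation (φ g) ≤ 1 := fun g =>
    (A.valuation_le_one_iff _).2 (hA g)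
  have hunit : ∀ g, IsUnit g → A.valuation (φ g) = 1 := by
    rintro _ ⟨u, rfl⟩
    refine le_antisymm (hle _) ?_
    have h2 := hle (↑u⁻¹ : PowerSeries F)
    have h1 : A.valuation (φ u) * A.valuation (φ (↑u⁻¹ : PowerSeries F)) = 1 := by
      rw [← map_mul, ← map_mul]; simp
    calc 1 = A.valuation (φ u) * A.valuation (φ (↑u⁻¹ : PowerSeries F)) := h1.symm
      _ ≤ A.valuation (φ u) * 1 := by gcongr
      _ = _ := mul_one _
  have hX : A.valuation (φ PowerSeries.X) < 1 := by
    refine lt_of_le_of_ne (hle _) fun h => ?_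
    have hu : IsUnit (φ.codRestrict A.toSubring (fun g => hA g) PowerSeries.X) :=
      (A.valuation_eq_one_iff _).2 h
    exact PowerSeries.X_prime.not_isUnit (hloc.map_nonunit _ hu)
  have hφ : Function.Injective φ :=
    (algebraMap (LaurentSeries F) L).injective.comp (IsFractionRing.injective _ _)
  have hX0 : φ PowerSeries.X ≠ 0 := by
    rw [Ne, map_eq_zero_iff φ hφ]; exact PowerSeries.X_ne_zero
  refine ⟨L, inferInstance, (φ.comp (PowerSeries.C (R := F))).toAlgebra, inferInstance, A,
    (φ PowerSeries.X)⁻¹, ?_, fun c hc => hunit _ ?_⟩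
  · rw [map_inv₀]
    exact (one_lt_inv₀ (by simpa [zero_lt_iff] using hX0)).2 hX
  · exact (PowerSeries.isUnit_iff_constantCoeff).2 (by simpa using hc)

section Span

variable {F K : Type*} [Field F] [CommRing K] [Algebra F K]

/-- The span of the powers `x ^ i`, `lo ≤ i ≤ hi`. -/
def lspan (F : Type*) {K : Type*} [Field F] [CommRing K] [Algebra F K] (x : Kˣ) (lo hi : ℤ) :
    Submodule F K :=
  Submodule.span F {z | ∃ i : ℤ, lo ≤ i ∧ i ≤ hi ∧ z = ((x ^ i : Kˣ) : K)}

/-- The span of the monomials `x ^ i * y ^ c`, `lo ≤ i ≤ hi`, `c < p`. -/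
def rspan (F : Type*) {K : Type*} [Field F] [CommRing K] [Algebra F K] (p : ℕ) (x : Kˣ) (y : K)
    (lo hi : ℤ) : Submodule F K :=
  Submodule.span F {z | ∃ i : ℤ, ∃ c : ℕ, lo ≤ i ∧ i ≤ hi ∧ c < p ∧ z = ((x ^ i : Kˣ) : K) * y ^ c}

theorem lspan_mono (x : Kˣ) {lo hi lo' hi' : ℤ} (h1 : lo' ≤ lo) (h2 : hi ≤ hi') :
    lspan F x lo hi ≤ lspan F x lo' hi' := by
  apply Submodule.span_mono
  rintro _ ⟨i, h, h', rfl⟩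
  exact ⟨i, by omega, by omega, rfl⟩

theorem rspan_mono (p : ℕ) (x : Kˣ) (y : K) {lo hi lo' hi' : ℤ} (h1 : lo' ≤ lo) (h2 : hi ≤ hi') :
    rspan F p x y lo hi ≤ rspan F p x y lo' hi' := by
  apply Submodule.span_mono
  rintro _ ⟨i, c, h, h', hc, rfl⟩
  exact ⟨i, c, by omega, by omega, hc, rfl⟩

theorem lspan_mul_rspan {p : ℕ} {x : Kˣ} {y : K} {lo hi lo' hi' : ℤ} {z w : K}
    (hz : z ∈ lspan F x lo hi) (hw : w ∈ rspan F p x y lo' hi') :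
    z * w ∈ rspan F p x y (lo + lo') (hi + hi') := by
  have h := Submodule.mul_mem_mul hz hw
  rw [lspan, rspan, Submodule.span_mul_span] at h
  refine Submodule.span_mono ?_ h
  rintro _ ⟨_, ⟨i, h1, h2, rfl⟩, _, ⟨j, c, h3, h4, hc, rfl⟩, rfl⟩
  exact ⟨i + j, c, by omega, by omega, hc, by simp only [zpow_add, Units.val_mul]; ring⟩

theorem zpow_mul_mem_rspan {p : ℕ} {x : Kˣ} {y : K} {lo hi : ℤ} {w : K} (i : ℤ)
    (hw : w ∈ rspan F p x y lo hi) :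
    ((x ^ i : Kˣ) : K) * w ∈ rspan F p x y (i + lo) (i + hi) :=
  lspan_mul_rspan (Submodule.subset_span ⟨i, le_rfl, le_rfl, rfl⟩) hw

theorem mul_mem_rspan {p : ℕ} (hp : 1 < p) {x : Kˣ} {y : K} {s e : ℤ} (hs : 0 ≤ s) (he : 0 ≤ e)
    (hy : y ^ p - y ∈ lspan F x (-s) e) {lo hi : ℤ} {w : K} (hw : w ∈ rspan F p x y lo hi) :
    y * w ∈ rspan F p x y (lo - s) (hi + e) := by
  induction hw using Submodule.span_induction with
  | zero => simp
  | add a b _ _ ha hb => rw [mul_add]; exact add_mem ha hb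
  | smul c a _ ha => rw [mul_smul_comm]; exact Submodule.smul_mem _ _ ha
  | mem a ha =>
    obtain ⟨i, c, h1, h2, hc, rfl⟩ := ha
    rcases Nat.lt_or_ge (c + 1) p with h | h
    · exact Submodule.subset_span ⟨i, c + 1, by omega, by omega, h, by ring⟩
    · obtain rfl : p = c + 1 := by omega
      have e1 : y * (((x ^ i : Kˣ) : K) * y ^ c)
          = ((x ^ i : Kˣ) : K) * y ^ 1 + (y ^ (c + 1) - y) * (((x ^ i : Kˣ) : K) * y ^ 0) := by ring
      rw [e1]
      refine add_mem (Submodule.subset_span ⟨i, 1, by omega, by omega, hp, rfl⟩) ?_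
      refine rspan_mono _ _ _ ?_ ?_ (lspan_mul_rspan hy
        (Submodule.subset_span ⟨i, 0, le_rfl, le_rfl, by omega, rfl⟩)) <;> omega

theorem pow_char_mem_lspan (p : ℕ) [hp : Fact p.Prime] [CharP K p] {x : Kˣ} {lo hi : ℤ} {w : K}
    (hw : w ∈ lspan F x lo hi) : w ^ p ∈ lspan F x (p * lo) (p * hi) := by
  induction hw using Submodule.span_induction with
  | zero => simp [hp.out.ne_zero]
  | add a b _ _ ha hb => rw [add_pow_char]; exact add_mem ha hb
  | smul c a _ ha => rw [_root_.smul_pow]; exact Submodule.smul_mem _ _ ha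
  | mem a ha =>
    obtain ⟨i, h1, h2, rfl⟩ := ha
    refine Submodule.subset_span ⟨p * i, by gcongr, by gcongr, ?_⟩
    rw [mul_comm, zpow_mul]; simp

theorem pow_char_pow_sub_mem_lspan (p : ℕ) [hp : Fact p.Prime] [CharP K p] {x : Kˣ} {y : K}
    {s e : ℤ} (hs : 0 ≤ s) (he : 0 ≤ e) (hy : y ^ p - y ∈ lspan F x (-s) e) (n : ℕ) :
    y ^ p ^ n - y ∈ lspan F x (-(s * p ^ n)) (e * p ^ n) := by
  induction n with
  | zero => simp
  | succ n ih =>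
    have h1 : y ^ p ^ (n + 1) - y = (y ^ p ^ n - y) ^ p + (y ^ p - y) := by
      rw [sub_pow_char, pow_succ, pow_mul]; ring
    have h2 : (1 : ℤ) ≤ p ^ (n + 1) := by exact_mod_cast Nat.one_le_pow _ _ hp.out.pos
    rw [h1]
    refine add_mem (lspan_mono _ ?_ ?_ (pow_char_mem_lspan p ih)) (lspan_mono _ ?_ ?_ hy)
    · apply le_of_eq; ring
    · apply le_of_eq; ring
    · nlinarith
    · nlinarith

theorem pow_mul_mem_rspan (p : ℕ) [hp : Fact p.Prime] [CharP K p] {x : Kˣ} {y : K}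
    {s e : ℤ} (hs : 0 ≤ s) (he : 0 ≤ e) (hy : y ^ p - y ∈ lspan F x (-s) e) (n j : ℕ)
    {lo hi : ℤ} {w : K} (hw : w ∈ rspan F p x y lo hi) :
    (y ^ p ^ n) ^ j * w ∈ rspan F p x y (lo - j * (s * (p ^ n + 1))) (hi + j * (e * (p ^ n + 1))) := by
  induction j with
  | zero => simpa using hw
  | succ j ih =>
    have h1 : (y ^ p ^ n) ^ (j + 1) * w
        = (y ^ p ^ n - y) * ((y ^ p ^ n) ^ j * w) + y * ((y ^ p ^ n) ^ j * w) := by ring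
    have h2 : (0 : ℤ) ≤ p ^ n := by positivity
    have h3 := mul_nonneg hs h2
    have h4 := mul_nonneg he h2
    rw [h1]
    refine add_mem (rspan_mono _ _ _ ?_ ?_ (lspan_mul_rspan
      (pow_char_pow_sub_mem_lspan p hs he hy n) ih))
      (rspan_mono _ _ _ ?_ ?_ (mul_mem_rspan hp.out.one_lt hs he hy ih)) <;>
    · push_cast; linarith

theorem monomial_mem_rspan (p : ℕ) [hp : Fact p.Prime] [CharP K p] {x : Kˣ} {y : K}
    {s e : ℤ} (hs : 0 ≤ s) (he : 0 ≤ e) (hy : y ^ p - y ∈ lspan F x (-s) e) (n : ℕ) {c j : ℕ}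
    (hc : c < p) (hj : j < p) (i : ℤ) :
    ((x ^ i : Kˣ) : K) * y ^ (c + j * p ^ n)
      ∈ rspan F p x y (i - s * (p ^ (n + 1) + p)) (i + e * (p ^ (n + 1) + p)) := by
  have h0 : y ^ c ∈ rspan F p x y 0 0 :=
    Submodule.subset_span ⟨0, c, le_rfl, le_rfl, hc, by simp⟩
  have h1 := zpow_mul_mem_rspan i (pow_mul_mem_rspan p hs he hy n j h0)
  have h2 : y ^ (c + j * p ^ n) = (y ^ p ^ n) ^ j * y ^ c := by
    rw [pow_add, ← pow_mul]; ring
  have h3 : (j : ℤ) ≤ p := by exact_mod_cast hj.le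
  have h4 : (0 : ℤ) ≤ p ^ n + 1 := by positivity
  have h5 := mul_le_mul_of_nonneg_right h3 (mul_nonneg hs h4)
  have h6 := mul_le_mul_of_nonneg_right h3 (mul_nonneg he h4)
  rw [h2]
  refine rspan_mono _ _ _ ?_ ?_ h1
  · rw [pow_succ]; linarith
  · rw [pow_succ]; linarith

theorem rspan_eq_span_range (p : ℕ) (x : Kˣ) (y : K) (lo hi : ℤ) :
    rspan F p x y lo hi = Submodule.span F (Set.range
      fun t : Finset.Icc lo hi × Fin p => ((x ^ (t.1 : ℤ) : Kˣ) : K) * y ^ (t.2 : ℕ)) := by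
  apply le_antisymm <;> apply Submodule.span_mono
  · rintro _ ⟨i, c, h1, h2, hc, rfl⟩
    exact ⟨(⟨i, Finset.mem_Icc.2 ⟨h1, h2⟩⟩, ⟨c, hc⟩), rfl⟩
  · rintro _ ⟨⟨⟨i, hi⟩, c⟩, rfl⟩
    have := Finset.mem_Icc.1 hi
    exact ⟨i, c, this.1, this.2, c.2, rfl⟩

end Span

theorem Valuation.sum_ne_zero_of_injOn {ι R Γ : Type*} [Ring R]
    [LinearOrderedCommGroupWithZero Γ] (v : Valuation R Γ) (s : Finset ι) (f : ι → R)
    (hinj : ∀ i ∈ s, ∀ j ∈ s, v (f i) = v (f j) → i = j) (hs : s.Nonempty)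
    (h0 : ∀ i ∈ s, v (f i) ≠ 0) : ∑ i ∈ s, f i ≠ 0 := by
  classical
  obtain ⟨j, hj, hmax⟩ := s.exists_max_image (fun i => v (f i)) hs
  intro h
  have := v.map_sum_eq_of_lt hj (f := f) (s := s) (fun i hi => by
    simp only [Finset.mem_sdiff, Finset.mem_singleton] at hi
    exact lt_of_le_of_ne (hmax i hi.1) fun h => hi.2 (hinj i hi.1 j hj h))
  rw [h, map_zero] at this
  exact h0 j hj this.symm

/-- A function `∑ c, a c * y ^ c` with `c < p` vanishing on a coset of the prime field is zero. -/
theorem eq_zero_of_forall_sum_eq_zero {F : Type*} [Field F] (p : ℕ) [Fact p.Prime] [CharP F p]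
    (a : Fin p → F) (y : F) (h : ∀ k : Fin p, ∑ c, a c * (y + (k : ℕ)) ^ (c : ℕ) = 0) : a = 0 := by
  refine Matrix.eq_zero_of_forall_index_sum_mul_pow_eq_zero (f := fun k : Fin p => y + (k : ℕ)) ?_ h
  intro k l hkl
  have h1 : ((k : ℕ) : F) = (l : ℕ) := by simpa using hkl
  exact Fin.ext (CharP.natCast_injOn_Iio F p k.2 l.2 h1)

theorem card_le_of_forall_sum_zpow_eq_zero {F : Type*} [Field F] {lo hi : ℤ} (hlh : lo ≤ hi)
    (d : Finset.Icc lo hi → F) (hd : d ≠ 0) (T : Finset Fˣ)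
    (hT : ∀ x ∈ T, ∑ i, d i * ((x ^ (i : ℤ) : Fˣ) : F) = 0) : (T.card : ℤ) ≤ hi - lo := by
  classical
  let P : F[X] := ∑ i, C (d i) * X ^ ((i : ℤ) - lo).toNat
  have hpos : ∀ i : Finset.Icc lo hi, lo ≤ (i : ℤ) ∧ (i : ℤ) ≤ hi := fun i => Finset.mem_Icc.1 i.2
  have hP : P ≠ 0 := by
    intro h
    apply hd
    funext j
    have := congrArg (fun P => P.coeff ((j : ℤ) - lo).toNat) h
    simp only [P, finsetSum_coeff, coeff_C_mul_X_pow, coeff_zero] at this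
    rw [Finset.sum_eq_single j] at this
    · simpa using this
    · intro i _ hij
      rw [if_neg]
      intro h
      have h1 := hpos i
      have h2 := hpos j
      exact hij (Subtype.ext (by omega))
    · simp
  have hdeg : P.natDegree ≤ (hi - lo).toNat := by
    refine natDegree_sum_le_of_forall_le _ _ fun i _ => (natDegree_C_mul_X_pow_le _ _).trans ?_
    have := hpos i
    omega
  have hsub : T.image (fun x : Fˣ => (x : F)) ⊆ P.roots.toFinset := by
    intro z hz
    obtain ⟨x, hx, rfl⟩ := Finset.mem_image.1 hz
    rw [Multiset.mem_toFinset, mem_roots hP, IsRoot, eval_finsetSum]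
    have h1 : ∀ i : Finset.Icc lo hi, eval (x : F) (C (d i) * X ^ ((i : ℤ) - lo).toNat)
        = ((x ^ (-lo) : Fˣ) : F) * (d i * ((x ^ (i : ℤ) : Fˣ) : F)) := by
      intro i
      have h2 : (x : F) ^ ((i : ℤ) - lo).toNat = ((x ^ (-lo) : Fˣ) : F) * ((x ^ (i : ℤ) : Fˣ) : F) := by
        rw [← Units.val_mul, ← zpow_add, ← Units.val_pow_eq_pow_val, ← zpow_natCast]
        congr 2
        have := hpos i
        omega
      simp only [eval_mul, eval_C, eval_pow, eval_X]
      rw [h2]; ring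
    rw [Finset.sum_congr rfl fun i _ => h1 i, ← Finset.mul_sum, hT x hx, mul_zero]
  have h1 := Finset.card_le_card hsub
  rw [Finset.card_image_of_injective _ Units.val_injective] at h1
  have h2 := (Multiset.toFinset_card_le P.roots).trans (card_roots' P)
  omega

theorem exists_ne_zero_sum_eq_zero {F K ι κ : Type*} [Field F] [AddCommGroup K] [Module F K]
    [Fintype ι] [Fintype κ] (g : κ → K) (f : ι → K) (hf : ∀ i, f i ∈ Submodule.span F (Set.range g))
    (hcard : Fintype.card κ < Fintype.card ι) : ∃ V : ι → F, V ≠ 0 ∧ ∑ i, V i • f i = 0 := by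
  by_contra! h
  have hli : LinearIndependent F f := by
    rw [Fintype.linearIndependent_iff]
    intro V hV i
    by_contra hi
    exact h V (fun h0 => hi (by simp [h0])) hV
  let f' : ι → Submodule.span F (Set.range g) := fun i => ⟨f i, hf i⟩
  have hli' : LinearIndependent F f' := by
    apply LinearIndependent.of_comp (Submodule.subtype _)
    exact hli
  have := FiniteDimensional.span_of_finite F (Set.finite_range g)
  have h1 := hli'.fintype_card_le_finrank
  have h2 := finrank_range_le_card (R := F) g
  rw [Set.finrank] at h2
  omega

/-- The value at the unit `x` of the Laurent polynomial `∑ c i * X ^ i`, `-s ≤ i ≤ e`. -/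
noncomputable def laurentEval {F K : Type*} [Field F] [CommRing K] [Algebra F K] (c : ℤ → F) (s e : ℕ)
    (x : Kˣ) : K :=
  ∑ i ∈ Finset.Icc (-(s : ℤ)) e, c i • ((x ^ i : Kˣ) : K)

theorem laurentEval_mem_lspan {F K : Type*} [Field F] [CommRing K] [Algebra F K] (c : ℤ → F)
    (s e : ℕ) (x : Kˣ) : laurentEval c s e x ∈ lspan F x (-s) e :=
  Submodule.sum_mem _ fun i hi => Submodule.smul_mem _ _ <| Submodule.subset_span
    ⟨i, (Finset.mem_Icc.1 hi).1, (Finset.mem_Icc.1 hi).2, rfl⟩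

theorem map_laurentEval {F K K' : Type*} [Field F] [CommRing K] [Algebra F K] [CommRing K']
    [Algebra F K'] (φ : K →ₐ[F] K') (c : ℤ → F) (s e : ℕ) (x : Kˣ) :
    φ (laurentEval c s e x) = laurentEval c s e (Units.map (φ : K →* K') x) := by
  simp only [laurentEval, map_sum, map_smul]
  refine Finset.sum_congr rfl fun i _ => ?_
  rw [← map_zpow]
  rfl

theorem valuation_laurentEval {F L Γ : Type*} [Field F] [Field L] [Algebra F L]
    [LinearOrderedCommGroupWithZero Γ] (v : Valuation L Γ)
    (hv : ∀ c : F, c ≠ 0 → v (algebraMap F L c) = 1) (x : Lˣ) (hx : 1 < v (x : L))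
    (c : ℤ → F) (s e : ℕ) (hc : c e ≠ 0) : v (laurentEval c s e x) = v (x : L) ^ e := by
  classical
  have hterm : ∀ i, c i ≠ 0 → v (c i • ((x ^ i : Lˣ) : L)) = v (x : L) ^ i := by
    intro i hi
    rw [Algebra.smul_def, map_mul, hv _ hi, one_mul, Units.val_zpow_eq_zpow_val, map_zpow₀]
  have hlt := v.map_sum_eq_of_lt (s := Finset.Icc (-(s : ℤ)) e)
    (f := fun i => c i • ((x ^ i : Lˣ) : L)) (j := (e : ℤ)) (by simp) (by
      intro i hi
      simp only [Finset.mem_sdiff, Finset.mem_singleton, Finset.mem_Icc] at hi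
      rw [hterm e hc]
      by_cases h : c i = 0
      · rw [h, zero_smul, map_zero]
        exact zpow_pos (zero_lt_one.trans hx) _
      · rw [hterm i h]
        exact zpow_lt_zpow_right₀ hx (by omega))
  rw [laurentEval, hlt, hterm _ hc, zpow_natCast]

theorem valuation_pow_eq {L Γ : Type*} [Field L] [LinearOrderedCommGroupWithZero Γ]
    (v : Valuation L Γ) {p : ℕ} (hp : 1 < p) {y z : L} (h : y ^ p - y = z) (hz : 1 < v z) :
    v y ^ p = v z := by
  have hy : 1 < v y := by
    by_contra! hy
    have : v z ≤ 1 := by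
      rw [← h]
      refine (v.map_sub _ _).trans (max_le ?_ hy)
      rw [map_pow]; exact pow_le_one₀ zero_le hy
    exact absurd hz this.not_gt
  have h1 : v y < v (y ^ p) := by
    rw [map_pow]; exact lt_self_pow₀ hy hp
  rw [← h, Valuation.map_sub_eq_of_lt_left v h1, map_pow]

theorem weight_injective {p e q : ℕ} (hpe : Nat.Coprime p e) {i j a b i' j' a' b' : ℕ}
    (hj : j < p) (hj' : j' < p) (hb : b < p) (hb' : b' < p)
    (h1 : p * i + e * j < q) (h2 : p * i' + e * j' < q)
    (h : p * i + e * j + q * (p * a + e * b) = p * i' + e * j' + q * (p * a' + e * b')) :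
    i = i' ∧ j = j' ∧ a = a' ∧ b = b' := by
  have key : ∀ {i j i' j' : ℕ}, j < p → j' < p → p * i + e * j = p * i' + e * j' →
      i = i' ∧ j = j' := by
    intro i j i' j' hj hj' h
    have h3 : e * j ≡ e * j' [MOD p] := by
      have : (p * i + e * j) % p = (p * i' + e * j') % p := by rw [h]
      simpa [Nat.add_mod, Nat.ModEq] using this
    have h4 : j = j' := Nat.ModEq.eq_of_lt_of_lt (h3.cancel_left_of_coprime hpe) hj hj'
    subst h4
    have hp : 0 < p := by omega
    exact ⟨Nat.eq_of_mul_eq_mul_left hp (by omega), rfl⟩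
  have hq : 0 < q := by omega
  have h3 : p * a + e * b = p * a' + e * b' := by
    have := congrArg (· / q) h
    simpa [Nat.add_mul_div_left _ _ hq, Nat.div_eq_of_lt h1, Nat.div_eq_of_lt h2] using this
  have h4 : p * i + e * j = p * i' + e * j' := by rw [h3] at h; omega
  have h5 := key hj hj' h4
  have h6 := key hb hb' h3
  tauto

/-- A universal solution of `y ^ p - y = f x`: a ring with a valuation describing the point at
infinity, specializing to every affine point. -/
theorem exists_artinSchreier_model (p : ℕ) [hp : Fact p.Prime] (F : Type) [Field F] [CharP F p]
    (c : ℤ → F) (s e : ℕ) (hce : c e ≠ 0) (he : 0 < e) :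
    ∃ (K : Type) (_ : CommRing K) (_ : Algebra F K) (_ : CharP K p) (Γ : Type)
      (_ : LinearOrderedCommGroupWithZero Γ) (v : Valuation K Γ) (x : Kˣ) (y : K),
      y ^ p - y = laurentEval c s e x ∧ 1 < v (x : K) ∧ v y ^ p = v (x : K) ^ e ∧
      (∀ a : F, a ≠ 0 → v (algebraMap F K a) = 1) ∧
      ∀ (u : Fˣ) (z : F), z ^ p - z = laurentEval c s e u →
        ∃ φ : K →ₐ[F] F, (∀ i : ℤ, φ ((x ^ i : Kˣ) : K) = ((u ^ i : Fˣ) : F)) ∧ φ y = z := by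
  obtain ⟨L, _, _, _, V, xL', hxL, hv⟩ := exists_algClosed_valuation F
  set v := V.valuation
  have hxL0 : xL' ≠ 0 := by rintro h; rw [h, map_zero] at hxL; exact not_lt_zero hxL
  obtain ⟨xL, rfl⟩ : ∃ u : Lˣ, (u : L) = xL' := ⟨Units.mk0 _ hxL0, rfl⟩
  have hp1 := hp.out.one_lt
  obtain ⟨yL, hyL⟩ : ∃ y : L, y ^ p - y = laurentEval c s e xL := by
    have hd : (X ^ p - X - C (laurentEval c s e xL) : L[X]).degree ≠ 0 := by
      have h1 : (X ^ p - X : L[X]).degree = p := by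
        rw [degree_sub_eq_left_of_degree_lt] <;> rw [degree_X_pow]
        rw [degree_X]; exact_mod_cast hp1
      have : (X ^ p - X - C (laurentEval c s e xL) : L[X]).degree = p := by
        rw [degree_sub_C, h1]; rw [h1]; exact_mod_cast hp.out.pos
      rw [this]; exact_mod_cast hp.out.ne_zero
    obtain ⟨y, hy⟩ := IsAlgClosed.exists_root _ hd
    refine ⟨y, ?_⟩
    simpa [sub_eq_zero] using hy
  have hvx : 1 < v (laurentEval c s e xL) := by
    rw [valuation_laurentEval v hv xL hxL c s e hce]
    exact one_lt_pow₀ hxL he.ne'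
  have hvy : v yL ^ p = v (xL : L) ^ e := by
    rw [valuation_pow_eq v hp1 hyL hvx, valuation_laurentEval v hv xL hxL c s e hce]
  let Pts := {P : Fˣ × F // P.2 ^ p - P.2 = laurentEval c s e P.1}
  let x : (L × (Pts → F))ˣ := MulEquiv.prodUnits.symm (xL, MulEquiv.piUnits.symm fun P => P.1.1)
  let y : L × (Pts → F) := (yL, fun P => P.1.2)
  let πP : Pts → (L × (Pts → F) →ₐ[F] F) := fun P =>
    (Pi.evalAlgHom F (fun _ : Pts => F) P).comp (AlgHom.snd F L (Pts → F))
  have hxP : ∀ P, Units.map (πP P : L × (Pts → F) →* F) x = P.1.1 := fun P => Units.ext rfl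
  refine ⟨L × (Pts → F), inferInstance, inferInstance,
    charP_of_injective_algebraMap (algebraMap F (L × (Pts → F))).injective p, V.ValueGroup,
    inferInstance, v.comap (RingHom.fst L (Pts → F)), x, y, ?_, hxL, hvy, hv, fun u z h => ?_⟩
  · refine Prod.ext ?_ (funext fun P => ?_)
    · refine hyL.trans (Eq.trans ?_ (map_laurentEval (AlgHom.fst F L (Pts → F)) c s e x).symm)
      congr 1
    · refine P.2.trans (Eq.trans ?_ (map_laurentEval (πP P) c s e x).symm)
      rw [hxP]
  · refine ⟨πP ⟨(u, z), h⟩, fun i => ?_, rfl⟩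
    have h2 := congrArg (fun w : Fˣ => ((w ^ i : Fˣ) : F)) (hxP ⟨(u, z), h⟩)
    simp only [← map_zpow] at h2
    exact h2

set_option maxHeartbeats 1000000 in
/-- Counts the affine units `x` over which `y ^ p - y = f x` is solvable: the Stepanov-Bombieri
upper bound. -/
theorem card_le_of_artinSchreier (p : ℕ) [hp : Fact p.Prime] (m : ℕ) (F : Type) [Field F] [Fintype F]
    [CharP F p] (hcard : Fintype.card F = (p ^ (m + 1)) ^ 2) (c : ℤ → F) (s e : ℕ) (hce : c e ≠ 0)
    (he : 0 < e) (hpe : Nat.Coprime p e)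
    (hq : ((s + e) * p + 1) * (1 + e * p) + (s + e) * p ≤ p ^ (m + 1))
    (T : Finset Fˣ) (hT : ∀ x ∈ T, ∃ y : F, y ^ p - y = laurentEval c s e x) :
    p * T.card ≤ (p ^ (m + 1)) ^ 2 +
      (1 + p * ((s + e) * p + 1) + 2 * (s + e) * p ^ 2) * p ^ (m + 1) := by
  classical
  obtain ⟨K, _, _, _, Γ, _, v, x, y, hy, hxv, hvy, hv, hpt⟩ :=
    exists_artinSchreier_model p F c s e hce he
  have hyl : y ^ p - y ∈ lspan F x (-s) e := hy ▸ laurentEval_mem_lspan c s e x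
  have hp1 := hp.out.one_lt
  set q := p ^ (m + 1) with hqdef
  set κ := s + e with hκ
  set E := p ^ (m + 1 + 1) + p with hE
  have hEq : E = p * q + p := by rw [hE, pow_succ, ← hqdef, mul_comm]
  set t := κ * p + 1 with ht
  obtain ⟨I, hI⟩ : ∃ I, p ^ m = I + 1 + e := by
    have h1 : (e + 1) * p ≤ p ^ m * p := by
      rw [← pow_succ, ← hqdef]
      refine le_trans ?_ hq
      have h2 : 1 * p ≤ κ * p := Nat.mul_le_mul_right _ (by omega)
      have h3 : 1 * (1 + e * p) ≤ t * (1 + e * p) := Nat.mul_le_mul_right _ (by omega)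
      have h4 : (e + 1) * p = e * p + p := by ring
      omega
    have := Nat.le_of_mul_le_mul_right h1 hp.out.pos
    exact ⟨p ^ m - (e + 1), by omega⟩
  set A := p ^ m + t with hA
  have hqp : q = p * p ^ m := by rw [hqdef, pow_succ, mul_comm]
  let ι := (Fin (I + 1) × Fin p) × (Fin A × Fin p)
  have hwt : ∀ z : ι, p * (z.1.1 : ℕ) + e * (z.1.2 : ℕ) < q := by
    intro z
    have h1 : (z.1.1 : ℕ) ≤ I := Nat.lt_succ_iff.1 z.1.1.2
    have h2 : (z.1.2 : ℕ) ≤ p := z.1.2.2.le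
    have h3 := Nat.mul_le_mul_left p h1
    have h4 := Nat.mul_le_mul_left e h2
    rw [hqp, hI]
    nlinarith [hp.out.pos]
  -- the auxiliary linear relation
  let lo : ℤ := -(s * E)
  let hi : ℤ := I * q + (A - 1) + e * E
  obtain ⟨W, hW0, hW⟩ : ∃ W : ι → F, W ≠ 0 ∧ ∑ z, W z •
      (((x ^ (((z.1.1 : ℕ) : ℤ) * q + ((z.2.1 : ℕ) : ℤ)) : Kˣ) : K) *
        y ^ ((z.2.2 : ℕ) + (z.1.2 : ℕ) * q)) = 0 := by
    refine exists_ne_zero_sum_eq_zero (κ := Finset.Icc lo hi × Fin p)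
      (fun t => ((x ^ (t.1 : ℤ) : Kˣ) : K) * y ^ (t.2 : ℕ)) _ ?_ ?_
    · intro z
      rw [← rspan_eq_span_range]
      have h1 : (z.1.1 : ℕ) ≤ I := Nat.lt_succ_iff.1 z.1.1.2
      have h2 : (z.2.1 : ℕ) + 1 ≤ A := z.2.1.2
      have h3 : ((z.1.1 : ℕ) : ℤ) * q ≤ I * q := by gcongr
      have h5 : (0 : ℤ) ≤ ((z.1.1 : ℕ) : ℤ) * q := by positivity
      have h6 : (E : ℤ) = (p : ℤ) ^ (m + 1 + 1) + p := by push_cast [hE]; rfl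
      refine rspan_mono _ _ _ ?_ ?_ (monomial_mem_rspan p (by positivity) (by positivity) hyl
        (m + 1) z.2.2.2 z.1.2.2 _)
      · rw [← h6]; simp only [lo]; omega
      · rw [← h6]; simp only [hi]; omega
    · simp only [ι, Fintype.card_prod, Fintype.card_fin, Fintype.card_coe, Int.card_Icc]
      have h1 : (hi + 1 - lo).toNat = I * q + A + κ * E := by
        have : hi + 1 - lo = ((I * q + A + κ * E : ℕ) : ℤ) := by
          simp only [hi, lo, hκ]; push_cast; ring
        rw [this]; rfl
      rw [h1]
      have h2 : I * q + A + κ * E < p * ((I + 1) * A) := by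
        have h3 : p * ((I + 1) * A) + t * (e * p) = (I + 1) * q + q * t := by
          rw [hqp, hI, hA, hI]; ring
        have h4 : p ^ m < q := by rw [hqp]; exact lt_mul_left (pow_pos hp.out.pos m) hp1
        rw [hEq]
        have h5 : κ * (p * q + p) + q = t * q + κ * p := by rw [ht]; ring
        have h6 : q ≤ t * q := Nat.le_mul_of_pos_left _ (by omega)
        have h7 : (I + 1) * q = I * q + q := by ring
        have h8 : t * (1 + e * p) = t + t * (e * p) := by ring
        have h9 : q * t = t * q := mul_comm _ _
        omega
      calc (I * q + A + κ * E) * p < (p * ((I + 1) * A)) * p := by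
            exact Nat.mul_lt_mul_of_pos_right h2 hp.out.pos
        _ = _ := by ring
  let U : ι → F := fun z => W z ^ q
  have hU : ∀ z, U z ^ q = W z := fun z => by
    simp only [U]; rw [← pow_mul, ← sq, ← hcard, FiniteField.pow_card]
  let w : K := ∑ z, U z • (((x ^ (((z.1.1 : ℕ) : ℤ) + ((z.2.1 : ℕ) : ℤ) * q) : Kˣ) : K) *
        y ^ ((z.1.2 : ℕ) + (z.2.2 : ℕ) * q))
  let hi' : ℤ := I + (A - 1) * q + e * E
  have hw : w ∈ rspan F p x y lo hi' := by
    refine Submodule.sum_mem _ fun z _ => Submodule.smul_mem _ _ ?_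
    have h1 : (z.1.1 : ℕ) ≤ I := Nat.lt_succ_iff.1 z.1.1.2
    have h2 : (z.2.1 : ℕ) + 1 ≤ A := z.2.1.2
    have h3 : ((z.2.1 : ℕ) : ℤ) * q ≤ (A - 1) * q := by
      have : ((z.2.1 : ℕ) : ℤ) ≤ A - 1 := by omega
      gcongr
    have h5 : (0 : ℤ) ≤ ((z.2.1 : ℕ) : ℤ) * q := by positivity
    have h6 : (E : ℤ) = (p : ℤ) ^ (m + 1 + 1) + p := by push_cast [hE]; rfl
    refine rspan_mono _ _ _ ?_ ?_ (monomial_mem_rspan p (by positivity) (by positivity) hyl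
      (m + 1) z.1.2.2 z.2.2.2 _)
    · rw [← h6]; simp only [lo]; omega
    · rw [← h6]; simp only [hi']; omega
  have hwL : w ≠ 0 := by
    have h1 : w = ∑ z with W z ≠ 0, U z • (((x ^ (((z.1.1 : ℕ) : ℤ) + ((z.2.1 : ℕ) : ℤ) * q) :
        Kˣ) : K) * y ^ ((z.1.2 : ℕ) + (z.2.2 : ℕ) * q)) := by
      rw [Finset.sum_filter_of_ne]
      · intro z _ h1 h2
        simp [U, h2, hqdef, hp.out.ne_zero] at h1
    have hval : ∀ z, W z ≠ 0 → v (U z • (((x ^ (((z.1.1 : ℕ) : ℤ) + ((z.2.1 : ℕ) : ℤ) * q) :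
        Kˣ) : K) * y ^ ((z.1.2 : ℕ) + (z.2.2 : ℕ) * q))) ^ p =
        v (x : K) ^ (p * (z.1.1 : ℕ) + e * (z.1.2 : ℕ) +
          q * (p * (z.2.1 : ℕ) + e * (z.2.2 : ℕ))) := by
      intro z hz
      have h2 : ((z.1.1 : ℕ) : ℤ) + ((z.2.1 : ℕ) : ℤ) * q
          = (((z.1.1 : ℕ) + (z.2.1 : ℕ) * q : ℕ) : ℤ) := by push_cast; ring
      rw [Algebra.smul_def, map_mul, hv _ (pow_ne_zero _ hz), one_mul, h2, zpow_natCast,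
        map_mul, Units.val_pow_eq_pow_val, map_pow, map_pow, mul_pow, ← pow_mul, ← pow_mul,
        mul_comm _ p, mul_comm ((z.1.2 : ℕ) + _) p, pow_mul (v y), hvy, ← pow_mul, ← pow_add]
      congr 1; ring
    rw [h1]
    refine v.sum_ne_zero_of_injOn _ _ ?_ ?_ ?_
    · intro z hz z' hz' h
      have h2 := congrArg (· ^ p) h
      simp only [Finset.mem_filter, Finset.mem_univ, true_and] at hz hz'
      simp only [hval z hz, hval z' hz'] at h2
      have h3 := pow_right_injective₀ (zero_lt_one.trans hxv) hxv.ne' h2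
      obtain ⟨h4, h5, h6, h7⟩ := weight_injective hpe z.1.2.2 z'.1.2.2 z.2.2.2 z'.2.2.2
        (hwt z) (hwt z') h3
      exact Prod.ext (Prod.ext (Fin.ext h4) (Fin.ext h5)) (Prod.ext (Fin.ext h6) (Fin.ext h7))
    · obtain ⟨z, hz⟩ := Function.ne_iff.1 hW0
      exact ⟨z, by simpa using hz⟩
    · intro z hz h0
      simp only [Finset.mem_filter, Finset.mem_univ, true_and] at hz
      have h2 := hval z hz
      rw [h0, zero_pow hp.out.ne_zero] at h2
      exact pow_ne_zero _ (zero_lt_one.trans hxv).ne' h2.symm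
  have hcharq : ∀ (ι' : Type) [Fintype ι'] (f : ι' → F), (∑ i, f i) ^ q = ∑ i, f i ^ q := by
    intro ι' _ f
    rw [hqdef]
    have := map_sum (iterateFrobenius F p (m + 1)) f Finset.univ
    simpa only [iterateFrobenius_def] using this
  have hwP : ∀ (u : Fˣ) (φ : K →ₐ[F] F),
      (∀ i : ℤ, φ ((x ^ i : Kˣ) : K) = ((u ^ i : Fˣ) : F)) → φ w = 0 := by
    intro u φ hzP
    have h1 : φ w ^ q = 0 := by
      have h2 := congrArg φ hW
      simp only [map_sum, map_smul, map_mul, map_pow, hzP, map_zero, smul_eq_mul] at h2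
      simp only [w, map_sum, map_smul, map_mul, map_pow, hzP, smul_eq_mul]
      rw [hcharq, ← h2]
      refine Finset.sum_congr rfl fun z _ => ?_
      rw [mul_pow, mul_pow, hU]
      congr 2
      · rw [← Units.val_pow_eq_pow_val, ← zpow_natCast, ← zpow_mul, add_mul, mul_assoc, zpow_add,
          zpow_add, mul_comm ((z.2.1 : ℕ) : ℤ), zpow_mul _ ((q : ℤ) * q)]
        congr 2
        have h3 : (u ^ ((q : ℤ) * q)) = u := by
          apply Units.ext
          have : ((q : ℤ) * q) = ((q ^ 2 : ℕ) : ℤ) := by push_cast; ring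
          rw [this, zpow_natCast, Units.val_pow_eq_pow_val, ← hcard, FiniteField.pow_card]
        rw [h3]
      · rw [← pow_mul, add_mul, mul_assoc, pow_add, pow_add, mul_comm ((φ y) ^ _)]
        rw [mul_comm (z.2.2 : ℕ), pow_mul _ (q * q), ← sq q, ← hcard, FiniteField.pow_card]
    exact pow_eq_zero_iff (pow_pos hp.out.pos _).ne' |>.1 h1
  rw [rspan_eq_span_range, Submodule.mem_span_range_iff_exists_fun] at hw
  obtain ⟨d, hd⟩ := hw
  have hd0 : d ≠ 0 := by
    rintro rfl
    simp only [Pi.zero_apply, zero_smul, Finset.sum_const_zero] at hd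
    exact hwL hd.symm
  obtain ⟨⟨i₀, c₀⟩, hic⟩ := Function.ne_iff.1 hd0
  have hlh : lo ≤ hi' := (Finset.mem_Icc.1 i₀.2).1.trans (Finset.mem_Icc.1 i₀.2).2
  have hcount : (T.card : ℤ) ≤ hi' - lo := by
    refine card_le_of_forall_sum_zpow_eq_zero hlh (fun i => d (i, c₀))
      (fun h => hic (congrFun h i₀)) T fun u hu => ?_
    obtain ⟨y₀, hy₀⟩ := hT u hu
    have h1 := eq_zero_of_forall_sum_eq_zero p
      (fun c => ∑ i, d (i, c) * ((u ^ (i : ℤ) : Fˣ) : F)) y₀ (fun k => by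
        have hP : (y₀ + (k : ℕ)) ^ p - (y₀ + (k : ℕ)) = laurentEval c s e u := by
          rw [add_pow_char, ← hy₀]
          have : ((k : ℕ) : F) ^ p = (k : ℕ) := by
            have h := map_natCast (frobenius F p) (k : ℕ)
            rwa [frobenius_def] at h
          rw [this]; ring
        obtain ⟨φ, hzP, hyP⟩ := hpt u _ hP
        have h2 := hwP u φ hzP
        rw [← hd] at h2
        simp only [map_sum, map_smul, map_mul, map_pow, hzP, hyP, smul_eq_mul,
          Fintype.sum_prod_type_right] at h2
        rw [← h2]
        refine Finset.sum_congr rfl fun c _ => ?_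
        rw [Finset.sum_mul]
        exact Finset.sum_congr rfl fun i _ => by ring)
    exact congrFun h1 c₀
  have hfin : (T.card : ℤ) + 1 ≤ ((I + 1 + A * q + κ * E : ℕ) : ℤ) - q := by
    simp only [hi', lo] at hcount
    push_cast [hκ]
    linarith
  have h1 : T.card + 1 + q ≤ I + 1 + A * q + κ * E := by omega
  have h2 : p * (T.card + 1 + q) ≤ p * (I + 1 + A * q + κ * E) := Nat.mul_le_mul_left _ h1
  have h3 : p * (I + 1 + A * q + κ * E) + p * e = q + (q + p * t) * q + p * (κ * E) := by
    have : p * (I + 1) + p * e = q := by rw [hqp, hI]; ring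
    have h5 : p * A = q + p * t := by rw [hA, hqp]; ring
    calc _ = (p * (I + 1) + p * e) + p * A * q + p * (κ * E) := by ring
      _ = _ := by rw [this, h5]
  have h4 : p * (κ * E) ≤ 2 * κ * p ^ 2 * q := by
    have : 1 ≤ q := Nat.one_le_pow _ _ hp.out.pos
    rw [hEq]
    have h6 : κ * p ^ 2 * 1 ≤ κ * p ^ 2 * q := Nat.mul_le_mul_left _ this
    nlinarith
  nlinarith

/-- Additive Hilbert 90 over the prime field. -/
theorem exists_pow_sub_eq_of_trace_eq_zero (p : ℕ) [hp : Fact p.Prime] {F : Type*} [Field F]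
    [Finite F] [Algebra (ZMod p) F] {z : F} (hz : Algebra.trace (ZMod p) F z = 0) :
    ∃ y : F, y ^ p - y = z := by
  classical
  have : Fintype F := Fintype.ofFinite F
  let φ : F →ₗ[ZMod p] F := (FiniteField.frobeniusAlgHom (ZMod p) F).toLinearMap - LinearMap.id
  have hφ : ∀ y, φ y = y ^ p - y := fun y => by
    simp [φ, ZMod.card]
  have h1 : LinearMap.range φ ≤ LinearMap.ker (Algebra.trace (ZMod p) F) := by
    rintro _ ⟨y, rfl⟩
    have h2 := Algebra.trace_eq_of_algEquiv (FiniteField.frobeniusAlgEquivOfAlgebraic (ZMod p) F) y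
    rw [FiniteField.coe_frobeniusAlgEquivOfAlgebraic, ZMod.card] at h2
    rw [LinearMap.mem_ker, hφ, map_sub, h2, sub_self]
  have hker : Module.finrank (ZMod p) (LinearMap.ker φ) ≤ 1 := by
    have h0 : (X ^ p - X : F[X]) ≠ 0 := FiniteField.X_pow_card_sub_X_ne_zero F hp.out.one_lt
    have h3 : Nat.card (LinearMap.ker φ) ≤ p := by
      rw [← SetLike.coe_sort_coe, Nat.card_coe_set_eq]
      have h4 : ((LinearMap.ker φ : Set F)) ⊆ ((X ^ p - X : F[X]).roots.toFinset : Set F) := by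
        intro y hy
        have : y ^ p - y = 0 := by rw [← hφ]; exact hy
        rw [Finset.mem_coe, Multiset.mem_toFinset, mem_roots h0]
        simpa using this
      refine (Set.ncard_le_ncard h4 (Finset.finite_toSet _)).trans ?_
      rw [Set.ncard_coe_finset]
      refine (Multiset.toFinset_card_le _).trans ((card_roots' _).trans ?_)
      rw [FiniteField.X_pow_card_sub_X_natDegree_eq F hp.out.one_lt]
    rw [Module.natCard_eq_pow_finrank (K := ZMod p), Nat.card_zmod] at h3
    exact (Nat.pow_le_pow_iff_right hp.out.one_lt).1 (by simpa using h3)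
  have hsurj := Algebra.trace_surjective (ZMod p) F
  have h4 := LinearMap.finrank_range_add_finrank_ker φ
  have h5 := LinearMap.finrank_range_add_finrank_ker (Algebra.trace (ZMod p) F)
  rw [LinearMap.range_eq_top.2 hsurj, finrank_top, Module.finrank_self] at h5
  have h6 := Submodule.eq_of_le_of_finrank_le h1 (by omega)
  have h7 : z ∈ LinearMap.range φ := h6 ▸ hz
  obtain ⟨y, hy⟩ := h7
  exact ⟨y, by rw [← hφ, hy]⟩

theorem laurentEval_algebraMap_add {k F : Type*} [Field k] [Field F] [Algebra k F] (c : ℤ → k)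
    (s e : ℕ) (x : Fˣ) (d : F) :
    laurentEval (fun i => algebraMap k F (c i) + if i = 0 then d else 0) s e x
      = laurentEval c s e x + d := by
  simp only [laurentEval, smul_eq_mul, add_mul, Finset.sum_add_distrib, Algebra.smul_def, ite_mul,
    zero_mul]
  rw [Finset.sum_ite_eq']
  simp

theorem exists_norm_sum_le (p : ℕ) [hp : Fact p.Prime] (ψ : AddChar (ZMod p) ℂ) (hψ : ψ ≠ 1)
    (c : ℤ → ZMod p) (s e : ℕ) (hce : c e ≠ 0) (he : 0 < e) (hpe : Nat.Coprime p e) :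
    ∃ C m₀ : ℕ, ∀ m ≥ m₀, ∀ (F : Type) [Field F] [Fintype F] [DecidableEq F] [Algebra (ZMod p) F],
      Fintype.card F = (p ^ (m + 1)) ^ 2 →
      ‖∑ x : Fˣ, ψ (Algebra.trace (ZMod p) F (laurentEval c s e x))‖ ≤ C * p ^ (m + 1) := by
  classical
  set C₀ := 1 + p * ((s + e) * p + 1) + 2 * (s + e) * p ^ 2 with hC₀
  refine ⟨C₀ + 1, ((s + e) * p + 1) * (1 + e * p) + (s + e) * p, fun m hm F _ _ _ _ hF => ?_⟩
  have : CharP F p := charP_of_injective_algebraMap (algebraMap (ZMod p) F).injective p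
  have hq : ((s + e) * p + 1) * (1 + e * p) + (s + e) * p ≤ p ^ (m + 1) :=
    (hm.trans (Nat.le_succ m)).trans (Nat.lt_pow_self hp.out.one_lt).le
  let N : ZMod p → ℕ := fun t =>
    (Finset.univ.filter fun x : Fˣ => Algebra.trace (ZMod p) F (laurentEval c s e x) = t).card
  have hN : ∀ t, p * N t ≤ (p ^ (m + 1)) ^ 2 + C₀ * p ^ (m + 1) := by
    intro t
    obtain ⟨d, hd⟩ := Algebra.trace_surjective (ZMod p) F t
    refine card_le_of_artinSchreier p m F hF
      (fun i => algebraMap (ZMod p) F (c i) + if i = 0 then -d else 0) s e ?_ he hpe hq _ ?_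
    · simp [he.ne', hce]
    · intro x hx
      rw [laurentEval_algebraMap_add]
      apply exists_pow_sub_eq_of_trace_eq_zero
      rw [map_add, map_neg, (Finset.mem_filter.1 hx).2, hd, add_neg_cancel]
  have hsum : ∑ t, N t = (p ^ (m + 1)) ^ 2 - 1 := by
    rw [← hF, ← Fintype.card_units, ← Finset.card_univ, Finset.card_eq_sum_card_fiberwise
      (t := Finset.univ) (f := fun x : Fˣ => Algebra.trace (ZMod p) F (laurentEval c s e x))
      (fun _ _ => Finset.mem_univ _)]
  have hpos : 1 ≤ (p ^ (m + 1)) ^ 2 := Nat.one_le_pow _ _ (pow_pos hp.out.pos _)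
  have hS : ∑ x : Fˣ, ψ (Algebra.trace (ZMod p) F (laurentEval c s e x))
      = ∑ t, (N t : ℂ) * ψ t := by
    rw [← Finset.sum_fiberwise (g := fun x : Fˣ =>
      Algebra.trace (ZMod p) F (laurentEval c s e x))]
    refine Finset.sum_congr rfl fun t _ => ?_
    rw [Finset.sum_congr rfl (g := fun _ => ψ t)
      (fun x hx => by rw [(Finset.mem_filter.1 hx).2]), Finset.sum_const, nsmul_eq_mul]
  set q := p ^ (m + 1)
  have hp0 : (0 : ℝ) < p := by exact_mod_cast hp.out.pos
  have h1 : (p : ℂ) * ∑ t, (N t : ℂ) * ψ t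
      = - ∑ t, (((q ^ 2 + C₀ * q : ℕ) : ℂ) - p * N t) * ψ t := by
    simp only [sub_mul, Finset.sum_sub_distrib, ← Finset.mul_sum, AddChar.sum_eq_zero_of_ne_one hψ,
      mul_assoc]
    ring
  have h2 : ∀ t, ‖(((q ^ 2 + C₀ * q : ℕ) : ℂ) - p * N t) * ψ t‖
      = ((q ^ 2 + C₀ * q : ℕ) : ℝ) - p * N t := by
    intro t
    have h3 : (((q ^ 2 + C₀ * q : ℕ) : ℂ) - p * N t)
        = ((((q ^ 2 + C₀ * q : ℕ) : ℝ) - p * N t : ℝ) : ℂ) := by push_cast; ring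
    rw [norm_mul, AddChar.norm_apply, mul_one, h3, Complex.norm_real, Real.norm_eq_abs,
      abs_of_nonneg]
    rw [sub_nonneg]
    exact_mod_cast hN t
  have h4 : (p : ℝ) * ‖∑ t, (N t : ℂ) * ψ t‖ ≤ p * (C₀ * q + 1) := by
    calc (p : ℝ) * ‖∑ t, (N t : ℂ) * ψ t‖ = ‖(p : ℂ) * ∑ t, (N t : ℂ) * ψ t‖ := by
          rw [norm_mul]; simp
      _ ≤ ∑ t, (((q ^ 2 + C₀ * q : ℕ) : ℝ) - p * N t) := by
          rw [h1, norm_neg]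
          exact (norm_sum_le _ _).trans (Finset.sum_le_sum fun t _ => (h2 t).le)
      _ = p * (C₀ * q + 1) := by
          have h9 : ∑ t, (N t : ℝ) = (q : ℝ) ^ 2 - 1 := by
            rw [← Nat.cast_sum, hsum, Nat.cast_sub hpos]; push_cast; rfl
          rw [Finset.sum_sub_distrib, ← Finset.mul_sum, h9]
          simp [ZMod.card]; ring
  have h5 := le_of_mul_le_mul_left h4 hp0
  have h6 : (1 : ℝ) ≤ q := by exact_mod_cast Nat.one_le_pow _ _ hp.out.pos
  rw [hS]
  push_cast
  have h7 : ((p : ℝ) ^ (m + 1)) = q := by simp [q]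
  rw [h7]
  linarith

/-- The power series `-X u' / u`; for `u = ∏ (1 - x X)` its coefficients are the power sums
of the `x`. -/
noncomputable def negLogDeriv {k : Type*} [Field k] (u : PowerSeries k) : PowerSeries k :=
  -(PowerSeries.X * PowerSeries.derivative k u * u⁻¹)

section

variable {k : Type*} [Field k]

theorem negLogDeriv_mul {u v : PowerSeries k} (hu : PowerSeries.constantCoeff u ≠ 0)
    (hv : PowerSeries.constantCoeff v ≠ 0) :
    negLogDeriv (u * v) = negLogDeriv u + negLogDeriv v := by
  have h1 := PowerSeries.mul_inv_cancel u hu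
  have h2 := PowerSeries.mul_inv_cancel v hv
  rw [negLogDeriv, negLogDeriv, negLogDeriv, PowerSeries.mul_inv_rev, Derivation.leibniz,
    smul_eq_mul, smul_eq_mul]
  linear_combination (-PowerSeries.X * PowerSeries.derivative k v * v⁻¹) * h1
    + (-PowerSeries.X * PowerSeries.derivative k u * u⁻¹) * h2

theorem negLogDeriv_multiset_prod (s : Multiset (PowerSeries k))
    (hs : ∀ u ∈ s, PowerSeries.constantCoeff u ≠ 0) :
    negLogDeriv s.prod = (s.map negLogDeriv).sum := by
  induction s using Multiset.induction with
  | empty => simp [negLogDeriv]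
  | cons u s ih =>
    have h1 : ∀ v ∈ s, PowerSeries.constantCoeff v ≠ 0 := fun v hv =>
      hs v (Multiset.mem_cons_of_mem hv)
    have h2 : PowerSeries.constantCoeff s.prod ≠ 0 := by
      rw [map_multiset_prod]
      refine Multiset.prod_ne_zero fun h => ?_
      obtain ⟨v, hv, h⟩ := Multiset.mem_map.1 h
      exact h1 v hv h
    rw [Multiset.prod_cons, negLogDeriv_mul (hs u (Multiset.mem_cons_self _ _)) h2, ih h1,
      Multiset.map_cons, Multiset.sum_cons]

theorem negLogDeriv_C (c : k) : negLogDeriv (PowerSeries.C c) = 0 := by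
  simp [negLogDeriv]

theorem negLogDeriv_one_sub (x : k) :
    negLogDeriv (1 - PowerSeries.C x * PowerSeries.X) = PowerSeries.mk fun m =>
      if m = 0 then 0 else x ^ m := by
  have hc : PowerSeries.constantCoeff (1 - PowerSeries.C x * PowerSeries.X) ≠ 0 := by simp
  have h1 : negLogDeriv (1 - PowerSeries.C x * PowerSeries.X) *
      (1 - PowerSeries.C x * PowerSeries.X) = PowerSeries.C x * PowerSeries.X := by
    rw [negLogDeriv, neg_mul, mul_assoc, PowerSeries.inv_mul_cancel _ hc]
    simp [PowerSeries.derivative_X, mul_comm]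
  have h2 : (PowerSeries.mk fun m => if m = 0 then 0 else x ^ m) *
      (1 - PowerSeries.C x * PowerSeries.X) = PowerSeries.C x * PowerSeries.X := by
    ext n
    rw [mul_sub, mul_one, ← mul_assoc, map_sub]
    rcases n with _ | _ | n
    · simp
    · simp [PowerSeries.coeff_succ_mul_X, PowerSeries.coeff_mul_C]
    · simp [PowerSeries.coeff_succ_mul_X, PowerSeries.coeff_mul_C, pow_succ]
  have h3 := h1.trans h2.symm
  refine mul_right_cancel₀ ?_ h3
  rintro h
  rw [h] at hc
  simp at hc

theorem negLogDeriv_map {K : Type*} [Field K] (f : k →+* K) {u : PowerSeries k}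
    (hu : PowerSeries.constantCoeff u ≠ 0) :
    negLogDeriv (PowerSeries.map f u) = PowerSeries.map f (negLogDeriv u) := by
  have h1 := PowerSeries.mul_inv_cancel u hu
  have h2 : PowerSeries.constantCoeff (PowerSeries.map f u) ≠ 0 := by
    rw [← PowerSeries.coeff_zero_eq_constantCoeff_apply, PowerSeries.coeff_map,
      PowerSeries.coeff_zero_eq_constantCoeff_apply]
    exact (map_ne_zero f).2 hu
  have h3 : (PowerSeries.map f u)⁻¹ = PowerSeries.map f u⁻¹ := by
    rw [eq_comm, PowerSeries.eq_inv_iff_mul_eq_one h2, ← map_mul, mul_comm, h1, map_one]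
  have h4 : PowerSeries.derivative K (PowerSeries.map f u)
      = PowerSeries.map f (PowerSeries.derivative k u) := by
    ext n
    simp [PowerSeries.coeff_derivative]
  rw [negLogDeriv, negLogDeriv, h3, h4]
  simp

/-- Changing `u` by `δ X ^ m` changes the `m`-th coefficient of `negLogDeriv u` by `-m δ`
and none of the lower ones. -/
theorem coeff_negLogDeriv_add {u w : PowerSeries k} {c : k} (hc : c ≠ 0)
    (hu : PowerSeries.constantCoeff u = c) {m : ℕ} (hm : m ≠ 0) (δ : k)
    (hw : w = u + PowerSeries.C δ * PowerSeries.X ^ m) {j : ℕ} (hj : j ≤ m) :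
    PowerSeries.coeff j (negLogDeriv w) = PowerSeries.coeff j (negLogDeriv u)
      - if j = m then m * δ * c⁻¹ else 0 := by
  have hu0 : PowerSeries.constantCoeff u ≠ 0 := hu ▸ hc
  have hw0 : PowerSeries.constantCoeff w = c := by rw [hw]; simp [hu, hm]
  have hw0' : PowerSeries.constantCoeff w ≠ 0 := hw0 ▸ hc
  have h1 := PowerSeries.mul_inv_cancel u hu0
  have h2 := PowerSeries.mul_inv_cancel w hw0'
  have hd : PowerSeries.X * PowerSeries.derivative k w = PowerSeries.X * PowerSeries.derivative k u
      + PowerSeries.C (m * δ) * PowerSeries.X ^ m := by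
    ext n
    rcases n with _ | n
    · simp [hm]
    · simp only [hw, map_add, PowerSeries.coeff_succ_X_mul, PowerSeries.coeff_derivative,
        PowerSeries.coeff_C_mul, PowerSeries.coeff_X_pow]
      split_ifs with h
      · subst h; push_cast; ring
      · ring
  have key : negLogDeriv w = negLogDeriv u - PowerSeries.X ^ m *
      (PowerSeries.C (m * δ) * w⁻¹ +
        PowerSeries.C δ * negLogDeriv u * w⁻¹) := by
    have h3 : (u⁻¹ - w⁻¹) = PowerSeries.C δ * PowerSeries.X ^ m * u⁻¹ * w⁻¹ := by
      have : w - u = PowerSeries.C δ * PowerSeries.X ^ m := by rw [hw]; ring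
      rw [← this]
      linear_combination (-u⁻¹) * h2 + w⁻¹ * h1
    rw [negLogDeriv, hd, negLogDeriv]
    linear_combination (PowerSeries.X * PowerSeries.derivative k u) * h3
  have h0 : PowerSeries.constantCoeff (negLogDeriv u) = 0 := by simp [negLogDeriv]
  rw [key, map_sub, PowerSeries.coeff_X_pow_mul']
  congr 1
  by_cases h : j = m
  · subst h
    simp [h0, hw0]
  · rw [if_neg (by omega), if_neg h]

end

/-- The sum of the `i`-th powers of the roots of a monic polynomial, for `i ≠ 0`. -/
noncomputable def powerSum {k : Type*} [Field k] (g : k[X]) (i : ℤ) : k :=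
  if 0 ≤ i then PowerSeries.coeff i.toNat (negLogDeriv (g.reverse : PowerSeries k))
  else PowerSeries.coeff (-i).toNat (negLogDeriv (g : PowerSeries k))

section

variable {k : Type*} [Field k]

theorem constantCoeff_coe_reverse {g : k[X]} (hg : g.Monic) :
    PowerSeries.constantCoeff (g.reverse : PowerSeries k) = 1 := by
  rw [constantCoeff_coe, coeff_zero_reverse, hg.leadingCoeff]

theorem powerSum_mul {g h : k[X]} (hg : g.Monic) (hh : h.Monic) {i : ℤ}
    (hg0 : i < 0 → g.coeff 0 ≠ 0) (hh0 : i < 0 → h.coeff 0 ≠ 0) :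
    powerSum (g * h) i = powerSum g i + powerSum h i := by
  unfold powerSum
  split_ifs with hi
  · rw [reverse_mul_of_domain, coe_mul, negLogDeriv_mul, map_add]
    · rw [constantCoeff_coe_reverse hg]; exact one_ne_zero
    · rw [constantCoeff_coe_reverse hh]; exact one_ne_zero
  · push Not at hi
    rw [coe_mul, negLogDeriv_mul, map_add]
    · rw [constantCoeff_coe]; exact hg0 hi
    · rw [constantCoeff_coe]; exact hh0 hi

theorem powerSum_one (i : ℤ) : powerSum (1 : k[X]) i = 0 := by
  simp [powerSum, negLogDeriv, reverse]

theorem powerSum_map {K : Type*} [Field K] (f : k →+* K) {g : k[X]} (hg : g.Monic) {i : ℤ}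
    (hg0 : i < 0 → g.coeff 0 ≠ 0) : powerSum (g.map f) i = f (powerSum g i) := by
  unfold powerSum
  split_ifs with hi
  · have h1 : (((g.map f).reverse : K[X]) : PowerSeries K)
        = PowerSeries.map f (g.reverse : PowerSeries k) := by
      rw [reverse, natDegree_map, reflect_map, ← polynomial_map_coe]; rfl
    rw [h1, negLogDeriv_map, PowerSeries.coeff_map]
    rw [constantCoeff_coe_reverse hg]; exact one_ne_zero
  · push Not at hi
    rw [polynomial_map_coe, negLogDeriv_map, PowerSeries.coeff_map]
    rw [constantCoeff_coe]; exact hg0 hi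

theorem powerSum_X_sub_C {x : k} {i : ℤ} (hi : i ≠ 0) (hx : i < 0 → x ≠ 0) :
    powerSum (X - C x) i = x ^ i := by
  unfold powerSum
  split_ifs with h0
  · have h1 : ((reverse (X - C x) : k[X]) : PowerSeries k)
        = 1 - PowerSeries.C x * PowerSeries.X := by
      have : reverse (X - C x) = 1 - C x * X := by
        ext n
        rcases n with _ | _ | n <;>
          simp [coeff_reverse, coeff_X, coeff_C, revAt, coeff_one]
      rw [this]; simp
    obtain ⟨n, rfl⟩ := Int.eq_ofNat_of_zero_le h0
    rw [h1, negLogDeriv_one_sub, PowerSeries.coeff_mk, if_neg (by simpa using hi)]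
    simp
  · push Not at h0
    have hx0 := hx h0
    have h1 : ((X - C x : k[X]) : PowerSeries k) = PowerSeries.C (-x) *
        (1 - PowerSeries.C x⁻¹ * PowerSeries.X) := by
      rw [mul_sub, ← mul_assoc, ← map_mul]
      simp [hx0]; ring
    obtain ⟨n, rfl⟩ : ∃ n : ℕ, i = -n := ⟨(-i).toNat, by omega⟩
    rw [h1, negLogDeriv_mul, negLogDeriv_C, zero_add, negLogDeriv_one_sub, PowerSeries.coeff_mk,
      if_neg (by simpa using hi)]
    · simp
    · simpa using hx0
    · simp

theorem powerSum_prod_X_sub_C (s : Multiset k) {i : ℤ} (hi : i ≠ 0) (hs : i < 0 → (0 : k) ∉ s) :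
    powerSum (s.map fun x => X - C x).prod i = (s.map fun x => x ^ i).sum := by
  induction s using Multiset.induction with
  | empty => simp [powerSum_one]
  | cons x s ih =>
    have h1 : i < 0 → (0 : k) ∉ s := fun h h' => hs h (Multiset.mem_cons_of_mem h')
    have h2 : i < 0 → x ≠ 0 := fun h h' => hs h (h' ▸ Multiset.mem_cons_self _ _)
    rw [Multiset.map_cons, Multiset.prod_cons, powerSum_mul (monic_X_sub_C x)
      (monic_multiset_prod_of_monic _ _ fun x _ => monic_X_sub_C x), ih h1, powerSum_X_sub_C hi h2,
      Multiset.map_cons, Multiset.sum_cons]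
    · intro h; simpa using h2 h
    · intro h
      rw [coeff_zero_eq_eval_zero, eval_multiset_prod]
      refine Multiset.prod_ne_zero fun h' => ?_
      simp only [Multiset.map_map, Multiset.mem_map, Function.comp_apply] at h'
      obtain ⟨y, hy, h'⟩ := h'
      simp at h'
      exact h1 h (h' ▸ hy)

theorem natDegree_add_C_mul_X_pow {g : k[X]} (δ : k) {l : ℕ} (hl : l < g.natDegree) :
    (g + C δ * X ^ l).natDegree = g.natDegree :=
  natDegree_add_eq_left_of_natDegree_lt ((natDegree_C_mul_X_pow_le _ _).trans_lt hl)

theorem monic_add_C_mul_X_pow {g : k[X]} (hg : g.Monic) (δ : k) {l : ℕ} (hl : l < g.natDegree) :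
    (g + C δ * X ^ l).Monic :=
  hg.add_of_left (degree_lt_degree ((natDegree_C_mul_X_pow_le _ _).trans_lt hl))

theorem powerSum_add_C_mul_X_pow {g : k[X]} (hg : g.Monic) (δ : k) {m j : ℕ} (hm : m ≠ 0)
    (hmg : m ≤ g.natDegree) (hj : j ≤ m) :
    powerSum (g + C δ * X ^ (g.natDegree - m)) j
      = powerSum g j - if j = m then m * δ else 0 := by
  have h1 : ((g + C δ * X ^ (g.natDegree - m)).reverse : PowerSeries k)
      = (g.reverse : PowerSeries k) + PowerSeries.C δ * PowerSeries.X ^ m := by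
    rw [reverse, natDegree_add_C_mul_X_pow δ (by omega), reflect_add, reflect_C_mul_X_pow,
      revAt_le (by omega), Nat.sub_sub_self hmg]
    simp [reverse]
  unfold powerSum
  rw [if_pos (by positivity), if_pos (by positivity), Int.toNat_natCast,
    coeff_negLogDeriv_add one_ne_zero (constantCoeff_coe_reverse hg) hm δ h1 hj]
  simp

theorem powerSum_neg_add_C_mul_X_pow {g : k[X]} (hg0 : g.coeff 0 ≠ 0) (δ : k) {l m : ℕ}
    (hm : m ≠ 0) (hl : m < l) :
    powerSum (g + C δ * X ^ l) (-m : ℤ) = powerSum g (-m : ℤ) := by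
  have h1 : ((g + C δ * X ^ l : k[X]) : PowerSeries k)
      = (g : PowerSeries k) + PowerSeries.C δ * PowerSeries.X ^ l := by simp
  unfold powerSum
  rw [if_neg (by omega), if_neg (by omega), neg_neg, Int.toNat_natCast,
    coeff_negLogDeriv_add hg0 (constantCoeff_coe g) (by omega) δ h1 hl.le, if_neg hl.ne, sub_zero]

end

section

variable (k : Type*) [Field k] [Finite k]

theorem finite_setOf_natDegree_le (r : ℕ) : {g : k[X] | g.natDegree ≤ r}.Finite := by
  have : Finite (degreeLT k (r + 1)) := Finite.of_equiv _ (degreeLTEquiv k (r + 1)).symm.toEquiv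
  refine (Set.toFinite (degreeLT k (r + 1) : Set k[X])).subset fun g hg => ?_
  rw [SetLike.mem_coe, mem_degreeLT]
  exact degree_le_natDegree.trans_lt (by exact_mod_cast Nat.lt_succ_of_le hg)

/-- The monic polynomials of degree `r`. -/
noncomputable def monics (r : ℕ) : Finset k[X] :=
  ((finite_setOf_natDegree_le k r).subset (fun _ hg => hg.2.le :
    {g : k[X] | g.Monic ∧ g.natDegree = r} ⊆ _)).toFinset

/-- The monic irreducible polynomials of degree at most `r`. -/
noncomputable def monicPrimes (r : ℕ) : Finset k[X] :=
  ((finite_setOf_natDegree_le k r).subset (fun _ hg => hg.2.2 :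
    {g : k[X] | g.Monic ∧ Irreducible g ∧ g.natDegree ≤ r} ⊆ _)).toFinset

variable {k}

@[simp] theorem mem_monics {r : ℕ} {g : k[X]} : g ∈ monics k r ↔ g.Monic ∧ g.natDegree = r := by
  simp [monics]

@[simp] theorem mem_monicPrimes {r : ℕ} {g : k[X]} :
    g ∈ monicPrimes k r ↔ g.Monic ∧ Irreducible g ∧ g.natDegree ≤ r := by
  simp [monicPrimes]

theorem monics_zero : monics k 0 = {1} := by
  ext g
  simp only [mem_monics, Finset.mem_singleton]
  exact ⟨fun h => h.1.natDegree_eq_zero.1 h.2, by rintro rfl; simp⟩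

open Classical in
theorem natDegree_eq_sum_monicPrimes {r : ℕ} {g : k[X]} (hg : g ∈ monics k r) :
    r = ∑ P ∈ monicPrimes k r, ∑ j ∈ Finset.Icc 1 r, if P ^ j ∣ g then P.natDegree else 0 := by
  rw [mem_monics] at hg
  obtain ⟨hm, hr⟩ := hg
  have h0 := hm.ne_zero
  set s := UniqueFactorizationMonoid.normalizedFactors g with hs
  have hmem : ∀ P ∈ s, P.Monic ∧ Irreducible P ∧ P.natDegree ≤ r := fun P hP => by
    have hirr := UniqueFactorizationMonoid.irreducible_of_normalized_factor P hP
    have hn := UniqueFactorizationMonoid.normalize_normalized_factor P hP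
    refine ⟨?_, hirr, ?_⟩
    · rw [← hn]; exact monic_normalize hirr.ne_zero
    · rw [← hr]
      exact natDegree_le_of_dvd (UniqueFactorizationMonoid.dvd_of_mem_normalizedFactors hP) h0
  have hprod : s.prod = g := by
    rw [hs, UniqueFactorizationMonoid.prod_normalizedFactors_eq h0, hm.normalize_eq_self]
  have hpow : ∀ P ∈ monicPrimes k r, ∀ j : ℕ, P ^ j ∣ g ↔ j ≤ s.count P := by
    intro P hP j
    rw [mem_monicPrimes] at hP
    rw [pow_dvd_iff_le_emultiplicity,
      UniqueFactorizationMonoid.emultiplicity_eq_count_normalizedFactors hP.2.1 h0,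
      hP.1.normalize_eq_self, Nat.cast_le]
  have hcount : ∀ P ∈ monicPrimes k r, s.count P ≤ r := by
    intro P hP
    have h1 := natDegree_le_of_dvd ((hpow P hP _).2 le_rfl) h0
    rw [mem_monicPrimes] at hP
    rw [natDegree_pow, hr] at h1
    exact (Nat.le_mul_of_pos_right _ hP.2.1.natDegree_pos).trans h1
  calc r = (s.map natDegree).sum := by
        rw [← natDegree_multiset_prod_of_monic s fun P hP => (hmem P hP).1, hprod, hr]
    _ = ∑ P ∈ monicPrimes k r, s.count P • P.natDegree := by
        rw [Finset.sum_multiset_map_count]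
        refine Finset.sum_subset (fun P hP => ?_) fun P _ hP => ?_
        · rw [mem_monicPrimes]; exact hmem P (Multiset.mem_toFinset.1 hP)
        · rw [Multiset.count_eq_zero.2 fun h => hP (Multiset.mem_toFinset.2 h), zero_smul]
    _ = _ := by
        refine Finset.sum_congr rfl fun P hP => ?_
        rw [← Finset.sum_filter, Finset.sum_const]
        congr 1
        have : (Finset.Icc 1 r).filter (fun j => P ^ j ∣ g) = Finset.Icc 1 (s.count P) := by
          ext j
          have := hcount P hP
          simp only [Finset.mem_filter, Finset.mem_Icc, hpow P hP]
          omega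
        rw [this]; simp

theorem char_pow {k R : Type*} [Field k] [CommRing R] (χ : k[X] → R) (h1 : χ 1 = 1)
    (hmul : ∀ g h : k[X], g.Monic → h.Monic → χ (g * h) = χ g * χ h) {P : k[X]} (hP : P.Monic) (j : ℕ) : χ (P ^ j) = χ P ^ j := by
  induction j with
  | zero => simpa using h1
  | succ j ih => rw [pow_succ, hmul _ _ (hP.pow j) hP, ih, pow_succ]

open Classical in
theorem sum_monics_dvd {R : Type*} [CommRing R] (χ : k[X] → R)
    (hmul : ∀ g h : k[X], g.Monic → h.Monic → χ (g * h) = χ g * χ h) {Q : k[X]} (hQ : Q.Monic) (r : ℕ) :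
    (∑ g ∈ monics k r, if Q ∣ g then χ g else 0) =
      if Q.natDegree ≤ r then χ Q * ∑ h ∈ monics k (r - Q.natDegree), χ h else 0 := by
  rw [← Finset.sum_filter]
  split_ifs with hr
  · have : (monics k r).filter (Q ∣ ·) = (monics k (r - Q.natDegree)).image (Q * ·) := by
      ext g
      simp only [Finset.mem_filter, mem_monics, Finset.mem_image]
      constructor
      · rintro ⟨⟨hg, hd⟩, h, rfl⟩
        have hh := hQ.of_mul_monic_left hg
        rw [hQ.natDegree_mul hh] at hd
        exact ⟨h, ⟨hh, by omega⟩, rfl⟩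
      · rintro ⟨h, ⟨hh, hd⟩, rfl⟩
        exact ⟨⟨hQ.mul hh, by rw [hQ.natDegree_mul hh]; omega⟩, dvd_mul_right _ _⟩
    rw [this, Finset.sum_image fun a _ b _ h => mul_left_cancel₀ hQ.ne_zero h, Finset.mul_sum]
    exact Finset.sum_congr rfl fun h hh => hmul _ _ hQ (mem_monics.1 hh).1
  · refine Finset.sum_eq_zero fun g hg => ?_
    simp only [Finset.mem_filter, mem_monics] at hg
    exact absurd (hg.1.2 ▸ natDegree_le_of_dvd hg.2 hg.1.1.ne_zero) hr

/-- The logarithmic derivative of the Euler product. -/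
theorem mul_sum_monics {R : Type*} [CommRing R] (χ : k[X] → R) (h1 : χ 1 = 1)
    (hmul : ∀ g h : k[X], g.Monic → h.Monic → χ (g * h) = χ g * χ h) (r : ℕ) :
    (r : R) * ∑ g ∈ monics k r, χ g = ∑ s ∈ Finset.Icc 1 r,
      (∑ P ∈ monicPrimes k r, if P.natDegree ∣ s then P.natDegree * χ P ^ (s / P.natDegree) else 0) *
        ∑ h ∈ monics k (r - s), χ h := by
  classical
  calc (r : R) * ∑ g ∈ monics k r, χ g
      = ∑ g ∈ monics k r, ∑ P ∈ monicPrimes k r, ∑ j ∈ Finset.Icc 1 r,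
          P.natDegree * if P ^ j ∣ g then χ g else 0 := by
        rw [Finset.mul_sum]
        refine Finset.sum_congr rfl fun g hg => ?_
        conv_lhs => rw [natDegree_eq_sum_monicPrimes hg]
        simp only [Nat.cast_sum, Finset.sum_mul]
        refine Finset.sum_congr rfl fun P _ => Finset.sum_congr rfl fun j _ => ?_
        split_ifs <;> simp
    _ = ∑ P ∈ monicPrimes k r, ∑ j ∈ Finset.Icc 1 r,
          P.natDegree * if j * P.natDegree ≤ r then χ P ^ j *
            ∑ h ∈ monics k (r - j * P.natDegree), χ h else 0 := by
        rw [Finset.sum_comm]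
        refine Finset.sum_congr rfl fun P hP => ?_
        rw [Finset.sum_comm]
        refine Finset.sum_congr rfl fun j _ => ?_
        have hm := (mem_monicPrimes.1 hP).1
        rw [← Finset.mul_sum, sum_monics_dvd χ hmul (hm.pow j), natDegree_pow,
          char_pow χ h1 hmul hm]
    _ = ∑ P ∈ monicPrimes k r, ∑ s ∈ Finset.Icc 1 r, if P.natDegree ∣ s then
          P.natDegree * χ P ^ (s / P.natDegree) * ∑ h ∈ monics k (r - s), χ h else 0 := by
        refine Finset.sum_congr rfl fun P hP => ?_
        have hpos := (mem_monicPrimes.1 hP).2.1.natDegree_pos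
        simp only [mul_ite, mul_zero]
        rw [← Finset.sum_filter, ← Finset.sum_filter]
        refine Finset.sum_nbij' (· * P.natDegree) (· / P.natDegree) ?_ ?_ ?_ ?_ ?_
        · intro j hj
          simp only [Finset.mem_filter, Finset.mem_Icc] at hj ⊢
          exact ⟨⟨Nat.mul_pos hj.1.1 hpos, hj.2⟩, dvd_mul_left _ _⟩
        · intro s hs
          simp only [Finset.mem_filter, Finset.mem_Icc] at hs ⊢
          obtain ⟨⟨h1, h2⟩, j, rfl⟩ := hs
          rw [Nat.mul_div_cancel_left _ hpos, mul_comm]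
          exact ⟨⟨Nat.pos_of_mul_pos_left h1, (Nat.le_mul_of_pos_left _ hpos).trans h2⟩, h2⟩
        · intro j _; exact Nat.mul_div_cancel _ hpos
        · intro s hs
          exact Nat.div_mul_cancel (Finset.mem_filter.1 hs).2
        · intro j _
          rw [Nat.mul_div_cancel _ hpos, mul_assoc]
    _ = _ := by
        rw [Finset.sum_comm]
        refine Finset.sum_congr rfl fun s _ => ?_
        rw [Finset.sum_mul]
        refine Finset.sum_congr rfl fun P _ => ?_
        split_ifs <;> simp

end

theorem sum_minpoly_eq {k K R : Type*} [Field k] [Finite k] [Field K] [Fintype K] [Algebra k K]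
    [CommRing R] {r : ℕ} (hr : Module.finrank k K ≤ r) (F : k[X] → R) :
    ∑ α : K, F (minpoly k α) = ∑ P ∈ monicPrimes k r,
      if P.natDegree ∣ Module.finrank k K then P.natDegree * F P else 0 := by
  classical
  have hmaps : ∀ α ∈ (Finset.univ : Finset K), minpoly k α ∈ monicPrimes k r := by
    intro α _
    have hi := Algebra.IsIntegral.isIntegral (R := k) α
    rw [mem_monicPrimes]
    exact ⟨minpoly.monic hi, minpoly.irreducible hi, (minpoly.natDegree_le α).trans hr⟩
  rw [← Finset.sum_fiberwise_of_maps_to hmaps]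
  refine Finset.sum_congr rfl fun P hP => ?_
  obtain ⟨hm, hirr, -⟩ := mem_monicPrimes.1 hP
  rw [Finset.sum_congr rfl (g := fun _ => F P)
    (fun α hα => by rw [(Finset.mem_filter.1 hα).2]), Finset.sum_const, nsmul_eq_mul]
  split_ifs with hd
  · congr 2
    have h1 := hirr.natDegree_dvd_iff_dvd_X_pow_card_pow_sub_X.1 hd
    rw [← Module.natCard_eq_pow_finrank, Nat.card_eq_fintype_card] at h1
    have h2 : (P.map (algebraMap k K)).Splits := by
      have h3 := (FiniteField.isSplittingField_sub K k).splits
      refine h3.of_dvd ?_ (Polynomial.map_dvd _ h1)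
      simpa using FiniteField.X_pow_card_sub_X_ne_zero K Fintype.one_lt_card
    rw [← card_rootSet_eq_natDegree (PerfectField.separable_of_irreducible hirr) h2, ← Set.toFinset_card]
    congr 1
    ext α
    rw [Finset.mem_filter, Set.mem_toFinset, mem_rootSet]
    constructor
    · rintro ⟨-, rfl⟩; exact ⟨hm.ne_zero, minpoly.aeval k α⟩
    · rintro ⟨-, h⟩
      exact ⟨Finset.mem_univ _, (minpoly.eq_of_irreducible_of_monic hirr h hm).symm⟩
  · rw [Finset.card_eq_zero.2, Nat.cast_zero, zero_mul]
    refine Finset.filter_eq_empty_iff.2 fun α _ h => hd ?_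
    rw [← h]
    exact minpoly.degree_dvd (Algebra.IsIntegral.isIntegral (R := k) α)

/-- Traces of powers are multiples of the power sums of the conjugates. -/
theorem natCast_mul_powerSum_minpoly {k K : Type*} [Field k] [Finite k] [Field K] [Finite K]
    [Algebra k K] {α : K} {i : ℤ} (hi : i ≠ 0) (hα : i < 0 → α ≠ 0) :
    ((Module.finrank k K / (minpoly k α).natDegree : ℕ) : k) * powerSum (minpoly k α) i
      = Algebra.trace k K (α ^ i) := by
  open IntermediateField in
  have hintegral := Algebra.IsIntegral.isIntegral (R := k) α
  have hm := minpoly.monic hintegral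
  let E := AlgebraicClosure k
  have hcoeff : i < 0 → (minpoly k α).coeff 0 ≠ 0 := fun h =>
    minpoly.coeff_zero_ne_zero hintegral (hα h)
  have hpow : powerSum (minpoly k α) i = Algebra.trace k k⟮α⟯ (AdjoinSimple.gen k α ^ i) := by
    apply (algebraMap k E).injective
    rw [← powerSum_map _ hm hcoeff, trace_eq_sum_embeddings E]
    have hsp := IsAlgClosed.splits ((minpoly k α).map (algebraMap k E))
    rw [hsp.eq_prod_roots_of_monic (hm.map _), powerSum_prod_X_sub_C _ hi]
    · let pb := IntermediateField.adjoin.powerBasis hintegral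
      have hgen : minpoly k pb.gen = minpoly k α := by
        rw [IntermediateField.adjoin.powerBasis_gen, minpoly_gen]
      have hsep : ((minpoly k α).aroots E).Nodup :=
        nodup_roots (PerfectField.separable_of_irreducible (minpoly.irreducible hintegral)).map
      classical
      let _ := Fintype.ofEquiv _ (pb.liftEquiv' (B := E))
      have h2 : (((minpoly k α).aroots E).map fun x => x ^ i).sum
          = ∑ y : {y // y ∈ (minpoly k pb.gen).aroots E}, (y : E) ^ i := by
        rw [← Finset.sum_subtype ((minpoly k α).aroots E).toFinset (by simp [hgen])
          (fun y => y ^ i), Finset.sum, Multiset.toFinset_val, hsep.dedup]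
      change (((minpoly k α).aroots E).map fun x => x ^ i).sum = _
      rw [h2]
      rw [← Equiv.sum_comp pb.liftEquiv']
      refine Finset.sum_congr rfl fun σ _ => ?_
      rw [map_zpow₀, PowerBasis.liftEquiv'_apply_coe, IntermediateField.adjoin.powerBasis_gen]
    · intro h h0
      rw [mem_roots (hm.map _).ne_zero, IsRoot, ← coeff_zero_eq_eval_zero, coeff_map] at h0
      exact hcoeff h ((map_eq_zero _).1 h0)
  have h1 : α ^ i = algebraMap k⟮α⟯ K (AdjoinSimple.gen k α ^ i) := by
    rw [map_zpow₀, AdjoinSimple.algebraMap_gen]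
  rw [h1, ← Algebra.trace_trace (S := k⟮α⟯), Algebra.trace_algebraMap, map_nsmul, ← hpow,
    nsmul_eq_mul]
  congr 2
  rw [← IntermediateField.adjoin.finrank hintegral, ← Module.finrank_mul_finrank k k⟮α⟯ K,
    Nat.mul_div_cancel_left _ Module.finrank_pos]

theorem sum_eq_sum_units_add {K M : Type*} [Field K] [Fintype K] [DecidableEq K]
    [AddCommMonoid M] (f : K → M) : ∑ α : K, f α = (∑ u : Kˣ, f u) + f 0 := by
  have h : ∑ u : Kˣ, f u = ∑ α ∈ Finset.univ.erase 0, f α :=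
    Finset.sum_bij (fun u _ => (u : K)) (by simp) (fun u _ v _ h => Units.ext h)
      (fun x hx => ⟨Units.mk0 x (Finset.ne_of_mem_erase hx), Finset.mem_univ _, rfl⟩) (by simp)
  rw [h, Finset.sum_erase_add _ _ (Finset.mem_univ 0)]

/-- The multiplicative function on monic polynomials attached to the exponential sum of
`a x + b x ^ l`. -/
noncomputable def binomialChar {k : Type*} [Field k] (ψ : AddChar k ℂ) (a b : k) (l : ℤ)
    (g : k[X]) : ℂ :=
  open Classical in
  if l < 0 ∧ g.coeff 0 = 0 then 0 else ψ (a * powerSum g 1 + b * powerSum g l)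

section

variable {k : Type*} [Field k] (ψ : AddChar k ℂ) (a b : k) (l : ℤ)

theorem binomialChar_one : binomialChar ψ a b l (1 : k[X]) = 1 := by
  simp [binomialChar, powerSum_one]

theorem binomialChar_mul (g h : k[X]) (hg : g.Monic) (hh : h.Monic) :
    binomialChar ψ a b l (g * h) = binomialChar ψ a b l g * binomialChar ψ a b l h := by
  unfold binomialChar
  rw [mul_coeff_zero]
  by_cases h1 : l < 0 ∧ g.coeff 0 = 0
  · rw [if_pos h1, if_pos ⟨h1.1, by rw [h1.2, zero_mul]⟩, zero_mul]
  by_cases h2 : l < 0 ∧ h.coeff 0 = 0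
  · rw [if_pos h2, if_pos ⟨h2.1, by rw [h2.2, mul_zero]⟩, mul_zero]
  rw [if_neg h1, if_neg h2, if_neg, powerSum_mul hg hh (by simp) (by simp),
    powerSum_mul hg hh (fun h h' => h1 ⟨h, h'⟩) (fun h h' => h2 ⟨h, h'⟩), ← AddChar.map_add_eq_mul]
  · congr 1; ring
  · rintro ⟨h3, h4⟩
    rcases mul_eq_zero.1 h4 with h | h
    · exact h1 ⟨h3, h⟩
    · exact h2 ⟨h3, h⟩

variable [Finite k]

theorem sum_monics_eq_zero {r j : ℕ} (hj : j < r) (χ : k[X] → ℂ) (δ : k) (z : ℂ) (hz : z ≠ 1)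
    (h : ∀ g ∈ monics k r, χ (g + C δ * X ^ j) = z * χ g) : ∑ g ∈ monics k r, χ g = 0 := by
  have hmem : ∀ (δ : k), ∀ g ∈ monics k r, g + C δ * X ^ j ∈ monics k r := by
    intro δ g hg
    rw [mem_monics] at hg ⊢
    have h1 : j < g.natDegree := hg.2 ▸ hj
    exact ⟨monic_add_C_mul_X_pow hg.1 δ h1, (natDegree_add_C_mul_X_pow δ h1).trans hg.2⟩
  have h1 : ∑ g ∈ monics k r, χ (g + C δ * X ^ j) = ∑ g ∈ monics k r, χ g :=
    Finset.sum_nbij' (fun g => g + C δ * X ^ j) (fun g => g + C (-δ) * X ^ j) (hmem δ)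
      (hmem (-δ)) (fun g _ => by simp) (fun g _ => by simp) (fun g _ => rfl)
  rw [Finset.sum_congr rfl h, ← Finset.mul_sum] at h1
  by_contra h0
  exact hz (mul_right_cancel₀ h0 (h1.trans (one_mul _).symm))

theorem sum_monics_binomialChar_eq_zero (hψ : ψ ≠ 1) {a b : k} (ha : a ≠ 0) (hb : b ≠ 0) {l : ℤ}
    (hl0 : l ≠ 0) (hl1 : l ≠ 1) (hl : (l : k) ≠ 0) {r : ℕ} (hr : (l - 1).natAbs < r) :
    ∑ g ∈ monics k r, binomialChar ψ a b l g = 0 := by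
  obtain ⟨t, ht⟩ := AddChar.ne_one_iff.1 hψ
  rcases lt_or_gt_of_ne hl0 with hneg | hpos
  · obtain ⟨m, rfl⟩ : ∃ m : ℕ, l = -m := ⟨(-l).toNat, by omega⟩
    refine sum_monics_eq_zero (j := r - 1) (by omega) _ (-(t / a)) (ψ t) ht fun g hg => ?_
    obtain ⟨hm, rfl⟩ := mem_monics.1 hg
    have hc : (g + C (-(t / a)) * X ^ (g.natDegree - 1)).coeff 0 = g.coeff 0 := by
      rw [coeff_add, coeff_C_mul_X_pow, if_neg (by omega), add_zero]
    unfold binomialChar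
    rw [hc]
    by_cases h1 : (-m : ℤ) < 0 ∧ g.coeff 0 = 0
    · rw [if_pos h1, if_pos h1, mul_zero]
    · have h2 := powerSum_add_C_mul_X_pow hm (-(t / a)) one_ne_zero (by omega) (le_refl 1)
      rw [Nat.cast_one, if_pos rfl] at h2
      rw [if_neg h1, if_neg h1, h2, powerSum_neg_add_C_mul_X_pow (fun h => h1 ⟨hneg, h⟩) _
        (by omega) (by omega), ← AddChar.map_add_eq_mul]
      congr 1
      field_simp
      push_cast
      ring
  · obtain ⟨m, rfl⟩ := Int.eq_ofNat_of_zero_le hpos.le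
    have hm0 : (m : k) ≠ 0 := by exact_mod_cast hl
    refine sum_monics_eq_zero (j := r - m) (by omega) _ (-(t / (b * m))) (ψ t) ht fun g hg => ?_
    obtain ⟨hm, rfl⟩ := mem_monics.1 hg
    have h1 := powerSum_add_C_mul_X_pow hm (-(t / (b * m))) (m := m) (j := 1) (by omega)
      (by omega) (by omega)
    have h2 := powerSum_add_C_mul_X_pow hm (-(t / (b * m))) (m := m) (j := m) (by omega)
      (by omega) le_rfl
    rw [if_neg (by omega), sub_zero, Nat.cast_one] at h1
    rw [if_pos rfl] at h2
    unfold binomialChar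
    rw [if_neg (by omega), if_neg (by omega), h1, h2, ← AddChar.map_add_eq_mul]
    congr 1
    field_simp
    ring

theorem sum_binomialChar_minpoly {K : Type*} [Field K] [Fintype K] [DecidableEq K] [Algebra k K]
    {l : ℤ} (hl : l ≠ 0) {r : ℕ} (hr : Module.finrank k K ≤ r) :
    (∑ P ∈ monicPrimes k r, if P.natDegree ∣ Module.finrank k K then
      P.natDegree * binomialChar ψ a b l P ^ (Module.finrank k K / P.natDegree) else 0)
    = ∑ u : Kˣ, ψ (Algebra.trace k K (a • (u : K) + b • ((u ^ l : Kˣ) : K)))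
      + if l < 0 then 0 else 1 := by
  have hα : ∀ α : K, (l < 0 → α ≠ 0) → binomialChar ψ a b l (minpoly k α) ^
      (Module.finrank k K / (minpoly k α).natDegree)
      = ψ (Algebra.trace k K (a • α + b • α ^ l)) := by
    intro α h
    have hintegral := Algebra.IsIntegral.isIntegral (R := k) α
    rw [binomialChar, if_neg fun h' => minpoly.coeff_zero_ne_zero hintegral (h h'.1) h'.2,
      ← AddChar.map_nsmul_eq_pow, nsmul_eq_mul, map_add, map_smul, map_smul,
      ← natCast_mul_powerSum_minpoly hl h]
    have h1 := natCast_mul_powerSum_minpoly (k := k) (α := α) (i := 1) one_ne_zero (by simp)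
    rw [zpow_one] at h1
    rw [← h1]
    congr 1
    simp only [smul_eq_mul]
    ring
  rw [← sum_minpoly_eq hr (fun P => binomialChar ψ a b l P ^ (Module.finrank k K / P.natDegree)),
    sum_eq_sum_units_add]
  congr 1
  · refine Finset.sum_congr rfl fun u _ => ?_
    rw [hα u fun _ => u.ne_zero, Units.val_zpow_eq_zpow_val]
  · split_ifs with h
    · have hf : Module.finrank k K ≠ 0 := Module.finrank_pos.ne'
      rw [binomialChar, if_pos ⟨h, by simp [minpoly.zero]⟩, minpoly.zero, natDegree_X,
        Nat.div_one, zero_pow hf]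
    · rw [hα 0 fun h' => absurd h' h, zero_zpow _ hl]
      simp

/-- The `L`-function of the binomial sums is a polynomial of degree at most `|l - 1|`. -/
theorem exists_lFunction (p : ℕ) [Fact p.Prime] (ψ : AddChar (ZMod p) ℂ) (hψ : ψ ≠ 1)
    {a b : ZMod p} (ha : a ≠ 0) (hb : b ≠ 0) {l : ℤ} (hl0 : l ≠ 0) (hl1 : l ≠ 1)
    (hl : (l : ZMod p) ≠ 0) :
    ∃ c S : ℕ → ℂ, c 0 = 1 ∧ (∀ r, (l - 1).natAbs < r → c r = 0) ∧
      (∀ r : ℕ, r * c r = ∑ s ∈ Finset.Icc 1 r, S s * c (r - s)) ∧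
      ∀ (K : Type) [Field K] [Fintype K] [DecidableEq K] [Algebra (ZMod p) K],
        S (Module.finrank (ZMod p) K) =
          ∑ u : Kˣ, ψ (Algebra.trace (ZMod p) K (a • (u : K) + b • ((u ^ l : Kˣ) : K)))
            + if l < 0 then 0 else 1 := by
  classical
  refine ⟨fun r => ∑ g ∈ monics (ZMod p) r, binomialChar ψ a b l g, fun s =>
    ∑ P ∈ monicPrimes (ZMod p) s, if P.natDegree ∣ s then
      P.natDegree * binomialChar ψ a b l P ^ (s / P.natDegree) else 0, ?_,
    fun r hr => sum_monics_binomialChar_eq_zero ψ hψ ha hb hl0 hl1 hl hr, fun r => ?_,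
    fun K _ _ _ _ => sum_binomialChar_minpoly ψ a b hl0 le_rfl⟩
  · simp [monics_zero, binomialChar_one]
  · rw [mul_sum_monics _ (binomialChar_one ψ a b l) (binomialChar_mul ψ a b l)]
    refine Finset.sum_congr rfl fun s hs => ?_
    rw [Finset.mem_Icc] at hs
    have : Fintype (GaloisField p s) := Fintype.ofFinite _
    have hfin : Module.finrank (ZMod p) (GaloisField p s) = s := GaloisField.finrank p (by omega)
    have h1 := sum_binomialChar_minpoly ψ a b (K := GaloisField p s) hl0 (r := r) (hfin.trans_le hs.2)
    have h2 := sum_binomialChar_minpoly ψ a b (K := GaloisField p s) hl0 (r := s) hfin.le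
    rw [hfin] at h1 h2
    beta_reduce
    rw [h1, h2]

end

theorem norm_le_of_norm_sum_pow_le (B : Multiset ℂ) {M R : ℝ} (hR : 0 < R) (m₀ : ℕ)
    (h : ∀ m ≥ m₀, ‖(B.map (· ^ m)).sum‖ ≤ M * R ^ m) : ∀ β ∈ B, ‖β‖ ≤ R := by
  classical
  intro β hβ
  set q : ℂ[X] := ∏ γ ∈ B.toFinset.erase β, (X - C γ) with hq
  have hqβ : q.eval β ≠ 0 := by
    rw [hq, eval_prod, Finset.prod_ne_zero_iff]
    intro γ hγ
    rw [eval_sub, eval_X, eval_C, sub_ne_zero]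
    exact (Finset.ne_of_mem_erase hγ).symm
  have hq0 : ∀ γ ∈ B.toFinset, γ ≠ β → q.eval γ = 0 := by
    intro γ hγ hne
    rw [hq, eval_prod]
    exact Finset.prod_eq_zero (Finset.mem_erase.2 ⟨hne, hγ⟩) (by simp)
  have key : ∀ r : ℕ, ∑ j ∈ Finset.range (q.natDegree + 1), q.coeff j * (B.map (· ^ (r + j))).sum
      = B.count β * (β ^ r * q.eval β) := by
    intro r
    calc _ = ∑ γ ∈ B.toFinset, B.count γ * (γ ^ r * q.eval γ) := by
          simp only [Finset.sum_multiset_map_count, nsmul_eq_mul, Finset.mul_sum, eval_eq_sum_range]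
          rw [Finset.sum_comm]
          refine Finset.sum_congr rfl fun γ _ => Finset.sum_congr rfl fun j _ => ?_
          ring
      _ = _ := Finset.sum_eq_single β (fun γ hγ hne => by rw [hq0 γ hγ hne]; ring)
          fun hn => absurd (Multiset.mem_toFinset.2 hβ) hn
  have hcount : (0 : ℝ) < B.count β := by exact_mod_cast Multiset.count_pos.2 hβ
  have hbound : ∀ r ≥ m₀, (‖β‖ / R) ^ r ≤
      (∑ j ∈ Finset.range (q.natDegree + 1), ‖q.coeff j‖ * (M * R ^ j))
        / (B.count β * ‖q.eval β‖) := by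
    intro r hr
    have h1 := congrArg norm (key r)
    rw [norm_mul, norm_mul, norm_pow, Complex.norm_natCast] at h1
    rw [le_div_iff₀ (mul_pos hcount (norm_pos_iff.2 hqβ)), div_pow, div_mul_eq_mul_div,
      div_le_iff₀ (by positivity)]
    calc ‖β‖ ^ r * (B.count β * ‖q.eval β‖)
        = ‖∑ j ∈ Finset.range (q.natDegree + 1), q.coeff j * (B.map (· ^ (r + j))).sum‖ := by
          rw [h1]; ring
      _ ≤ ∑ j ∈ Finset.range (q.natDegree + 1), ‖q.coeff j‖ * (M * R ^ (r + j)) := by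
          refine norm_sum_le_of_le _ fun j _ => ?_
          rw [norm_mul]
          exact mul_le_mul_of_nonneg_left (h _ (by omega)) (norm_nonneg _)
      _ = _ := by
          rw [Finset.sum_mul]
          refine Finset.sum_congr rfl fun j _ => ?_
          ring
  by_contra! hlt
  have h1 : 1 < ‖β‖ / R := (one_lt_div hR).2 hlt
  obtain ⟨n, hn⟩ := pow_unbounded_of_one_lt _ h1
  exact absurd (hbound (n + m₀) (by omega))
    (not_le.2 (hn.trans_le (pow_le_pow_right₀ h1.le (by omega))))

/-- A sequence satisfying the Newton identities of a polynomial consists of (negated) power sums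
of its inverse roots. -/
theorem exists_multiset_of_newton {c S : ℕ → ℂ} {D : ℕ} (h0 : c 0 = 1) (hD : ∀ r, D < r → c r = 0)
    (hrec : ∀ r : ℕ, r * c r = ∑ s ∈ Finset.Icc 1 r, S s * c (r - s)) :
    ∃ B : Multiset ℂ, B.card ≤ D ∧ ∀ m ≠ 0, S m = -(B.map (· ^ m)).sum := by
  set A : ℂ[X] := ∑ r ∈ Finset.range (D + 1), C (c r) * X ^ r with hA
  have hcoeff : ∀ r, A.coeff r = c r := by
    intro r
    rw [hA, finsetSum_coeff]
    simp only [coeff_C_mul_X_pow]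
    rw [Finset.sum_ite_eq]
    split_ifs with h
    · rfl
    · exact (hD r (by simpa using h)).symm
  have hA0 : A ≠ 0 := fun h => by
    have := hcoeff 0
    rw [h, h0] at this
    simp at this
  have hdeg : A.natDegree ≤ D := natDegree_le_iff_coeff_eq_zero.2 fun r hr => by
    rw [hcoeff, hD r hr]
  have hroot : ∀ α ∈ A.roots, α ≠ 0 := by
    rintro α hα rfl
    have h := (mem_roots hA0).1 hα
    rw [IsRoot, ← coeff_zero_eq_eval_zero, hcoeff, h0] at h
    exact one_ne_zero h
  have hprod : A = C (A.leadingCoeff * (A.roots.map fun α => -α).prod)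
      * (A.roots.map fun α => 1 - C α⁻¹ * X).prod := by
    conv_lhs => rw [(IsAlgClosed.splits A).eq_prod_roots]
    rw [C_mul, mul_assoc, map_multiset_prod, Multiset.map_map, ← Multiset.prod_map_mul]
    congr 2
    refine Multiset.map_congr rfl fun α hα => ?_
    have h := hroot α hα
    have h2 : (C α : ℂ[X]) * C α⁻¹ = 1 := by rw [← C_mul, mul_inv_cancel₀ h, C_1]
    simp only [Function.comp_apply, C_neg]
    linear_combination (-X) * h2
  have hlead : A.leadingCoeff * (A.roots.map fun α => -α).prod ≠ 0 := by
    refine mul_ne_zero (leadingCoeff_ne_zero.2 hA0) (Multiset.prod_ne_zero fun h => ?_)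
    obtain ⟨α, hα, h⟩ := Multiset.mem_map.1 h
    exact hroot α hα (neg_eq_zero.1 h)
  refine ⟨A.roots.map (·⁻¹), by
    rw [Multiset.card_map]; exact (card_roots' A).trans hdeg, fun m hm => ?_⟩
  have h1 : negLogDeriv (A : PowerSeries ℂ) =
      ((A.roots.map (·⁻¹)).map fun ω => PowerSeries.mk fun m => if m = 0 then 0 else ω ^ m).sum := by
    have hne : ∀ u ∈ A.roots.map fun α => 1 - PowerSeries.C α⁻¹ * PowerSeries.X,
        PowerSeries.constantCoeff u ≠ 0 := by
      intro u hu
      obtain ⟨α, -, rfl⟩ := Multiset.mem_map.1 hu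
      simp
    have : (A : PowerSeries ℂ) = PowerSeries.C (A.leadingCoeff * (A.roots.map fun α => -α).prod)
        * (A.roots.map fun α => 1 - PowerSeries.C α⁻¹ * PowerSeries.X).prod := by
      conv_lhs => rw [hprod]
      rw [coe_mul, coe_C]
      congr 1
      rw [← coeToPowerSeries.ringHom_apply, map_multiset_prod, Multiset.map_map]
      congr 1
      refine Multiset.map_congr rfl fun α _ => ?_
      simp
    rw [this, negLogDeriv_mul (by simpa using hlead), negLogDeriv_C, zero_add,
      negLogDeriv_multiset_prod _ hne, Multiset.map_map, Multiset.map_map]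
    · congr 1
      refine Multiset.map_congr rfl fun α _ => ?_
      exact negLogDeriv_one_sub α⁻¹
    · rw [map_multiset_prod]
      refine Multiset.prod_ne_zero fun h => ?_
      obtain ⟨u, hu, h⟩ := Multiset.mem_map.1 h
      exact hne u hu h
  have h2 : negLogDeriv (A : PowerSeries ℂ) = -PowerSeries.mk fun m => if m = 0 then 0 else S m := by
    have hc : PowerSeries.constantCoeff (A : PowerSeries ℂ) ≠ 0 := by
      rw [← PowerSeries.coeff_zero_eq_constantCoeff_apply, coeff_coe, hcoeff, h0]
      exact one_ne_zero
    have h3 : PowerSeries.X * PowerSeries.derivative ℂ (A : PowerSeries ℂ) =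
        (PowerSeries.mk fun m => if m = 0 then 0 else S m) * (A : PowerSeries ℂ) := by
      ext r
      have hl : PowerSeries.coeff r (PowerSeries.X * PowerSeries.derivative ℂ (A : PowerSeries ℂ))
          = r * c r := by
        rcases r with _ | r
        · simp
        · rw [PowerSeries.coeff_succ_X_mul, PowerSeries.coeff_derivative, coeff_coe, hcoeff]
          push_cast
          ring
      rw [hl, hrec, PowerSeries.coeff_mul, Finset.Nat.sum_antidiagonal_eq_sum_range_succ_mk,
        Finset.sum_range_succ']
      simp only [PowerSeries.coeff_mk, coeff_coe, hcoeff, if_true, zero_mul, add_zero,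
        Nat.succ_ne_zero, if_false]
      rw [Finset.range_eq_Ico, Finset.sum_Ico_add' (fun s => S s * c (r - s)) 0 r 1]
      rfl
    rw [negLogDeriv, h3, mul_assoc, PowerSeries.mul_inv_cancel _ hc, mul_one]
  have h3 := congrArg (PowerSeries.coeff m) (h2.symm.trans h1)
  rw [map_multiset_sum, Multiset.map_map, map_neg, PowerSeries.coeff_mk, if_neg hm] at h3
  rw [neg_eq_iff_eq_neg.1 h3]
  congr 2
  refine Multiset.map_congr rfl fun ω _ => ?_
  simp [hm]

theorem norm_le_of_newton {c S : ℕ → ℂ} {D : ℕ} (h0 : c 0 = 1) (hD : ∀ r, D < r → c r = 0)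
    (hrec : ∀ r : ℕ, r * c r = ∑ s ∈ Finset.Icc 1 r, S s * c (r - s)) {q C : ℝ} (hq : 0 < q)
    (m₀ : ℕ) (hS : ∀ m ≥ m₀, ‖S (2 * m)‖ ≤ C * q ^ m) : ‖S 1‖ ≤ D * √q := by
  obtain ⟨B, hB, h⟩ := exists_multiset_of_newton h0 hD hrec
  have h1 : ∀ β ∈ B.map (· ^ 2), ‖β‖ ≤ q := by
    refine norm_le_of_norm_sum_pow_le (M := C) _ hq (m₀ + 1) fun m hm => ?_
    have h2 := hS m (by omega)
    rw [h _ (by omega), norm_neg] at h2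
    rw [Multiset.map_map]
    simpa only [Function.comp_def, ← pow_mul] using h2
  have h2 : ∀ ω ∈ B, ‖ω‖ ≤ √q := fun ω hω =>
    Real.le_sqrt_of_sq_le ((norm_pow ω 2).symm.trans_le (h1 _ (Multiset.mem_map_of_mem _ hω)))
  rw [h 1 one_ne_zero, norm_neg]
  simp only [pow_one, Multiset.map_id']
  calc ‖B.sum‖ ≤ (B.map norm).sum := norm_multiset_sum_le B
    _ ≤ (B.map norm).card • √q := Multiset.sum_le_card_nsmul _ _ fun x hx => by
        obtain ⟨ω, hω, rfl⟩ := Multiset.mem_map.1 hx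
        exact h2 ω hω
    _ ≤ D * √q := by
        rw [Multiset.card_map, nsmul_eq_mul]
        gcongr

theorem laurentEval_binomial {F K : Type*} [Field F] [Field K] [Algebra F K] (a b : F) {l : ℤ}
    (hl1 : l ≠ 1) {s e : ℕ} (hs : -(s : ℤ) ≤ l) (hle : l ≤ e) (he : 1 ≤ e) (u : Kˣ) :
    laurentEval (fun i => if i = 1 then a else if i = l then b else 0) s e u
      = a • (u : K) + b • ((u ^ l : Kˣ) : K) := by
  have h1 : (1 : ℤ) ∈ Finset.Icc (-(s : ℤ)) e := Finset.mem_Icc.2 ⟨by omega, by omega⟩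
  have h2 : l ∈ (Finset.Icc (-(s : ℤ)) e).erase 1 :=
    Finset.mem_erase.2 ⟨hl1, Finset.mem_Icc.2 ⟨hs, hle⟩⟩
  rw [laurentEval, ← Finset.add_sum_erase _ _ h1, ← Finset.add_sum_erase _ _ h2,
    Finset.sum_eq_zero, if_pos rfl, if_neg hl1, if_pos rfl, add_zero, zpow_one]
  intro i hi
  rw [Finset.mem_erase, Finset.mem_erase] at hi
  rw [if_neg hi.2.1, if_neg hi.1, zero_smul]

/-- The Weil bound for binomial sums, in all large extensions of even degree, with an unspecified
constant. -/
theorem exists_norm_sum_binomial_le (p : ℕ) [hp : Fact p.Prime] (ψ : AddChar (ZMod p) ℂ) (hψ : ψ ≠ 1) {a b : ZMod p}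
    (ha : a ≠ 0) (hb : b ≠ 0) {l : ℤ} (hl0 : l ≠ 0) (hl1 : l ≠ 1) (hl : (l : ZMod p) ≠ 0) :
    ∃ C m₀ : ℕ, ∀ m ≥ m₀, ∀ (F : Type) [Field F] [Fintype F] [DecidableEq F] [Algebra (ZMod p) F],
      Fintype.card F = (p ^ (m + 1)) ^ 2 →
      ‖∑ u : Fˣ, ψ (Algebra.trace (ZMod p) F (a • (u : F) + b • ((u ^ l : Fˣ) : F)))‖
        ≤ C * p ^ (m + 1) := by
  obtain ⟨s, e, hs, hle, he, hce, hpe⟩ : ∃ s e : ℕ, -(s : ℤ) ≤ l ∧ l ≤ e ∧ 1 ≤ e ∧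
      (if (e : ℤ) = 1 then a else if (e : ℤ) = l then b else 0) ≠ 0 ∧ Nat.Coprime p e := by
    rcases lt_or_gt_of_ne hl0 with h | h
    · exact ⟨l.natAbs, 1, by omega, by omega, le_rfl, by simpa using ha, Nat.coprime_one_right p⟩
    · obtain ⟨e, rfl⟩ := Int.eq_ofNat_of_zero_le h.le
      refine ⟨0, e, by omega, le_rfl, by omega, ?_, ?_⟩
      · rw [if_neg hl1, if_pos rfl]
        exact hb
      · rw [Nat.Prime.coprime_iff_not_dvd hp.out, ← ZMod.natCast_eq_zero_iff]
        exact_mod_cast hl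
  obtain ⟨C, m₀, h⟩ := exists_norm_sum_le p ψ hψ
    (fun i => if i = 1 then a else if i = l then b else 0) s e hce he hpe
  refine ⟨C, m₀, fun m hm F _ _ _ _ hF => ?_⟩
  have := h m hm F hF
  simpa only [laurentEval_binomial a b hl1 hs hle he] using this

/-- The Weil bound for binomial exponential sums. -/
theorem norm_sum_binomial_le (p : ℕ) [hp : Fact p.Prime] (ψ : AddChar (ZMod p) ℂ) (hψ : ψ ≠ 1) {a b : ZMod p}
    (ha : a ≠ 0) (hb : b ≠ 0) {l : ℤ} (hl0 : l ≠ 0) (hl1 : l ≠ 1) (hl : (l : ZMod p) ≠ 0) :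
    ‖∑ u : (ZMod p)ˣ, ψ (a * u + b * ((u ^ l : (ZMod p)ˣ) : ZMod p))‖
      ≤ (l - 1).natAbs * √p + 1 := by
  have hp0 : (0 : ℝ) < p := by exact_mod_cast hp.out.pos
  obtain ⟨c, S, h0, hD, hrec, hS⟩ := exists_lFunction p ψ hψ ha hb hl0 hl1 hl
  obtain ⟨C, m₀, hC⟩ := exists_norm_sum_binomial_le p ψ hψ ha hb hl0 hl1 hl
  have hε : ‖(if l < 0 then 0 else 1 : ℂ)‖ ≤ 1 := by split_ifs <;> simp
  have h1 : ‖S 1‖ ≤ (l - 1).natAbs * √p := by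
    refine norm_le_of_newton (C := C + 1) h0 hD hrec hp0 (m₀ + 1) fun m hm => ?_
    obtain ⟨m, rfl⟩ : ∃ n, m = n + 1 := ⟨m - 1, by omega⟩
    classical
    have : Fintype (GaloisField p (2 * (m + 1))) := Fintype.ofFinite _
    have h2 := hS (GaloisField p (2 * (m + 1)))
    rw [GaloisField.finrank p (by omega)] at h2
    have h3 := hC m (by omega) (GaloisField p (2 * (m + 1))) (by
      rw [← Nat.card_eq_fintype_card, GaloisField.card p _ (by omega), ← pow_mul, mul_comm])
    have h4 : (1 : ℝ) ≤ (p : ℝ) ^ (m + 1) := one_le_pow₀ (by exact_mod_cast hp.out.one_le)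
    rw [h2]
    refine (norm_add_le _ _).trans ?_
    rw [add_mul, one_mul]
    exact add_le_add h3 (hε.trans h4)
  have h2 := hS (ZMod p)
  rw [Module.finrank_self] at h2
  simp only [Algebra.trace_self_apply, smul_eq_mul] at h2
  rw [eq_sub_of_add_eq h2.symm]
  exact (norm_sub_le _ _).trans (add_le_add h1 hε)

theorem sum_sum_sum_comm {ι κ M : Type*} [Fintype κ] [AddCommMonoid M] (s : Finset ι)
    (f : κ → κ → ι → M) : ∑ a, ∑ b, ∑ x ∈ s, f a b x = ∑ x ∈ s, ∑ a, ∑ b, f a b x := by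
  rw [Finset.sum_congr rfl fun a _ => Finset.sum_comm, Finset.sum_comm]

theorem sq_mul_le_of_sum_eq_zero {ι : Type*} [Fintype ι] [DecidableEq ι] (o : ι) {X Y : ι → ℂ}
    {S : ι → ι → ℂ} {H W q M : ℝ} (hS : ∑ a, ∑ b, X a * Y b * S a b = 0) (hH : 0 ≤ H) (hM : 0 ≤ M)
    (hX₀ : X o = H) (hY₀ : Y o = H) (hX : ∑ a, ‖X a‖ ≤ W) (hY : ∑ a, ‖Y a‖ ≤ W)
    (hS₀ : S o o = q) (hS₁ : ∀ a ≠ o, ‖S a o‖ ≤ 1) (hS₂ : ∀ b ≠ o, ‖S o b‖ ≤ 1)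
    (hS₃ : ∀ a ≠ o, ∀ b ≠ o, ‖S a b‖ ≤ M) :
    H ^ 2 * q ≤ 2 * H * (W - H) + (W - H) ^ 2 * M := by
  have hnH : ‖(H : ℂ)‖ = H := by rw [Complex.norm_real, Real.norm_of_nonneg hH]
  have hX' : ∑ a ∈ Finset.univ.erase o, ‖X a‖ ≤ W - H := by
    rw [← Finset.sum_erase_add _ _ (Finset.mem_univ o), hX₀, hnH] at hX
    linarith
  have hY' : ∑ a ∈ Finset.univ.erase o, ‖Y a‖ ≤ W - H := by
    rw [← Finset.sum_erase_add _ _ (Finset.mem_univ o), hY₀, hnH] at hY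
    linarith
  have hWH : 0 ≤ W - H := (Finset.sum_nonneg fun _ _ => norm_nonneg _).trans hX'
  have h1 : ∀ a ≠ o, ‖∑ b, X a * Y b * S a b‖ ≤ ‖X a‖ * ((W - H) * M + H) := by
    intro a ha
    have : ∑ b, X a * Y b * S a b = X a * (∑ b ∈ Finset.univ.erase o, Y b * S a b + H * S a o) := by
      rw [← Finset.sum_erase_add _ _ (Finset.mem_univ o), hY₀, mul_add, Finset.mul_sum]
      simp only [mul_assoc]
    rw [this, norm_mul]
    refine mul_le_mul_of_nonneg_left ((norm_add_le _ _).trans (add_le_add ?_ ?_)) (norm_nonneg _)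
    · refine (norm_sum_le _ _).trans (le_trans ?_ (mul_le_mul_of_nonneg_right hY' hM))
      rw [Finset.sum_mul]
      refine Finset.sum_le_sum fun b hb => ?_
      rw [norm_mul]
      exact mul_le_mul_of_nonneg_left (hS₃ a ha b (Finset.ne_of_mem_erase hb)) (norm_nonneg _)
    · rw [norm_mul, hnH]
      exact mul_le_of_le_one_right hH (hS₁ a ha)
  have h2 : ‖∑ b ∈ Finset.univ.erase o, H * Y b * S o b‖ ≤ H * (W - H) := by
    refine (norm_sum_le _ _).trans (le_trans ?_ (mul_le_mul_of_nonneg_left hY' hH))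
    rw [Finset.mul_sum]
    refine Finset.sum_le_sum fun b hb => ?_
    rw [norm_mul, norm_mul, hnH]
    exact mul_le_of_le_one_right (by positivity) (hS₂ b (Finset.ne_of_mem_erase hb))
  have h3 : ‖∑ a ∈ Finset.univ.erase o, ∑ b, X a * Y b * S a b‖
      ≤ (W - H) * ((W - H) * M + H) := by
    refine (norm_sum_le _ _).trans (le_trans ?_ (mul_le_mul_of_nonneg_right hX' (by positivity)))
    rw [Finset.sum_mul]
    exact Finset.sum_le_sum fun a ha => h1 a (Finset.ne_of_mem_erase ha)
  rw [← Finset.sum_erase_add _ _ (Finset.mem_univ o), ← Finset.sum_erase_add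
    Finset.univ (fun b => X o * Y b * S o b) (Finset.mem_univ o), hX₀, hY₀, hS₀, ← add_assoc] at hS
  have h4 : ((H ^ 2 * q : ℝ) : ℂ) = -(∑ a ∈ Finset.univ.erase o, ∑ b, X a * Y b * S a b
      + ∑ b ∈ Finset.univ.erase o, H * Y b * S o b) := by
    rw [eq_neg_iff_add_eq_zero, ← hS]
    push_cast
    ring
  have h5 := (norm_add_le _ _).trans (add_le_add h3 h2)
  rw [← norm_neg, ← h4, Complex.norm_real] at h5
  nlinarith [le_abs_self (H ^ 2 * q), Real.norm_eq_abs (H ^ 2 * q)]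

section

variable {p : ℕ} [hp : Fact p.Prime] {ψ : AddChar (ZMod p) ℂ}

theorem zpow_bijective_of_gcd_eq_one {k : ℤ} (hk : Int.gcd k ((p : ℤ) - 1) = 1) :
    Function.Bijective fun u : (ZMod p)ˣ => u ^ k := by
  rw [← Finite.injective_iff_bijective]
  have h : Function.Injective (zpowGroupHom k : (ZMod p)ˣ →* (ZMod p)ˣ) := by
    rw [injective_iff_map_eq_one]
    intro u hu
    have h1 : (orderOf u : ℤ) ∣ k := orderOf_dvd_iff_zpow_eq_one.2 hu
    have h2 : (orderOf u : ℤ) ∣ (p : ℤ) - 1 := by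
      have := orderOf_dvd_of_pow_eq_one (ZMod.units_pow_card_sub_one_eq_one p u)
      have h3 := Int.natCast_dvd_natCast.2 this
      rwa [Nat.cast_sub hp.out.one_le, Nat.cast_one] at h3
    have h3 := Int.dvd_coe_gcd h1 h2
    rw [hk] at h3
    rw [← orderOf_eq_one_iff]
    exact Nat.dvd_one.1 (by exact_mod_cast h3)
  exact h

theorem sum_units_mul_eq_neg_one (hψ : ψ.IsPrimitive) {a : ZMod p} (ha : a ≠ 0) :
    ∑ u : (ZMod p)ˣ, ψ (a * u) = -1 := by
  have h1 : ∑ x : ZMod p, ψ (a * x) = 0 := by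
    have := AddChar.sum_mulShift a hψ
    rw [if_neg ha, Nat.cast_zero] at this
    simpa only [mul_comm] using this
  rw [sum_eq_sum_units_add, mul_zero, AddChar.map_zero_eq_one] at h1
  exact eq_neg_of_add_eq_zero_left h1

/-- Parseval's identity for an arithmetic progression. -/
theorem sum_norm_sum_sq (hψ : ψ.IsPrimitive) {n : ZMod p} (hn : n ≠ 0) {h : ℕ} (hh : h ≤ p) :
    ∑ a : ZMod p, ‖∑ s ∈ Finset.range h, ψ (a * (n * s))‖ ^ 2 = p * h := by
  have key : ∀ a : ZMod p, ((‖∑ s ∈ Finset.range h, ψ (a * (n * s))‖ ^ 2 : ℝ) : ℂ)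
      = ∑ s ∈ Finset.range h, ∑ t ∈ Finset.range h, ψ (a * (n * (s - t))) := by
    intro a
    rw [Complex.ofReal_pow, ← Complex.mul_conj', map_sum, Finset.sum_mul_sum]
    refine Finset.sum_congr rfl fun s _ => Finset.sum_congr rfl fun t _ => ?_
    rw [← AddChar.map_neg_eq_conj, ← AddChar.map_add_eq_mul]
    congr 1
    ring
  have h1 : ((∑ a : ZMod p, ‖∑ s ∈ Finset.range h, ψ (a * (n * s))‖ ^ 2 : ℝ) : ℂ)
      = ((p * h : ℝ) : ℂ) := by
    rw [Complex.ofReal_sum, Finset.sum_congr rfl fun a _ => key a, Finset.sum_comm]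
    have : ∀ s ∈ Finset.range h, ∑ a : ZMod p, ∑ t ∈ Finset.range h, ψ (a * (n * (s - t))) = p := by
      intro s hs
      rw [Finset.sum_comm, Finset.sum_eq_single s]
      · rw [AddChar.sum_mulShift _ hψ]
        simp [ZMod.card]
      · intro t ht hts
        rw [AddChar.sum_mulShift _ hψ, if_neg]
        · simp
        refine mul_ne_zero hn (sub_ne_zero.2 fun h => hts ?_)
        rw [ZMod.natCast_eq_natCast_iff', Nat.mod_eq_of_lt, Nat.mod_eq_of_lt] at h
        · exact h.symm
        · exact (Finset.mem_range.1 ht).trans_le hh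
        · exact (Finset.mem_range.1 hs).trans_le hh
      · exact fun h => absurd hs h
    rw [Finset.sum_congr rfl this]
    simp [mul_comm]
  exact_mod_cast h1

/-- The `h ^ 2` points of an arithmetic progression sumset, weighted by additive characters. -/
theorem sum_sum_char_eq (a c n : ZMod p) (h : ℕ) :
    ∑ x ∈ Finset.range h ×ˢ Finset.range h, ψ (-(a * (c + n * (x.1 + x.2))))
      = ψ (-(a * c)) * (∑ s ∈ Finset.range h, ψ (-a * (n * s))) ^ 2 := by
  rw [sq, Finset.sum_mul_sum, Finset.sum_product, Finset.mul_sum]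
  refine Finset.sum_congr rfl fun s _ => ?_
  rw [Finset.mul_sum]
  refine Finset.sum_congr rfl fun t _ => ?_
  rw [← AddChar.map_add_eq_mul, ← AddChar.map_add_eq_mul]
  congr 1
  ring

theorem sum_norm_sum_sum_char (hψ : ψ.IsPrimitive) (c : ZMod p) {n : ZMod p} (hn : n ≠ 0) {h : ℕ}
    (hh : h ≤ p) :
    ∑ a : ZMod p, ‖∑ x ∈ Finset.range h ×ˢ Finset.range h, ψ (-(a * (c + n * (x.1 + x.2))))‖
      = p * h := by
  simp only [sum_sum_char_eq, norm_mul, AddChar.norm_apply, one_mul, norm_pow]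
  rw [← sum_norm_sum_sq hψ hn hh]
  exact Equiv.sum_comp (Equiv.neg (ZMod p))
    fun a => ‖∑ s ∈ Finset.range h, ψ (a * (n * s))‖ ^ 2

/-- The monomial map `u ↦ A u ^ k` takes a point of one arithmetic progression sumset to a point
of another one, as soon as these are long enough. -/
theorem exists_mem_progression_of_lt {n : ZMod p} (hn : n ≠ 0) (c d : ZMod p) {h : ℕ} (hh : h ≤ p)
    {A : ZMod p} (hA : A ≠ 0) {k : ℤ} (hk : Int.gcd k ((p : ℤ) - 1) = 1) (hk0 : k ≠ 0)
    (hk1 : k ≠ 1) (hkp : (k : ZMod p) ≠ 0)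
    (hlt : 2 * h * (p - h : ℝ) + (p - h : ℝ) ^ 2 * ((k - 1).natAbs * √p + 1)
      < (p - 1 : ℝ) * h ^ 2) :
    ∃ u : (ZMod p)ˣ, ∃ s t s' t' : ℕ, (s < h ∧ t < h ∧ s' < h ∧ t' < h) ∧
      (u : ZMod p) = c + n * (s + t) ∧
      A * ((u ^ k : (ZMod p)ˣ) : ZMod p) = d + n * (s' + t') := by
  by_contra! hcon
  have hψ : (ZMod.stdAddChar (N := p)).IsPrimitive := ZMod.isPrimitive_stdAddChar p
  set ψ := ZMod.stdAddChar (N := p)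
  have hψ1 : ψ ≠ 1 := by
    intro h1
    refine hψ (one_ne_zero (α := ZMod p)) ?_
    rw [AddChar.mulShift_one, h1]
  set T := Finset.range h ×ˢ Finset.range h
  have hT : ∀ x ∈ T, x.1 < h ∧ x.2 < h := fun x hx => by simpa [T] using hx
  have hX0 : ∀ c : ZMod p, ∑ x ∈ T, ψ (-(0 * (c + n * (x.1 + x.2)))) = ((h ^ 2 : ℝ) : ℂ) := by
    intro c
    simp [T, sq]
  have hp1 : (Fintype.card (ZMod p)ˣ : ℂ) = ((p - 1 : ℝ) : ℂ) := by
    rw [ZMod.card_units, Nat.cast_sub hp.out.one_le]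
    simp
  have hsum : ∑ a : ZMod p, ∑ b : ZMod p, (∑ x ∈ T, ψ (-(a * (c + n * (x.1 + x.2)))))
      * (∑ x ∈ T, ψ (-(b * (d + n * (x.1 + x.2)))))
      * ∑ u : (ZMod p)ˣ, ψ (a * u + b * A * ((u ^ k : (ZMod p)ˣ) : ZMod p)) = 0 := by
    have h1 : ∀ a b : ZMod p, (∑ x ∈ T, ψ (-(a * (c + n * (x.1 + x.2)))))
      * (∑ x ∈ T, ψ (-(b * (d + n * (x.1 + x.2)))))
      * ∑ u : (ZMod p)ˣ, ψ (a * u + b * A * ((u ^ k : (ZMod p)ˣ) : ZMod p))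
      = ∑ x ∈ T, ∑ y ∈ T, ∑ u : (ZMod p)ˣ, ψ (a * (u - (c + n * (x.1 + x.2))))
        * ψ (b * (A * ((u ^ k : (ZMod p)ˣ) : ZMod p) - (d + n * (y.1 + y.2)))) := by
      intro a b
      rw [Finset.sum_mul_sum, Finset.sum_mul]
      refine Finset.sum_congr rfl fun x _ => ?_
      rw [Finset.sum_mul]
      refine Finset.sum_congr rfl fun y _ => ?_
      rw [Finset.mul_sum]
      refine Finset.sum_congr rfl fun u _ => ?_
      rw [← AddChar.map_add_eq_mul, ← AddChar.map_add_eq_mul, ← AddChar.map_add_eq_mul]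
      congr 1
      ring
    simp only [h1]
    have h2 : ∀ x ∈ T, ∀ y ∈ T, ∀ u : (ZMod p)ˣ, ∑ a : ZMod p, ∑ b : ZMod p,
        ψ (a * (u - (c + n * (x.1 + x.2))))
        * ψ (b * (A * ((u ^ k : (ZMod p)ˣ) : ZMod p) - (d + n * (y.1 + y.2)))) = 0 := by
      intro x hx y hy u
      rw [← Finset.sum_mul_sum, AddChar.sum_mulShift _ hψ, AddChar.sum_mulShift _ hψ]
      have h3 := hcon u x.1 x.2 y.1 y.2 ⟨(hT x hx).1, (hT x hx).2, (hT y hy).1, (hT y hy).2⟩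
      by_cases h4 : (u : ZMod p) = c + n * (x.1 + x.2)
      · rw [if_neg (sub_ne_zero.2 (h3 h4)), Nat.cast_zero, mul_zero]
      · rw [if_neg (sub_ne_zero.2 h4), Nat.cast_zero, zero_mul]
    rw [sum_sum_sum_comm]
    refine Finset.sum_eq_zero fun x hx => ?_
    rw [sum_sum_sum_comm]
    refine Finset.sum_eq_zero fun y hy => ?_
    rw [sum_sum_sum_comm]
    exact Finset.sum_eq_zero fun u _ => h2 x hx y hy u
  have hb := fun c : ZMod p => (sum_norm_sum_sum_char hψ c hn hh).le
  have hmain := sq_mul_le_of_sum_eq_zero (0 : ZMod p) hsum (by positivity)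
    (M := (k - 1).natAbs * √p + 1) (by positivity) (hX0 c) (hX0 d) (hb c) (hb d)
    (q := p - 1) (by simpa using hp1) ?_ ?_ ?_
  · have h0 : (0 : ℝ) < h ^ 2 := by
      rcases Nat.eq_zero_or_pos h with h0 | h0
      · subst h0
        have : (0 : ℝ) ≤ (p : ℝ) ^ 2 * ((k - 1).natAbs * √p + 1) := by positivity
        simp only [Nat.cast_zero, sub_zero, mul_zero, zero_mul, zero_add] at hlt
        linarith
      · positivity
    have := mul_lt_mul_of_pos_left hlt h0
    linarith
  · intro a ha
    simp only [zero_mul, add_zero]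
    rw [sum_units_mul_eq_neg_one hψ ha]
    simp
  · intro b hb
    simp only [zero_mul, zero_add]
    rw [(zpow_bijective_of_gcd_eq_one hk).sum_comp fun u : (ZMod p)ˣ => ψ (b * A * (u : ZMod p)),
      sum_units_mul_eq_neg_one hψ (mul_ne_zero hb hA)]
    simp
  · intro a ha b hb
    exact norm_sum_binomial_le p ψ hψ1 ha (mul_ne_zero hb hA) hk0 hk1 hkp

end

theorem progression_inequality {p n h D : ℝ} (hn : 2 ≤ n) (hD : 1 ≤ D)
    (hp : 16 * D ^ 2 * n ^ 4 ≤ p) (hh : p - n ≤ 2 * n * h) (hhp : h ≤ p - n) :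
    2 * h * (p - h) + (p - h) ^ 2 * (D * √p + 1) < (p - 1) * h ^ 2 := by
  have hn2 : (0 : ℝ) < n ^ 2 := by positivity
  have hn3 : 2 * n ^ 2 ≤ n ^ 3 := by nlinarith
  have hn4 : 2 * n ^ 3 ≤ n ^ 4 := by nlinarith
  have hn4p : (0 : ℝ) < n ^ 4 := by positivity
  have hp2 : 16 * n ^ 4 ≤ p := by nlinarith [one_le_pow₀ hD (n := 2)]
  have hp0 : 0 < p := by nlinarith
  have hs : √p ^ 2 = p := Real.sq_sqrt hp0.le
  have hDp : D * √p * (4 * n ^ 2) ≤ p := by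
    have h1 : 4 * D * n ^ 2 ≤ √p := Real.le_sqrt_of_sq_le (by nlinarith)
    nlinarith [Real.sqrt_nonneg p]
  have h1 : 4 * n ^ 2 * p < (h - n) * (2 * p - n - h) := by
    have h2 : 8 * n ^ 3 < 2 * n * h - 2 * n ^ 2 := by nlinarith
    have h3 : 4 * n ^ 2 < h - n := by nlinarith
    have h4 : p ≤ 2 * p - n - h := by linarith
    nlinarith
  have h2 : (p - h) ^ 2 + 4 * n ^ 2 * p < 4 * n ^ 2 * h ^ 2 := by
    have h5 : (p - n) ^ 2 ≤ (2 * n * h) ^ 2 :=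
      pow_le_pow_left₀ (by nlinarith) hh 2
    nlinarith
  have h3 : (p - h) ^ 2 * (D * √p) * (4 * n ^ 2) ≤ (p - h) ^ 2 * p := by
    nlinarith [mul_le_mul_of_nonneg_left hDp (sq_nonneg (p - h))]
  have h4 : ((p - h) ^ 2 * (D * √p) + p ^ 2) * (4 * n ^ 2) < p * h ^ 2 * (4 * n ^ 2) := by
    nlinarith [mul_lt_mul_of_pos_left h2 hp0]
  have h5 := lt_of_mul_lt_mul_right h4 (by positivity)
  nlinarith

/-- The points `c + n (s + t)` lie in the residue class `I_i`. -/
theorem exists_progression_subset_Iclass {p n i : ℕ} (hi : i < n) :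
    ∃ c : ℕ, ∀ h : ℕ, n * (2 * h - 1) ≤ p - 1 → ∀ s t : ℕ, s < h → t < h →
      c + n * (s + t) ∈ Iclass p n i := by
  refine ⟨if i = 0 then n else i, fun h hh s t hs ht => ?_⟩
  have h1 : n * (s + t + 1) ≤ n * (2 * h - 1) := Nat.mul_le_mul_left n (by omega)
  rw [mul_add, mul_one] at h1
  rw [Iclass, Finset.mem_filter, Finset.mem_Icc, Nat.add_mul_mod_self_left]
  split_ifs with h0
  · refine ⟨⟨by omega, by omega⟩, by simp [h0]⟩
  · exact ⟨⟨by omega, by omega⟩, Nat.mod_eq_of_lt hi⟩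

theorem fmapz_eq_of_unit {p : ℕ} [Fact p.Prime] (A k : ℤ) {x : ℕ} {u : (ZMod p)ˣ}
    (hu : (u : ZMod p) = x) :
    fmapz p A k x = ((A : ZMod p) * ((u ^ k : (ZMod p)ˣ) : ZMod p)).val := by
  rw [fmapz, ← hu, Units.val_zpow_eq_zpow_val]
  congr 2
  split_ifs with h
  · obtain ⟨m, rfl⟩ := Int.eq_ofNat_of_zero_le h
    rw [Int.toNat_natCast, zpow_natCast]
  · obtain ⟨m, rfl⟩ : ∃ m : ℕ, k = -m := ⟨(-k).toNat, by omega⟩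
    rw [neg_neg, Int.toNat_natCast, zpow_neg, zpow_natCast, inv_pow]

theorem stmt_5 (p n : ℕ) (A k : ℤ) (hp : p.Prime) (hodd : Odd p) (hn : 2 ≤ n)
    (hA : 2 * |A| < (p : ℤ)) (hA0 : A ≠ 0)
    (hk1 : k ≠ 1) (hk2 : 2 * |k| < (p : ℤ) - 1) (hk3 : Int.gcd k ((p : ℤ) - 1) = 1)
    (hbig : (16.2 : ℝ) * ((k : ℝ) - 1) ^ 2 * (n : ℝ) ^ 4 ≤ (p : ℝ)) :
    ∀ i j : ℕ, i ≤ n - 1 → j ≤ n - 1 →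
      ((Iclass p n i).image (fmapz p A k) ∩ Iclass p n j).Nonempty := by
  intro i j hi hj
  have : Fact p.Prime := ⟨hp⟩
  have hp3 : 3 ≤ p := by
    have := hp.two_le
    obtain ⟨m, rfl⟩ := hodd
    omega
  have hk0 : k ≠ 0 := by
    rintro rfl
    rw [Int.gcd_zero_left] at hk3
    omega
  have hcast : ∀ z : ℤ, z ≠ 0 → 2 * |z| < p → (z : ZMod p) ≠ 0 := by
    intro z hz hlt h
    rw [ZMod.intCast_zmod_eq_zero_iff_dvd] at h
    have := Int.le_of_dvd (abs_pos.2 hz) ((dvd_abs _ _).2 h)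
    omega
  have hD : ((k - 1).natAbs : ℝ) ^ 2 = ((k : ℝ) - 1) ^ 2 := by
    rw [Nat.cast_natAbs, Int.cast_abs, sq_abs]
    push_cast
    rfl
  have hD1 : (1 : ℝ) ≤ (k - 1).natAbs := by
    exact_mod_cast (by omega : 1 ≤ (k - 1).natAbs)
  have hnR : (2 : ℝ) ≤ n := by exact_mod_cast hn
  have hpD : 16 * ((k - 1).natAbs : ℝ) ^ 2 * (n : ℝ) ^ 4 ≤ p := by
    rw [hD]
    nlinarith [mul_nonneg (sq_nonneg ((k : ℝ) - 1)) (by positivity : (0 : ℝ) ≤ (n : ℝ) ^ 4)]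
  have hpn : 2 * n ≤ p := by
    have h1 : (2 * n : ℝ) ≤ p := by
      have h2 : (n : ℝ) ≤ (n : ℝ) ^ 4 := le_self_pow₀ (by linarith) (by norm_num)
      have h3 : (1 : ℝ) ≤ ((k - 1).natAbs : ℝ) ^ 2 := one_le_pow₀ hD1
      nlinarith [mul_le_mul h3 h2 (by linarith) (by positivity)]
    exact_mod_cast h1
  obtain ⟨h, hh1, hh2⟩ : ∃ h : ℕ, n * (2 * h - 1) ≤ p - 1 ∧ p ≤ 2 * n * h + n := by
    refine ⟨((p - 1) / n + 1) / 2, ?_, ?_⟩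
    · refine (Nat.mul_le_mul_left n ?_).trans (Nat.mul_div_le (p - 1) n)
      generalize (p - 1) / n = x
      omega
    · have h1 : n * ((p - 1) / n) ≤ n * (2 * (((p - 1) / n + 1) / 2)) :=
        Nat.mul_le_mul_left n (by generalize (p - 1) / n = x; omega)
      have h2 := Nat.div_add_mod (p - 1) n
      have h3 := Nat.mod_lt (p - 1) (by omega : n > 0)
      rw [← mul_assoc, mul_comm n 2] at h1
      omega
  have hhp : h + n ≤ p := by
    rcases Nat.eq_zero_or_pos h with rfl | h0
    · omega
    · have h1 : n * h ≤ n * (2 * h - 1) := Nat.mul_le_mul_left n (by omega)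
      have h2 : 2 * h ≤ n * h := Nat.mul_le_mul_right h hn
      omega
  have hlt := progression_inequality (h := h) hnR hD1 hpD
    (by rw [sub_le_iff_le_add]; exact_mod_cast hh2) (by rw [le_sub_iff_add_le]; exact_mod_cast hhp)
  have hnp : (n : ZMod p) ≠ 0 := by
    rw [Ne, ZMod.natCast_eq_zero_iff]
    exact fun h => absurd (Nat.le_of_dvd (by omega) h) (by omega)
  obtain ⟨c, hc⟩ := exists_progression_subset_Iclass (p := p) (n := n) (i := i) (by omega)
  obtain ⟨d, hd⟩ := exists_progression_subset_Iclass (p := p) (n := n) (i := j) (by omega)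
  obtain ⟨u, s, t, s', t', ⟨hs, ht, hs', ht'⟩, hu, hv⟩ := exists_mem_progression_of_lt hnp
    (c : ZMod p) (d : ZMod p) (by omega : h ≤ p) (hcast A hA0 hA) hk3 hk0 hk1
    (hcast k hk0 (by omega)) hlt
  have hx := hc h hh1 s t hs ht
  have hy := hd h hh1 s' t' hs' ht'
  refine ⟨d + n * (s' + t'), Finset.mem_inter.2
    ⟨Finset.mem_image.2 ⟨c + n * (s + t), hx, ?_⟩, hy⟩⟩
  rw [fmapz_eq_of_unit A k (u := u) (by rw [hu]; push_cast; rfl), hv]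
  have hlt' : d + n * (s' + t') < p := by
    have := (Finset.mem_Icc.1 (Finset.mem_filter.1 hy).1).2
    omega
  rw [← Nat.mod_eq_of_lt hlt', ← ZMod.val_natCast]
  push_cast
  rfl
end

section
/- Let p be a prime with p ≡ 1 (mod 4), let ε ∈ {+1, −1}, and let f(x) = (ε x^{(p+1)/2} mod p) on I. Let n ≥ 2 be an integer. (1) If n is odd and 0 ≤ i ≤ n−1 satisfies 2i ≡ p (mod n), then f(I_i) = I_i. (2) If n is even, or n is odd with 2i ≢ p (mod n), and p > (n+1)², then f(I_i) meets exactly two of the residue classes I_0, ..., I_{n−1}, namely I_i and I_{ī}, where ī is the residue of p − i modulo n. -/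
/-- `fmap p A k x` is `A x^k mod p`, the least residue in `{0, …, p-1}`. -/
def fmap (p : ℕ) (A : ℤ) (k : ℕ) (x : ℕ) : ℕ :=
  ((A : ZMod p) * (x : ZMod p) ^ k).val

/-- If the Legendre symbol is constant on `J = (mp/n, (m+1)p/n)`, and the sets of `y` with
`k y ∈ J` and with `(k + d) y ∈ J` modulo `p` overlap in an interval of length more than `1`, then
`k` and `k + d` have the same Legendre symbol. -/
theorem legendreSym_eq_of_window {p : ℕ} [Fact p.Prime] {n m s : ℤ}
    (hn : 0 < n) (hs : s ≠ 0)
    (hJ : ∀ x : ℤ, m * p < n * x → n * x < (m + 1) * p → legendreSym p x = s)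
    {k d l w : ℤ} (hk : 0 < k) (hd : 0 < d) (hw : 0 ≤ w) (hco : IsCoprime k d)
    (hl₁ : d * m - w ≤ n * l) (hl₂ : n * l ≤ d * m + d + w)
    (hlen : n * (k * (k + d)) < (k - w) * p) :
    legendreSym p k = legendreSym p (k + d) := by
  obtain ⟨u, v, huv⟩ := hco
  have hp0 : (0 : ℤ) < p := by exact_mod_cast (Fact.out : p.Prime).pos
  obtain ⟨j, j', hj⟩ : ∃ j j' : ℤ, k * j' - (k + d) * j = l :=
    ⟨-l * v, -l * v + l * u, by linear_combination l * huv⟩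
  set lo := max ((k + d) * (n * j + m)) (k * (n * j' + m)) with hlo
  have hdiff : k * (n * j' + m) - (k + d) * (n * j + m) = n * l - d * m := by
    linear_combination n * hj
  have hlo₁ : (k + d) * (n * j + m) ≤ lo := le_max_left _ _
  have hlo₂ : k * (n * j' + m) ≤ lo := le_max_right _ _
  have hup₁ : lo + (k - w) ≤ (k + d) * (n * j + m) + (k + d) := by
    have : lo ≤ (k + d) * (n * j + m) + (d + w) := max_le (by linarith) (by linarith)
    linarith
  have hup₂ : lo + (k - w) ≤ k * (n * j' + m) + k := by
    have : lo ≤ k * (n * j' + m) + w := max_le (by linarith) (by linarith)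
    linarith
  have hM : 0 < n * (k * (k + d)) := by positivity
  obtain ⟨y, hy₁, hy₂⟩ : ∃ y : ℤ, lo * p < n * (k * (k + d)) * y ∧
      n * (k * (k + d)) * y < (lo + (k - w)) * p := by
    refine ⟨lo * p / (n * (k * (k + d))) + 1, ?_, ?_⟩
    · have := Int.lt_mul_ediv_self_add (x := lo * p) hM
      linarith
    · have := Int.mul_ediv_self_le (x := lo * p) hM.ne'
      linarith
  have shift : ∀ a b c : ℤ, legendreSym p (a * b - c * p) = legendreSym p a * legendreSym p b := by
    intro a b c
    rw [← legendreSym.mul, legendreSym.mod p (a * b - c * p), Int.sub_mul_emod_self_right,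
      ← legendreSym.mod]
  have h₁ : legendreSym p (k * y - j * p) = s := by
    have hkd : 0 < k + d := by linarith
    apply hJ
    · refine lt_of_mul_lt_mul_left ?_ hkd.le
      nlinarith
    · refine lt_of_mul_lt_mul_left ?_ hkd.le
      nlinarith
  have h₂ : legendreSym p ((k + d) * y - j' * p) = s := by
    apply hJ
    · refine lt_of_mul_lt_mul_left ?_ hk.le
      nlinarith
    · refine lt_of_mul_lt_mul_left ?_ hk.le
      nlinarith
  rw [shift] at h₁ h₂
  have hy0 : legendreSym p y ≠ 0 := by
    rintro h
    rw [h, mul_zero] at h₁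
    exact hs h₁.symm
  exact mul_right_cancel₀ hy0 (h₁.trans h₂.symm)

theorem exists_pow_mul_mem_Icc {g X Y : ℤ} (hg : 2 ≤ g) (hXY : g * (X - 1) ≤ Y) :
    ∀ {z : ℤ}, 0 < z → z ≤ Y → ∃ e : ℕ, X ≤ g ^ e * z ∧ g ^ e * z ≤ Y := by
  intro z hz hzY
  by_cases h : X ≤ z
  · exact ⟨0, by simpa using h, by simpa using hzY⟩
  · have : z < g * z := by nlinarith
    have hgz : g * z ≤ Y := by nlinarith
    obtain ⟨e, he₁, he₂⟩ := exists_pow_mul_mem_Icc hg hXY (z := g * z) (by positivity) hgz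
    exact ⟨e + 1, by rw [pow_succ, mul_assoc]; exact he₁, by rw [pow_succ, mul_assoc]; exact he₂⟩
termination_by z => (Y - z).toNat
decreasing_by omega

/-- For some `d ≤ 4` the number `d m / n` is so close to an integer that, whenever the Legendre
symbol is constant on `(mp/n, (m+1)p/n)`, `legendreSym_eq_of_window` applies to all `k` coprime
to `d` in the range `X ≤ k ≤ n + 2 - d - X`. -/
theorem exists_window {n m : ℤ} (hn : 9 ≤ n) (hm : 0 ≤ m) (hmn : 2 * m + 2 ≤ n) :
    ∃ d X w l : ℤ, 0 ≤ w ∧ d * m - w ≤ n * l ∧ n * l ≤ d * m + d + w ∧ 0 < X ∧ 2 * X + d ≤ n + 2 ∧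
      w * (n + 2) ≤ X * (n + 2 - d - X) ∧
      ((d = 1 ∧ 3 * X ≤ n + 4) ∨ (d = 2 ∧ 4 * X ≤ n + 5) ∨ (d = 3 ∧ 3 * X ≤ n) ∨
        (d = 4 ∧ 4 * X ≤ n - 1)) := by
  obtain ⟨N, rfl⟩ : ∃ N, n = N - 2 := ⟨n + 2, by ring⟩
  obtain ⟨t, r, hr0, hr, rfl⟩ : ∃ t r : ℤ, 0 ≤ r ∧ r < 12 ∧ N = 12 * t + r :=
    ⟨N / 12, N % 12, by omega, by omega, by omega⟩
  have ht : 0 ≤ t := by omega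
  by_contra H
  have key (d X w l : ℤ) (h₀ : 0 ≤ w) (h₁ : d * m - w ≤ (12 * t + r - 2) * l)
      (h₂ : (12 * t + r - 2) * l ≤ d * m + d + w) (hX : 0 < X) (hXd : 2 * X + d ≤ 12 * t + r)
      (hd : (d = 1 ∧ 3 * X ≤ 12 * t + r + 2) ∨ (d = 2 ∧ 4 * X ≤ 12 * t + r + 3) ∨
        (d = 3 ∧ 3 * X ≤ 12 * t + r - 2) ∨ (d = 4 ∧ 4 * X ≤ 12 * t + r - 3)) :
      X * (12 * t + r - d - X) < w * (12 * t + r) := by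
    by_contra! h
    exact H ⟨d, X, w, l, h₀, h₁, h₂, hX, by linarith, by linarith, by omega⟩
  clear H
  have C1 := key 1 (4 * t + (r + 2) / 3) m 0 hm (by linarith) (by linarith) (by omega) (by omega)
    (by omega)
  have C2 := key 2 (3 * t + (r + 3) / 4) (12 * t + r - 2 * m - 4) 1 (by linarith) (by linarith)
    (by linarith) (by omega) (by omega) (by omega)
  have C3 := fun w h₀ h₁ h₂ => key 3 (4 * t + (r - 2) / 3) w 1 h₀ h₁ h₂ (by omega) (by omega)
    (by omega)
  have C4 := fun w h₀ h₁ h₂ => key 4 (3 * t + (r - 3) / 4) w 1 h₀ h₁ h₂ (by omega) (by omega)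
    (by omega)
  clear key
  have W3 : 12 * t + r - 2 < 3 * m ∨ 3 * m + 3 < 12 * t + r - 2 := by
    by_contra! h
    have := C3 0 le_rfl (by linarith) (by linarith)
    have : 0 ≤ (4 * t + (r - 2) / 3) * (12 * t + r - 3 - (4 * t + (r - 2) / 3)) :=
      mul_nonneg (by omega) (by omega)
    linarith
  have W4 : 12 * t + r - 2 < 4 * m ∨ 4 * m + 4 < 12 * t + r - 2 := by
    by_contra! h
    have := C4 0 le_rfl (by linarith) (by linarith)
    have : 0 ≤ (3 * t + (r - 3) / 4) * (12 * t + r - 4 - (3 * t + (r - 3) / 4)) :=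
      mul_nonneg (by omega) (by omega)
    linarith
  have C3a := fun h : 12 * t + r - 2 < 3 * m =>
    C3 (3 * m - (12 * t + r - 2)) (by linarith) (by linarith) (by linarith)
  have C3b := fun h : 3 * m + 3 < 12 * t + r - 2 =>
    C3 (12 * t + r - 2 - 3 * m - 3) (by linarith) (by linarith) (by linarith)
  have C4a := fun h : 12 * t + r - 2 < 4 * m =>
    C4 (4 * m - (12 * t + r - 2)) (by linarith) (by linarith) (by linarith)
  have C4b := fun h : 4 * m + 4 < 12 * t + r - 2 =>
    C4 (12 * t + r - 2 - 4 * m - 4) (by linarith) (by linarith) (by linarith)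
  clear C3 C4
  rcases W3 with h3 | h3 <;> rcases W4 with h4 | h4
  · replace C3a := C3a h3
    clear C3b C4a C4b C1
    interval_cases r <;> norm_num at * <;> nlinarith
  · linarith
  · replace C3b := C3b h3
    replace C4a := C4a h4
    clear C3a C4b
    interval_cases r <;> norm_num at * <;> nlinarith
  · replace C4b := C4b h4
    clear C3b C4a C3a C2
    interval_cases r <;> norm_num at * <;> nlinarith

/-- The least positive quadratic nonresidue is a prime `q` with `q (q - 1) < p`. -/
theorem exists_least_nonresidue {p : ℕ} [Fact p.Prime] (hp2 : p ≠ 2) :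
    ∃ q : ℕ, q.Prime ∧ q * (q - 1 : ℤ) < p ∧ legendreSym p q = -1 ∧
      ∀ z : ℤ, 0 < z → z < q → legendreSym p z = 1 := by
  have hp : p.Prime := Fact.out
  have hone : ∀ z : ℕ, 0 < z → z < p → legendreSym p z = 1 ∨ legendreSym p z = -1 := by
    intro z hz hzp
    apply legendreSym.eq_one_or_neg_one
    rw [Int.cast_natCast, Ne, ZMod.natCast_eq_zero_iff]
    exact Nat.not_dvd_of_pos_of_lt hz hzp
  have hex : ∃ z : ℕ, 0 < z ∧ z < p ∧ legendreSym p z = -1 := by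
    obtain ⟨a, ha⟩ := quadraticChar_exists_neg_one (F := ZMod p) (by rwa [ZMod.ringChar_zmod_n])
    have ha' : legendreSym p (a.val : ℕ) = -1 := by
      rw [legendreSym, Int.cast_natCast, ZMod.natCast_zmod_val, ha]
    refine ⟨a.val, Nat.pos_of_ne_zero fun h => ?_, a.val_lt, ha'⟩
    rw [h] at ha'
    simp at ha'
  classical
  obtain ⟨hq0, hqp, hq⟩ := Nat.find_spec hex
  have hmin : ∀ z : ℕ, 0 < z → z < Nat.find hex → legendreSym p z = 1 := fun z hz hzq =>
    (hone z hz (hzq.trans hqp)).resolve_right fun h =>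
      Nat.find_min hex hzq ⟨hz, hzq.trans hqp, h⟩
  set q := Nat.find hex
  have hq1 : q ≠ 1 := by
    intro h
    rw [h] at hq
    simp at hq
  refine ⟨q, ?_, ?_, hq, ?_⟩
  · by_contra hprime
    have hlt := (Nat.not_prime_iff_minFac_lt (by omega)).1 hprime
    have hmul := Nat.mul_div_cancel' q.minFac_dvd
    have hlt' : q / q.minFac < q := Nat.div_lt_self hq0 (Nat.minFac_prime hq1).one_lt
    rw [← hmul, Nat.cast_mul, legendreSym.mul, hmin _ q.minFac_pos hlt,
      hmin _ (Nat.div_pos hlt.le q.minFac_pos) hlt'] at hq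
    norm_num at hq
  · have hmod := Nat.div_add_mod p q
    have hmodlt := Nat.mod_lt p hq0
    have hmod0 : 0 < p % q := Nat.pos_of_ne_zero fun h =>
      hq1 ((hp.eq_one_or_self_of_dvd q (Nat.dvd_of_mod_eq_zero h)).resolve_right hqp.ne)
    by_contra! hle
    have hc : p / q + 1 < q := by
      zify at *
      nlinarith
    have hr := hmin (q - p % q) (by omega) (by omega)
    have : ((q - p % q : ℕ) : ℤ) = q * (p / q + 1 : ℕ) - 1 * p := by
      push_cast [hmodlt.le]
      zify at hmod
      linear_combination -hmod
    rw [this, legendreSym.mod, Int.sub_mul_emod_self_right, ← legendreSym.mod, legendreSym.mul, hq,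
      hmin _ (Nat.succ_pos _) hc] at hr
    norm_num at hr
  · intro z hz hzq
    lift z to ℕ using hz.le
    exact hmin z (by omega) (by omega)

/-- The Legendre symbol is not constant on `(mp/n, (m+1)p/n)` when this is left of `p / 2`. -/
theorem not_constant_on_interval {p : ℕ} [Fact p.Prime] (hp2 : p ≠ 2) {n m s : ℤ}
    (hn : 2 ≤ n) (hm : 0 ≤ m) (hmn : 2 * m + 2 ≤ n) (hpn : (n + 1) ^ 2 < p) (hs : s ≠ 0) :
    ¬ ∀ x : ℤ, m * p < n * x → n * x < (m + 1) * p → legendreSym p x = s := by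
  intro hJ
  obtain ⟨q, hqprime, hqq, hq, hres⟩ := exists_least_nonresidue hp2
  have hone : legendreSym p 1 = 1 := by simp
  have hn0 : 0 < n := by linarith
  have rel : ∀ k d l : ℤ, 0 < k → 0 < d → IsCoprime k d → d * m ≤ n * l → n * l ≤ d * m + d →
      k + d ≤ n + 2 → legendreSym p k = legendreSym p (k + d) := by
    intro k d l hk hd hco h₁ h₂ hB
    refine legendreSym_eq_of_window hn0 hs hJ hk hd le_rfl hco (by simpa using h₁)
      (by simpa using h₂) ?_
    nlinarith [mul_le_mul_of_nonneg_left hB (mul_pos hn0 hk).le]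
  have hq2 : (2 : ℤ) ≤ q := by exact_mod_cast hqprime.two_le
  have hqn : (q : ℤ) < n := by
    by_contra! h
    have hlt : n * (1 * (1 + (q - 1 : ℤ))) < (1 - 0) * p := by
      rcases h.eq_or_lt with h | h <;> nlinarith
    have := legendreSym_eq_of_window hn0 hs hJ one_pos (d := q - 1)
      (l := ((q - 1) * m + n - 1) / n) (by linarith) le_rfl
      isCoprime_one_left (by
        have := Int.lt_mul_ediv_self_add (x := (q - 1) * m + n - 1) hn0
        linarith) (by
        have := Int.mul_ediv_self_le (x := (q - 1) * m + n - 1) hn0.ne'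
        linarith) hlt
    rw [add_sub_cancel, hq, hone] at this
    norm_num at this
  have hcop : ∀ d : ℤ, 0 < d → d < q → IsCoprime (q : ℤ) d := fun d hd hdq =>
    (Nat.prime_iff_prime_int.1 hqprime).coprime_iff_not_dvd.2 fun h =>
      (Int.le_of_dvd hd h).not_gt hdq
  have hq5 : (5 : ℤ) ≤ q := by
    have hq2' : q ≠ 2 := by
      rintro rfl
      push_cast at hq hqn
      rcases Int.even_or_odd' n with ⟨a, h | h⟩
      · have h1 := rel 1 n m one_pos hn0 isCoprime_one_left le_rfl (by linarith) (by linarith)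
        have h2 := rel 2 (n - 1) m two_pos (by linarith) ⟨1 - a, 1, by rw [h]; ring⟩
          (by linarith) (by linarith) (by linarith)
        rw [show 2 + (n - 1) = 1 + n by ring, ← h1, hq, hone] at h2
        norm_num at h2
      · have h1 := rel 1 (n - 1) m one_pos (by linarith) isCoprime_one_left (by linarith)
          (by linarith) (by linarith)
        have h2 := rel 2 (n - 2) m two_pos (by linarith) ⟨1 - a, 1, by rw [h]; ring⟩
          (by linarith) (by linarith) (by linarith)
        rw [show 2 + (n - 2) = 1 + (n - 1) by ring, ← h1, hq, hone] at h2
        norm_num at h2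
    have hq3' : q ≠ 3 := by
      rintro rfl
      push_cast at hq hqn
      by_cases h : n % 3 = 2
      · obtain ⟨a, ha⟩ : ∃ a, n = 3 * a + 2 := ⟨n / 3, by omega⟩
        have h1 := rel 1 (n + 1) (m + 1) one_pos (by linarith) isCoprime_one_left (by linarith)
          (by linarith) (by linarith)
        have h2 := rel 3 (n - 1) m three_pos (by linarith) ⟨-a, 1, by rw [ha]; ring⟩
          (by linarith) (by linarith) (by linarith)
        rw [show 3 + (n - 1) = 1 + (n + 1) by ring, ← h1, hq, hone] at h2
        norm_num at h2
      · have hc : IsCoprime 3 (n - 2) :=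
          Int.prime_three.coprime_iff_not_dvd.2 (by omega)
        have h1 := rel 1 n m one_pos hn0 isCoprime_one_left le_rfl (by linarith) (by linarith)
        have h2 := rel 3 (n - 2) m three_pos (by linarith) hc
          (by linarith) (by linarith) (by linarith)
        rw [show 3 + (n - 2) = 1 + n by ring, ← h1, hq, hone] at h2
        norm_num at h2
    have hq4' : q ≠ 4 := by
      rintro rfl
      norm_num at hqprime
    omega
  have hqle : ∀ d l : ℤ, 0 < d → d * m ≤ n * l → n * l ≤ d * m + d → (q : ℤ) ≤ d := by
    intro d l hd h₁ h₂
    by_contra! h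
    have := rel (q - d) d l (by linarith) hd
      (by simpa [sub_eq_add_neg] using (hcop d hd h).add_mul_right_left (-1)) h₁ h₂ (by linarith)
    rw [sub_add_cancel, hq, hres _ (by linarith) (by linarith)] at this
    norm_num at this
  have hqhalf : 2 * (q : ℤ) ≤ n + 1 := by
    rcases Int.even_or_odd' n with ⟨a, h | h⟩ <;> rcases Int.even_or_odd' m with ⟨c, h' | h'⟩
    · have := hqle a c (by linarith) (by rw [h, h']; linarith) (by rw [h, h']; linarith)
      linarith
    · have := hqle a (c + 1) (by linarith) (by rw [h, h']; linarith) (by rw [h, h']; linarith)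
      linarith
    · have := hqle a c (by linarith) (by rw [h, h']; linarith) (by rw [h, h']; linarith)
      linarith
    · have := hqle (a + 1) (c + 1) (by linarith) (by rw [h, h']; linarith)
        (by rw [h, h']; linarith)
      linarith
  obtain ⟨d, X, w, l, hw, hl₁, hl₂, hX, hXd, hwX, hcase⟩ :=
    exists_window (n := n) (by linarith) hm hmn
  have hd : 0 < d := by omega
  have hdq : d < q := by omega
  have step : ∀ k, X ≤ k → k + d ≤ n + 2 - X → IsCoprime k d →
      legendreSym p k = legendreSym p (k + d) := by
    intro k hXk hkX hco
    have hk : 0 < k := by linarith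
    have hkw : k * (k + d) ≤ (k - w) * (n + 2) := by nlinarith
    have hkw0 : 0 < k - w := by
      have : 0 < k * (k + d) := by positivity
      nlinarith
    refine legendreSym_eq_of_window hn0 hs hJ hk hd hw hco hl₁ hl₂ ?_
    nlinarith [mul_le_mul_of_nonneg_left hkw hn0.le]
  have iter : ∀ (j : ℕ) (z : ℤ), X ≤ z → z + j * d ≤ n + 2 - X → IsCoprime z d →
      legendreSym p z = legendreSym p (z + j * d) := by
    intro j
    induction j with
    | zero => simp
    | succ j ih =>
      intro z hXz hzX hco
      push_cast at hzX ⊢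
      have hjd : 0 ≤ (j : ℤ) * d := by positivity
      rw [ih z hXz (by linarith) hco,
        step (z + j * d) (by linarith) (by linarith) (hco.add_mul_right_left _)]
      congr 1
      ring
  have cls : ∀ z z' : ℤ, X ≤ z → z ≤ n + 2 - X → X ≤ z' → z' ≤ n + 2 - X → IsCoprime z d →
      IsCoprime z' d → z ≡ z' [ZMOD d] → legendreSym p z = legendreSym p z' := by
    intro z z' h₁ h₂ h₁' h₂' hco hco' hmod
    wlog hle : z ≤ z' generalizing z z'
    · exact (this z' z h₁' h₂' h₁ h₂ hco' hco hmod.symm (by linarith)).symm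
    obtain ⟨j, hj⟩ := hmod.dvd
    have hj0 : 0 ≤ j := by
      by_contra! h
      nlinarith
    lift j to ℕ using hj0
    have hz' : z' = z + j * d := by linarith
    rw [hz']
    exact iter j z h₁ (by linarith) hco
  obtain ⟨g, hg2, hgq, hgX, hgd, hall⟩ : ∃ g : ℤ, 2 ≤ g ∧ g < q ∧ g * (X - 1) ≤ n + 2 - X ∧
      IsCoprime g d ∧ ∀ z z' : ℤ, X ≤ z → z ≤ n + 2 - X → X ≤ z' → z' ≤ n + 2 - X →
        IsCoprime z d → IsCoprime z' d → legendreSym p z = legendreSym p z' := by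
    have c2 : ∀ z : ℤ, IsCoprime z 2 ↔ ¬ 2 ∣ z := fun z => by
      rw [isCoprime_comm, Int.prime_two.coprime_iff_not_dvd]
    have c3 : ∀ z : ℤ, IsCoprime z 3 ↔ ¬ 3 ∣ z := fun z => by
      rw [isCoprime_comm, Int.prime_three.coprime_iff_not_dvd]
    have c4 : ∀ z : ℤ, IsCoprime z 4 ↔ ¬ 2 ∣ z := fun z => by
      rw [← c2, show (4 : ℤ) = 2 ^ 2 by norm_num, IsCoprime.pow_right_iff two_pos]
    rcases hcase with ⟨rfl, h⟩ | ⟨rfl, h⟩ | ⟨rfl, h⟩ | ⟨rfl, h⟩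
    · exact ⟨2, le_rfl, by linarith, by linarith, isCoprime_one_right,
        fun z z' h₁ h₂ h₃ h₄ h₅ h₆ => cls z z' h₁ h₂ h₃ h₄ h₅ h₆ (Int.modEq_one)⟩
    · refine ⟨3, by norm_num, by linarith, by linarith, (c2 3).2 (by norm_num),
        fun z z' h₁ h₂ h₃ h₄ h₅ h₆ => cls z z' h₁ h₂ h₃ h₄ h₅ h₆ ?_⟩
      rw [c2] at h₅ h₆
      rw [Int.ModEq]
      omega
    · obtain ⟨z₀, hz₀, hz₀', hz₀d⟩ : ∃ z₀, X ≤ z₀ ∧ z₀ ≤ X + 1 ∧ ¬ 3 ∣ z₀ := by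
        by_cases h3 : 3 ∣ X
        · exact ⟨X + 1, by omega, by omega, by omega⟩
        · exact ⟨X, by omega, by omega, h3⟩
      have hz : ∀ z, X ≤ z → z ≤ n + 2 - X → IsCoprime z 3 →
          legendreSym p z = legendreSym p z₀ := by
        intro z h₁ h₂ h₃
        have hz₃ := (c3 z).1 h₃
        by_cases hm : z % 3 = z₀ % 3
        · exact cls z z₀ h₁ h₂ hz₀ (by linarith) h₃ ((c3 _).2 hz₀d) hm
        · rw [cls z (2 * z₀) h₁ h₂ (by linarith) (by linarith) h₃ ((c3 _).2 (by omega))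
            (by rw [Int.ModEq]; omega), legendreSym.mul, hres 2 two_pos (by linarith), one_mul]
      exact ⟨2, le_rfl, by linarith, by linarith, (c3 2).2 (by norm_num),
        fun z z' h₁ h₂ h₃ h₄ h₅ h₆ => (hz z h₁ h₂ h₅).trans (hz z' h₃ h₄ h₆).symm⟩
    · obtain ⟨z₀, hz₀, hz₀', hz₀d⟩ : ∃ z₀, X ≤ z₀ ∧ z₀ ≤ X + 1 ∧ ¬ 2 ∣ z₀ := by
        by_cases h2 : 2 ∣ X
        · exact ⟨X + 1, by omega, by omega, by omega⟩
        · exact ⟨X, by omega, by omega, h2⟩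
      have hz : ∀ z, X ≤ z → z ≤ n + 2 - X → IsCoprime z 4 →
          legendreSym p z = legendreSym p z₀ := by
        intro z h₁ h₂ h₃
        have hz₄ := (c4 z).1 h₃
        by_cases hm : z % 4 = z₀ % 4
        · exact cls z z₀ h₁ h₂ hz₀ (by linarith) h₃ ((c4 _).2 hz₀d) hm
        · rw [cls z (3 * z₀) h₁ h₂ (by linarith) (by linarith) h₃ ((c4 _).2 (by omega))
            (by rw [Int.ModEq]; omega), legendreSym.mul, hres 3 three_pos (by linarith), one_mul]
      exact ⟨3, by norm_num, by linarith, by linarith, (c4 3).2 (by norm_num),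
        fun z z' h₁ h₂ h₃ h₄ h₅ h₆ => (hz z h₁ h₂ h₅).trans (hz z' h₃ h₄ h₆).symm⟩
  have hpow : ∀ (e : ℕ) (z : ℤ), legendreSym p (g ^ e * z) = legendreSym p z := by
    intro e z
    induction e with
    | zero => simp
    | succ e ih =>
      rw [pow_succ', mul_assoc, legendreSym.mul, ih, hres g (by linarith) hgq, one_mul]
  obtain ⟨e, he₁, he₂⟩ := exists_pow_mul_mem_Icc hg2 hgX one_pos (by linarith)
  obtain ⟨f, hf₁, hf₂⟩ := exists_pow_mul_mem_Icc hg2 hgX (z := (q : ℤ)) (by linarith)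
    (by linarith)
  have := hall _ _ he₁ he₂ hf₁ hf₂ (hgd.pow_left.mul_left isCoprime_one_left)
    (hgd.pow_left.mul_left (hcop d hd hdq))
  rw [hpow, hpow, hq, hone] at this
  norm_num at this

theorem mem_Iclass {p n j x : ℕ} : x ∈ Iclass p n j ↔ (1 ≤ x ∧ x ≤ p - 1) ∧ x % n = j := by
  simp [Iclass]

theorem legendreSym_sub_of_mod_four {p : ℕ} [Fact p.Prime] (hp4 : p % 4 = 1) (x : ℤ) :
    legendreSym p (p - x) = legendreSym p x := by
  have hp2 : p ≠ 2 := by rintro rfl; norm_num at hp4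
  have h : legendreSym p (p - x) = legendreSym p (-1 * x) := by
    rw [legendreSym, legendreSym]
    simp
  rw [h, legendreSym.mul, legendreSym.at_neg_one hp2, ZMod.χ₄_nat_one_mod_four hp4, one_mul]

/-- Division by `n` modulo `p` maps `I_i` onto the integers of `(mp/n, (m+1)p/n)`,
where `n ∣ i + p m`. -/
theorem not_constant_on_Iclass {p : ℕ} [Fact p.Prime] (hp4 : p % 4 = 1) {n i : ℕ} (hn : 2 ≤ n)
    (hi : i < n) (hpn : (n + 1) ^ 2 < p) (hne : (2 * i) % n ≠ p % n) {s : ℤ} (hs : s ≠ 0) :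
    ¬ ∀ x ∈ Iclass p n i, legendreSym p x = s := by
  intro hconst
  have hp : p.Prime := Fact.out
  have hp2 : p ≠ 2 := by rintro rfl; norm_num at hp4
  have hp0 : (0 : ℤ) < p := by exact_mod_cast hp.pos
  have hn0 : (0 : ℤ) < n := by positivity
  have hnp : n < p := by nlinarith
  have hn_ne : legendreSym p n ≠ 0 := by
    rw [Ne, legendreSym.eq_zero_iff, Int.cast_natCast, ZMod.natCast_eq_zero_iff]
    exact Nat.not_dvd_of_pos_of_lt (by omega) hnp
  obtain ⟨u, v, huv⟩ : IsCoprime (n : ℤ) p :=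
    Nat.isCoprime_iff_coprime.2
      (hp.coprime_iff_not_dvd.2 (Nat.not_dvd_of_pos_of_lt (by omega) hnp)).symm
  obtain ⟨m, hm0, hmn, t, ht⟩ : ∃ m : ℤ, 0 ≤ m ∧ m < n ∧ (n : ℤ) ∣ i + p * m := by
    refine ⟨(-i * v) % n, Int.emod_nonneg _ hn0.ne', Int.emod_lt_of_pos _ hn0,
      i * u - p * (-i * v / n), ?_⟩
    have := Int.mul_ediv_add_emod (-i * v) n
    linear_combination p * this - i * huv
  have hJ : ∀ x : ℤ, m * p < n * x → n * x < (m + 1) * p →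
      legendreSym p x = s * legendreSym p n := by
    intro x h₁ h₂
    obtain ⟨y, hy⟩ : ∃ y : ℕ, (y : ℤ) = n * x - m * p := ⟨(n * x - m * p).toNat, by omega⟩
    have hyI : y ∈ Iclass p n i := by
      refine mem_Iclass.2 ⟨⟨by omega, ?_⟩, ?_⟩
      · have : (y : ℤ) < p := by linarith
        omega
      · have hmod : (y : ℤ) = i + n * (x - t) := by linear_combination hy - ht
        have : (y : ℤ) % n = i := by
          rw [hmod, Int.add_mul_emod_self_left]
          exact Int.emod_eq_of_lt (by positivity) (by exact_mod_cast hi)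
        exact_mod_cast this
    have := hconst y hyI
    rw [hy, legendreSym.mod, Int.sub_mul_emod_self_right, ← legendreSym.mod, legendreSym.mul]
      at this
    have hsq : legendreSym p n * legendreSym p n = 1 := by
      rw [← sq, legendreSym.sq_one]
      rwa [Ne, ← legendreSym.eq_zero_iff]
    linear_combination legendreSym p n * this - legendreSym p x * hsq
  have hs' := mul_ne_zero hs hn_ne
  have hmid : 2 * m + 1 ≠ n := by
    intro h
    apply hne
    have : (2 * i : ℤ) ≡ p [ZMOD n] :=
      Int.modEq_iff_dvd.2 ⟨p - 2 * t, by linear_combination p * h - 2 * ht⟩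
    exact (Int.natCast_modEq_iff.1 (by exact_mod_cast this))
  have hpn' : ((n : ℤ) + 1) ^ 2 < p := by exact_mod_cast hpn
  rcases lt_or_gt_of_ne hmid with h | h
  · exact not_constant_on_interval hp2 (by exact_mod_cast hn) hm0 (by omega) hpn' hs' hJ
  · refine not_constant_on_interval hp2 (m := n - 1 - m) (by exact_mod_cast hn) (by omega)
      (by omega) hpn' hs' fun x h₁ h₂ => ?_
    rw [← hJ (p - x) (by linarith) (by linarith), legendreSym_sub_of_mod_four hp4]

theorem fmap_eq {p : ℕ} [Fact p.Prime] {ε : ℤ} (hε : ε = 1 ∨ ε = -1) (hp2 : p ≠ 2) {x : ℕ}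
    (hx : 1 ≤ x ∧ x ≤ p - 1) :
    (ε * legendreSym p x = 1 ∧ fmap p ε ((p + 1) / 2) x = x) ∨
      (ε * legendreSym p x = -1 ∧ fmap p ε ((p + 1) / 2) x = p - x) := by
  have hp : p.Prime := Fact.out
  have hodd := hp.eq_two_or_odd'.resolve_left hp2
  have hx0 : ((x : ℤ) : ZMod p) ≠ 0 := by
    rw [Int.cast_natCast, Ne, ZMod.natCast_eq_zero_iff]
    exact Nat.not_dvd_of_pos_of_lt (by omega) (by omega)
  have hsign : ε * legendreSym p x = 1 ∨ ε * legendreSym p x = -1 := by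
    rcases hε with rfl | rfl <;> rcases legendreSym.eq_one_or_neg_one p hx0 with h | h <;>
      simp [h]
  have hval : fmap p ε ((p + 1) / 2) x = (((ε * legendreSym p x : ℤ) : ZMod p) * x).val := by
    have : (p + 1) / 2 = p / 2 + 1 := by
      obtain ⟨a, rfl⟩ := hodd
      omega
    rw [fmap, this, pow_succ, ← mul_assoc, Int.cast_mul, legendreSym.eq_pow, Int.cast_natCast]
  refine hsign.imp (fun h => ⟨h, ?_⟩) fun h => ⟨h, ?_⟩
  · rw [hval, h, Int.cast_one, one_mul, ZMod.val_natCast_of_lt (by omega)]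
  · have : ((-1 : ℤ) : ZMod p) * x = ((p - x : ℕ) : ZMod p) := by
      rw [Nat.cast_sub (by omega)]
      simp
    rw [hval, h, this, ZMod.val_natCast_of_lt (by omega)]

theorem sub_mem_Iclass {p n i x : ℕ} (hx : x ∈ Iclass p n i) :
    p - x ∈ Iclass p n ((p - i) % n) := by
  obtain ⟨hx, rfl⟩ := mem_Iclass.1 hx
  refine mem_Iclass.2 ⟨by omega, ?_⟩
  have hdiv := Nat.div_add_mod x n
  rw [show p - x = p - x % n - n * (x / n) by omega, Nat.sub_mul_mod (by omega)]

theorem sub_mod_eq_iff {p n i : ℕ} (hi : i < n) (hip : i ≤ p) :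
    (p - i) % n = i ↔ (2 * i) % n = p % n := by
  conv_lhs => rhs; rw [← Nat.mod_eq_of_lt hi]
  change p - i ≡ i [MOD n] ↔ 2 * i ≡ p [MOD n]
  have h : 2 * i ≡ p [MOD n] ↔ i + i ≡ p - i + i [MOD n] := by
    rw [two_mul, Nat.sub_add_cancel hip]
  rw [h]
  exact ⟨fun h => (h.add_right i).symm, fun h => (h.add_right_cancel' i).symm⟩

theorem stmt_6 (p n : ℕ) (ε : ℤ) (hp : p.Prime) (hp4 : p % 4 = 1)
    (hε : ε = 1 ∨ ε = -1) (hn : 2 ≤ n) (i : ℕ) (hi : i ≤ n - 1) :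
    -- (1) if `n` is odd and `2i ≡ p (mod n)`, then `f(I_i) = I_i`
    (Odd n → (2 * i) % n = p % n →
      (Iclass p n i).image (fmap p ε ((p + 1) / 2)) = Iclass p n i) ∧
    -- (2) if `n` is even, or `n` is odd and `2i ≢ p (mod n)`, and `p > (n+1)²`, then
    -- `f(I_i)` meets exactly the two classes `I_i` and `I_{p-i mod n}`, which are distinct
    ((Even n ∨ (Odd n ∧ (2 * i) % n ≠ p % n)) → (n + 1) ^ 2 < p →
      ((p - i) % n ≠ i ∧
        ∀ j : ℕ, j ≤ n - 1 →
          (((Iclass p n i).image (fmap p ε ((p + 1) / 2)) ∩ Iclass p n j).Nonempty ↔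
            (j = i ∨ j = (p - i) % n)))) := by
  have : Fact p.Prime := ⟨hp⟩
  have hp2 : p ≠ 2 := by rintro rfl; norm_num at hp4
  have hin : i < n := by omega
  refine ⟨fun _ h2i => ?_, fun hcase hpn => ?_⟩
  · have hleg : ∀ x ≤ p, legendreSym p ((p - x : ℕ) : ℤ) = legendreSym p x := fun x hx => by
      rw [Nat.cast_sub hx, legendreSym_sub_of_mod_four hp4]
    have hsub : ∀ x ∈ Iclass p n i, p - x ∈ Iclass p n i := fun x hx => by
      have hx' := mem_Iclass.1 hx
      have hxi := Nat.mod_le x n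
      have := sub_mem_Iclass hx
      rwa [(sub_mod_eq_iff hin (by omega)).2 h2i] at this
    ext y
    rw [Finset.mem_image]
    constructor
    · rintro ⟨x, hx, rfl⟩
      rcases fmap_eq hε hp2 (mem_Iclass.1 hx).1 with ⟨-, h⟩ | ⟨-, h⟩ <;> rw [h]
      exacts [hx, hsub x hx]
    · intro hy
      have hy1 := (mem_Iclass.1 hy).1
      rcases fmap_eq hε hp2 hy1 with ⟨-, h⟩ | ⟨h, -⟩
      · exact ⟨y, hy, h⟩
      · refine ⟨p - y, hsub y hy, ?_⟩
        rcases fmap_eq hε hp2 (mem_Iclass.1 (hsub y hy)).1 with ⟨h', -⟩ | ⟨-, h'⟩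
        · rw [hleg y (by omega), h] at h'
          norm_num at h'
        · rw [h']
          omega
  · have hne : (2 * i) % n ≠ p % n := by
      rcases hcase with h | h
      · intro h'
        have : 2 * i ≡ p [MOD 2] := Nat.ModEq.of_dvd h.two_dvd h'
        rw [Nat.ModEq] at this
        omega
      · exact h.2
    have hip : i ≤ p := by nlinarith
    have hεε : ε * ε = 1 := by rcases hε with rfl | rfl <;> norm_num
    have hε0 : ε ≠ 0 := by rintro rfl; norm_num at hεε
    refine ⟨fun h => hne ((sub_mod_eq_iff hin hip).1 h), fun j _ => ⟨?_, ?_⟩⟩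
    · rintro ⟨y, hy⟩
      rw [Finset.mem_inter, Finset.mem_image] at hy
      obtain ⟨⟨x, hx, rfl⟩, hy⟩ := hy
      have hyj := (mem_Iclass.1 hy).2
      rcases fmap_eq hε hp2 (mem_Iclass.1 hx).1 with ⟨-, h⟩ | ⟨-, h⟩ <;> rw [h] at hyj
      · exact Or.inl (hyj.symm.trans (mem_Iclass.1 hx).2)
      · exact Or.inr (hyj.symm.trans (mem_Iclass.1 (sub_mem_Iclass hx)).2)
    · rintro (rfl | rfl)
      · by_contra hempty
        refine not_constant_on_Iclass hp4 hn hin hpn hne (neg_ne_zero.2 hε0) fun x hx => ?_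
        rcases fmap_eq hε hp2 (mem_Iclass.1 hx).1 with ⟨-, h⟩ | ⟨h, -⟩
        · exact (hempty ⟨x, Finset.mem_inter.2 ⟨Finset.mem_image.2 ⟨x, hx, h⟩, hx⟩⟩).elim
        · linear_combination ε * h - legendreSym p x * hεε
      · by_contra hempty
        refine not_constant_on_Iclass hp4 hn hin hpn hne hε0 fun x hx => ?_
        rcases fmap_eq hε hp2 (mem_Iclass.1 hx).1 with ⟨h, -⟩ | ⟨-, h⟩
        · linear_combination ε * h - legendreSym p x * hεε
        · exact (hempty ⟨p - x, Finset.mem_inter.2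
            ⟨Finset.mem_image.2 ⟨x, hx, h⟩, sub_mem_Iclass hx⟩⟩).elim
end

section
/- Let t be a positive integer and p a prime with p ≡ 1 (mod 4) such that the Legendre symbol (p/q) equals +1 for every prime q ≡ 1 (mod 4) with 3 ≤ q ≤ 4t−1 and equals −1 for every prime q ≡ 3 (mod 4) with 3 ≤ q ≤ 4t−1. Let n be an integer with n ≡ 2 (mod 4) and 2p/(4t+1) ≤ n < 2p/(4t−1), and let f(x) = (2 x^{(p+1)/2} mod p) on I. Then for i := (2p − (4t−1)n)/4 with j := (2i mod n) if (n/p) = −1 and j := (p − 2i mod n) if (n/p) = +1, one has f(I_i) ⊆ I_j; and likewise for i := (2p − (4t−3)n)/4 with j := (p − 2i mod n) if (n/p) = −1 and j := (2i mod n) if (n/p) = +1, one has f(I_i) ⊆ I_j. -/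
open ZMod in
/-- Under the prescribed symbols at odd primes up to `4t - 1`, the Legendre symbol modulo `p`
agrees with `χ₄` on odd integers up to that bound. -/
theorem legendreSym_eq_χ₄_of_odd (p t : ℕ) [hp : Fact p.Prime] (hp4 : p % 4 = 1)
    (hq : ∀ (q : ℕ) (hq' : Fact q.Prime), 3 ≤ q → q ≤ 4 * t - 1 →
      (q % 4 = 1 → @legendreSym q hq' p = 1) ∧ (q % 4 = 3 → @legendreSym q hq' p = -1))
    (d : ℕ) (hd : d % 2 = 1) (hdt : d ≤ 4 * t - 1) :
    legendreSym p d = χ₄ (d : ZMod 4) := by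
  induction d using Nat.strong_induction_on with
  | _ d ih =>
    rcases eq_or_ne d 1 with rfl | h1
    · simp [legendreSym.at_one]
    · have hprime := Nat.minFac_prime h1
      obtain ⟨e, he⟩ := Nat.minFac_dvd d
      set q := d.minFac
      have hmod : q % 2 = 1 ∧ e % 2 = 1 :=
        Nat.odd_mul.mp (he ▸ Nat.odd_iff.mpr hd) |>.imp Nat.odd_iff.mp Nat.odd_iff.mp
      have hq2 := hprime.two_le
      have he1 : 1 ≤ e := by lia
      have hqd : q ≤ d := by nlinarith
      have hed : e < d := by nlinarith
      have hE := ih e hed hmod.2 (by lia)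
      have : Fact q.Prime := ⟨hprime⟩
      have hQ : legendreSym p q = χ₄ (q : ZMod 4) := by
        rw [← legendreSym.quadratic_reciprocity_one_mod_four hp4 (by lia)]
        have hs := hq q ⟨hprime⟩ (by lia) (by lia)
        rcases (show q % 4 = 1 ∨ q % 4 = 3 by lia) with h | h
        · rw [hs.1 h, χ₄_nat_one_mod_four h]
        · rw [hs.2 h, χ₄_nat_three_mod_four h]
      rw [he]
      push_cast
      rw [legendreSym.mul, hQ, hE, map_mul]

theorem legendreSym_neg_of_mod_four_eq_one (p : ℕ) [hp : Fact p.Prime] (hp4 : p % 4 = 1) (a : ℤ) :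
    legendreSym p (-a) = legendreSym p a := by
  rw [← neg_one_mul, legendreSym.mul, legendreSym.at_neg_one (by lia),
    ZMod.χ₄_nat_one_mod_four hp4, one_mul]

theorem legendreSym_congr (p : ℕ) [hp : Fact p.Prime] {a b : ℤ} (h : (p : ℤ) ∣ a - b) :
    legendreSym p a = legendreSym p b := by
  rw [legendreSym.mod p a, legendreSym.mod p b,
    Int.emod_eq_emod_iff_emod_sub_eq_zero.mpr (Int.emod_eq_zero_of_dvd h)]

theorem fmap_two_cast (p : ℕ) [hp : Fact p.Prime] (hp2 : p % 2 = 1) (x : ℕ) :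
    ((fmap p 2 ((p + 1) / 2) x : ℕ) : ZMod p) = ((2 * legendreSym p x * x : ℤ) : ZMod p) := by
  have h : (p + 1) / 2 = p / 2 + 1 := by lia
  rw [fmap, ZMod.natCast_zmod_val, h, pow_succ]
  push_cast
  rw [legendreSym.eq_pow]
  push_cast
  ring

theorem fmap_lt (p : ℕ) [hp : Fact p.Prime] (A : ℤ) (k x : ℕ) : fmap p A k x < p :=
  ZMod.val_lt _

theorem fmap_two_eq_of_dvd_sub (p : ℕ) [hp : Fact p.Prime] (hp2 : p % 2 = 1) (x y : ℕ) (hy : y < p)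
    (h : (p : ℤ) ∣ 2 * legendreSym p x * x - y) : fmap p 2 ((p + 1) / 2) x = y := by
  have h1 := fmap_two_cast p hp2 x
  have h2 := (ZMod.intCast_eq_intCast_iff_dvd_sub (y : ℤ) (2 * legendreSym p x * x) p).mpr h
  rw [← h2, Int.cast_natCast, ZMod.natCast_eq_natCast_iff'] at h1
  rwa [Nat.mod_eq_of_lt hy, Nat.mod_eq_of_lt (fmap_lt p 2 _ x)] at h1

open ZMod in
/-- The image of a residue class whose representative is `i = (2p - an) / 4` with `a` odd. -/
theorem image_fmap_two_subset (p t n a i : ℕ) [hp : Fact p.Prime] (hp4 : p % 4 = 1)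
    (hq : ∀ (q : ℕ) (hq' : Fact q.Prime), 3 ≤ q → q ≤ 4 * t - 1 →
      (q % 4 = 1 → @legendreSym q hq' p = 1) ∧ (q % 4 = 3 → @legendreSym q hq' p = -1))
    (hn0 : 0 < n) (hnp : n < p) (hn2 : n % 2 = 0) (hlo : 2 * p ≤ n * (4 * t + 1))
    (ha : a % 2 = 1) (hi : 4 * i + a * n = 2 * p) :
    (Iclass p n i).image (fmap p 2 ((p + 1) / 2)) ⊆
      Iclass p n (if legendreSym p n * χ₄ (a : ZMod 4) = 1
        then (2 * i) % n else (p - 2 * i) % n) := by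
  intro y hy
  obtain ⟨x, hx, rfl⟩ := Finset.mem_image.mp hy
  simp only [Iclass, Finset.mem_filter, Finset.mem_Icc] at hx ⊢
  obtain ⟨⟨hx1, hxp⟩, hxi⟩ := hx
  obtain ⟨k, hk⟩ : ∃ k, x = i + n * k := ⟨x / n, by rw [← hxi, Nat.mod_add_div]⟩
  have hp0 := hp.out.two_le
  have hχ : χ₄ (a : ZMod 4) = 1 ∨ χ₄ (a : ZMod 4) = -1 := by
    rcases (show a % 4 = 1 ∨ a % 4 = 3 by lia) with h | h
    · exact .inl (χ₄_nat_one_mod_four h)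
    · exact .inr (χ₄_nat_three_mod_four h)
  have hN : legendreSym p n = 1 ∨ legendreSym p n = -1 := by
    apply legendreSym.eq_one_or_neg_one
    rw [Int.cast_natCast, Ne, ZMod.natCast_eq_zero_iff]
    exact Nat.not_dvd_of_pos_of_lt hn0 hnp
  have hL4 : legendreSym p (4 * x) = legendreSym p x := by
    have h2 : legendreSym p ((2 : ℤ) ^ 2) = 1 := legendreSym.sq_one' p (by
      rw [show ((2 : ℤ) : ZMod p) = ((2 : ℕ) : ZMod p) by norm_num, Ne,
        ZMod.natCast_eq_zero_iff]
      exact Nat.not_dvd_of_pos_of_lt (by lia) (by lia))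
    rw [legendreSym.mul, show (4 : ℤ) = 2 ^ 2 by norm_num, h2, one_mul]
  have h4x : 4 * x + a * n = 2 * p + 4 * k * n := by rw [hk]; linarith
  have hcong (c : ℕ) (hc : c % 2 = 1) (hct : c * n < 2 * p)
      (hcx : (p : ℤ) ∣ 4 * x - c * n ∨ (p : ℤ) ∣ 4 * x - -(c * n)) :
      legendreSym p x = legendreSym p n * χ₄ (c : ZMod 4) := by
    have hle : c ≤ 4 * t - 1 := by
      have : c < 4 * t + 1 := by
        by_contra! h
        nlinarith
      lia
    rw [← hL4, ← legendreSym_eq_χ₄_of_odd p t hp4 hq c hc hle,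
      mul_comm (legendreSym p n), ← legendreSym.mul]
    rcases hcx with h | h
    · exact legendreSym_congr p h
    · rw [legendreSym_congr p h, legendreSym_neg_of_mod_four_eq_one p hp4]
  have h2i : 2 * i ≤ p := by lia
  have hone (h : legendreSym p n * χ₄ (a : ZMod 4) ≠ 1) :
      legendreSym p n * χ₄ (a : ZMod 4) = -1 := by
    rcases hN with h' | h' <;> rcases hχ with h'' | h'' <;> rw [h', h''] at h ⊢ <;> lia
  have hval (y : ℕ) (hy1 : 0 < y) (hy : y < p) (hmod : (p : ℤ) ∣ 2 * legendreSym p x * x - y)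
      (r : ℕ) (hr : (n : ℤ) ∣ y - r) :
      (1 ≤ fmap p 2 ((p + 1) / 2) x ∧ fmap p 2 ((p + 1) / 2) x ≤ p - 1) ∧
        fmap p 2 ((p + 1) / 2) x % n = r % n := by
    rw [fmap_two_eq_of_dvd_sub p (by lia) x y hy hmod]
    exact ⟨⟨hy1, by lia⟩, (Nat.modEq_iff_dvd.mpr hr).symm⟩
  rw [← apply_ite (fun r => r % n)]
  have hi' : (4 * i + a * n : ℤ) = 2 * p := by exact_mod_cast hi
  have hk' : (x : ℤ) = i + n * k := by exact_mod_cast hk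
  obtain ⟨l, rfl⟩ : ∃ l, n = 2 * l := ⟨n / 2, by lia⟩
  push_cast at hi' hk'
  have hip : ((p - 2 * i : ℕ) : ℤ) = p - 2 * i := by push_cast [h2i]; ring
  rcases le_or_gt (4 * k) a with hka | hka
  · obtain ⟨c, rfl⟩ := Nat.exists_eq_add_of_le hka
    have hx4 : 4 * x + c * (2 * l) = 2 * p := by linarith
    have hx4' : (4 * x + c * (2 * l) : ℤ) = 2 * p := by exact_mod_cast hx4
    have hc0 : 0 < c := by lia
    have hcn : 0 < c * (2 * l) := by positivity
    have hx := hcong c (by lia) (by lia) (.inr ⟨2, by push_cast; linarith⟩)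
    rw [show ((4 * k + c : ℕ) : ZMod 4) = c by
      push_cast; rw [show (4 : ZMod 4) = 0 from rfl]; ring, ← hx] at hone ⊢
    split_ifs with h1
    · refine hval (2 * x) (by lia) (by lia) ⟨0, ?_⟩ _ ⟨2 * k, ?_⟩
      · rw [h1]; push_cast; ring
      · push_cast; linarith
    · have h1' := hone h1
      refine hval (p - 2 * x) (by lia) (by lia) ⟨-1, ?_⟩ _ ⟨-2 * k, ?_⟩
      · rw [h1']; push_cast [show 2 * x ≤ p by lia]; ring
      · rw [hip]; push_cast [show 2 * x ≤ p by lia]; linarith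
  · obtain ⟨c, hc⟩ := Nat.exists_eq_add_of_le hka.le
    have hc' : (4 * k : ℤ) = a + c := by exact_mod_cast hc
    have hx4 : 4 * x = 2 * p + c * (2 * l) := by
      rw [hc] at h4x
      linarith
    have hx4' : (4 * x : ℤ) = 2 * p + c * (2 * l) := by exact_mod_cast hx4
    have hc0 : 0 < c := by lia
    have hcn : 0 < c * (2 * l) := by positivity
    have hx := hcong c (by lia) (by lia) (.inl ⟨2, by push_cast; linarith⟩)
    have hneg : χ₄ (c : ZMod 4) = -χ₄ (a : ZMod 4) := by
      rcases (show a % 4 = 1 ∨ a % 4 = 3 by lia) with h | h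
      · rw [χ₄_nat_one_mod_four h, χ₄_nat_three_mod_four (by lia)]
      · rw [χ₄_nat_three_mod_four h, χ₄_nat_one_mod_four (by lia), neg_neg]
    rw [hneg, mul_neg] at hx
    split_ifs with h1
    · rw [h1] at hx
      refine hval (2 * p - 2 * x) (by lia) (by lia) ⟨-2, ?_⟩ _ ⟨a - 2 * k, ?_⟩
      · rw [hx]; push_cast [show 2 * x ≤ 2 * p by lia]; ring
      · push_cast [show 2 * x ≤ 2 * p by lia]; linarith
    · rw [hone h1, neg_neg] at hx
      refine hval (2 * x - p) (by lia) (by lia) ⟨1, ?_⟩ _ ⟨2 * k - a, ?_⟩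
      · rw [hx]; push_cast [show p ≤ 2 * x by lia]; ring
      · rw [hip]; push_cast [show p ≤ 2 * x by lia]; linarith

theorem stmt_7 (p t n : ℕ) [hp : Fact p.Prime] (ht : 1 ≤ t) (hp4 : p % 4 = 1)
    (hq : ∀ (q : ℕ) (hq' : Fact q.Prime), 3 ≤ q → q ≤ 4 * t - 1 →
      (q % 4 = 1 → @legendreSym q hq' p = 1) ∧ (q % 4 = 3 → @legendreSym q hq' p = -1))
    (hn2 : n % 4 = 2) (hlo : 2 * p ≤ n * (4 * t + 1)) (hhi : n * (4 * t - 1) < 2 * p) :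
    (∀ i : ℕ, i = (2 * p - (4 * t - 1) * n) / 4 →
      (Iclass p n i).image (fmap p 2 ((p + 1) / 2)) ⊆
        Iclass p n (if legendreSym p n = -1 then (2 * i) % n else (p - 2 * i) % n)) ∧
    (∀ i : ℕ, i = (2 * p - (4 * t - 3) * n) / 4 →
      (Iclass p n i).image (fmap p 2 ((p + 1) / 2)) ⊆
        Iclass p n (if legendreSym p n = -1 then (p - 2 * i) % n else (2 * i) % n)) := by
  have hnp : n < p := by
    have : 3 ≤ 4 * t - 1 := by lia
    nlinarith
  have hN : legendreSym p n = 1 ∨ legendreSym p n = -1 := by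
    apply legendreSym.eq_one_or_neg_one
    rw [Int.cast_natCast, Ne, ZMod.natCast_eq_zero_iff]
    exact Nat.not_dvd_of_pos_of_lt (by lia) hnp
  obtain ⟨s, rfl⟩ : ∃ s, t = s + 1 := ⟨t - 1, by lia⟩
  obtain ⟨m, rfl⟩ : ∃ m, n = 4 * m + 2 := ⟨n / 4, by lia⟩
  rw [show 4 * (s + 1) - 1 = 4 * s + 3 by lia, show 4 * (s + 1) - 3 = 4 * s + 1 by lia] at *
  have e3 : (4 * s + 3) * (4 * m + 2) = 4 * (4 * s * m + 2 * s + 3 * m + 1) + 2 := by ring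
  have e1 : (4 * s + 1) * (4 * m + 2) = 4 * (4 * s * m + 2 * s + m) + 2 := by ring
  have hr : (4 * m + 2) * (4 * s + 3) = (4 * s + 3) * (4 * m + 2) := mul_comm _ _
  constructor <;> intro i hi
  · have h := image_fmap_two_subset p (s + 1) (4 * m + 2) (4 * s + 3) i hp4
      (fun q hq' h₁ h₂ => hq q hq' h₁ (by lia)) (by lia) hnp (by lia) hlo (by lia) (by lia)
    rw [ZMod.χ₄_nat_three_mod_four (by lia)] at h
    rcases hN with hN | hN <;> rw [hN] at h ⊢ <;> simpa using h
  · have h := image_fmap_two_subset p (s + 1) (4 * m + 2) (4 * s + 1) i hp4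
      (fun q hq' h₁ h₂ => hq q hq' h₁ (by lia)) (by lia) hnp (by lia) hlo (by lia) (by lia)
    rw [ZMod.χ₄_nat_one_mod_four (by lia)] at h
    rcases hN with hN | hN <;> rw [hN] at h ⊢ <;> simpa using h
end

section
/- Let t be a positive integer and p > t a prime with p ≡ 1 (mod 8) such that the Legendre symbol (p/q) = 1 for all odd primes q ≤ t. Then for any integer n > (p−1)/(t+1) with n ≥ 2, the map f(x) = ((n/p)·x^{(p+1)/2} mod p) satisfies f(x) = x for every x ∈ I_0, i.e., f is the identity map on I_0. -/
/-- If every prime `q ≤ t` is a quadratic residue mod `p`, then so is every `m` with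
`1 ≤ m ≤ t`. -/
theorem legendreSym_eq_one_of_primes_le (p t : ℕ) [Fact p.Prime]
    (h : ∀ q : ℕ, q.Prime → q ≤ t → legendreSym p q = 1) (m : ℕ) (hm : m ≠ 0) (hmt : m ≤ t) :
    legendreSym p m = 1 := by
  induction m using induction_on_primes with
  | zero => exact absurd rfl hm
  | one => simp
  | prime_mul q a hq ih =>
    have ha : a ≠ 0 := right_ne_zero_of_mul hm
    have hqt : q ≤ t := (Nat.le_mul_of_pos_right q (Nat.pos_of_ne_zero ha)).trans hmt
    have hat : a ≤ t := (Nat.le_mul_of_pos_left a hq.pos).trans hmt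
    rw [Nat.cast_mul, legendreSym.mul, h q hq hqt, ih ha hat, one_mul]

/-- Euler's criterion in the form `x ^ ((p + 1) / 2) = (x / p) x`. -/
theorem pow_succ_div_two_eq_legendreSym_mul (p : ℕ) [Fact p.Prime] (hp2 : p ≠ 2) (x : ℕ) :
    (x : ZMod p) ^ ((p + 1) / 2) = (legendreSym p x : ZMod p) * x := by
  have hodd := (Fact.out : p.Prime).eq_two_or_odd.resolve_left hp2
  rw [legendreSym.eq_pow, show (p + 1) / 2 = p / 2 + 1 by lia, pow_succ, Int.cast_natCast]

theorem stmt_8 (p t n : ℕ) [hp : Fact p.Prime] (ht : 1 ≤ t) (hpt : t < p)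
    (hp8 : p % 8 = 1)
    (hq : ∀ (q : ℕ) (hq' : Fact q.Prime), Odd q → q ≤ t → @legendreSym q hq' p = 1)
    (hn : 2 ≤ n) (hn' : p - 1 < n * (t + 1)) :
    ∀ x ∈ Iclass p n 0, fmap p (legendreSym p n) ((p + 1) / 2) x = x := by
  intro x hx
  obtain ⟨hxI, hxn⟩ := Finset.mem_filter.mp hx
  obtain ⟨hx1, hxp⟩ := Finset.mem_Icc.mp hxI
  have hp2 : p ≠ 2 := by lia
  have hprime : ∀ q : ℕ, q.Prime → q ≤ t → legendreSym p q = 1 := by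
    intro q hqp hqt
    have : Fact q.Prime := ⟨hqp⟩
    rcases hqp.eq_two_or_odd' with rfl | hodd
    · rw [Nat.cast_ofNat, legendreSym.at_two hp2, ZMod.χ₈_nat_mod_eight, hp8]
      decide
    · have hq2 : q ≠ 2 := by rintro rfl; revert hodd; decide
      rw [← legendreSym.quadratic_reciprocity_one_mod_four (by lia) hq2]
      exact hq q this hodd hqt
  obtain ⟨m, rfl⟩ := Nat.dvd_of_mod_eq_zero hxn
  have hm : m ≠ 0 := by rintro rfl; simp at hx1
  have hmt : m ≤ t := Nat.lt_succ_iff.mp (lt_of_mul_lt_mul_left' (hxp.trans_lt hn'))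
  have hn0 : ((n : ℤ) : ZMod p) ≠ 0 := by
    rw [Int.cast_natCast, Ne, ZMod.natCast_eq_zero_iff]
    intro hdvd
    have := Nat.le_of_dvd (by lia) (hdvd.mul_right m)
    lia
  have hsym : legendreSym p (n * m : ℕ) = legendreSym p n := by
    rw [Nat.cast_mul, legendreSym.mul, legendreSym_eq_one_of_primes_le p t hprime m hm hmt, mul_one]
  rw [fmap, pow_succ_div_two_eq_legendreSym_mul p hp2, hsym, ← mul_assoc, ← Int.cast_mul, ← sq,
    legendreSym.sq_one p hn0, Int.cast_one, one_mul]
  exact ZMod.val_cast_of_lt (by lia)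
end

section
/- Let p ≡ 1 (mod 4) be prime, T a positive integer, t = 2T, and suppose that the Legendre symbol (x/p) = (2/p) for all x with (p+1)/2 − T ≤ x ≤ (p−1)/2 + T; set a = (p+1)/2 − T. Suppose either n is even with 2p/(t+1) < n < 2p/(t−1) and i := a·n − (n/2 − 1)·p, or n is odd with p/(t+1) < n < p/(t−1) and i := a·n − ((n−1)/2)·p. Then the map f(x) = ((2n/p)·x^{(p+1)/2} mod p) satisfies f(x) = x for every x ∈ I_i, i.e., f is the identity map on I_i. -/
/-- `IclassZ p n i` is the residue class `I_i = {x : 1 ≤ x ≤ p-1, x ≡ i (mod n)}`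
for an integer `i`. -/
def IclassZ (p n : ℕ) (i : ℤ) : Finset ℕ :=
  (Finset.Icc 1 (p - 1)).filter fun x => (x : ℤ) % (n : ℤ) = i % (n : ℤ)

/-- Multiplying `x ^ ((p + 1) / 2)` by the Legendre symbol of `x` gives back `x`. -/
theorem fmap_legendreSym_self (p : ℕ) [Fact p.Prime] (hp2 : p % 2 = 1) {x : ℕ}
    (hx0 : 1 ≤ x) (hxp : x < p) :
    fmap p (legendreSym p x) ((p + 1) / 2) x = x := by
  have hne : ((x : ℤ) : ZMod p) ≠ 0 := by
    rw [Int.cast_natCast, Ne, ZMod.natCast_eq_zero_iff]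
    exact Nat.not_dvd_of_pos_of_lt hx0 hxp
  have hpow : (x : ZMod p) ^ (p / 2) = ((legendreSym p x : ℤ) : ZMod p) := by
    rw [legendreSym.eq_pow, Int.cast_natCast]
  have hsq : ((legendreSym p x : ℤ) : ZMod p) * ((legendreSym p x : ℤ) : ZMod p) = 1 := by
    have h := legendreSym.sq_one p hne
    rw [sq] at h
    exact_mod_cast congrArg (Int.cast : ℤ → ZMod p) h
  have hexp : (p + 1) / 2 = p / 2 + 1 := by omega
  rw [fmap, hexp, pow_succ, hpow, ← mul_assoc, hsq, one_mul, ZMod.val_natCast_of_lt hxp]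

/-- If `b * n` lies within one of the two relevant intervals of length `p`,
then `b` lies within distance `T` of `p / 2`. -/
theorem near_half_of_mul_bounds {p T n m b : ℤ} (hn : 0 < n) (hm0 : 0 ≤ m) (hp0 : 0 < p)
    (hp2 : p % 2 = 1)
    (hlow : m * p < b * n) (hupp : b * n < (m + 1) * p)
    (hm : (n = 2 * m + 2 ∧ 2 * p < n * (2 * T + 1)) ∨ (n = 2 * m + 1 ∧ p < n * (2 * T + 1))) :
    0 < b ∧ (p + 1) / 2 - T ≤ b ∧ b ≤ (p - 1) / 2 + T := by
  have hb : 0 < b := pos_of_mul_pos_left (lt_of_le_of_lt (by positivity) hlow) hn.le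
  have h1 : p - 2 * T - 1 < 2 * b := by
    apply lt_of_mul_lt_mul_right _ hn.le
    rcases hm with ⟨rfl, h⟩ | ⟨rfl, h⟩ <;> nlinarith
  have h2 : 2 * b < p + 2 * T + 1 := by
    apply lt_of_mul_lt_mul_right _ hn.le
    rcases hm with ⟨rfl, h⟩ | ⟨rfl, h⟩ <;> nlinarith
  refine ⟨hb, ?_, ?_⟩ <;> omega

theorem stmt_9 (p T n : ℕ) [hp : Fact p.Prime] (hp4 : p % 4 = 1) (hT : 1 ≤ T)
    (hn : 2 ≤ n)
    (hleg : ∀ x : ℕ, ((p : ℤ) + 1) / 2 - (T : ℤ) ≤ (x : ℤ) →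
      (x : ℤ) ≤ ((p : ℤ) - 1) / 2 + (T : ℤ) → legendreSym p x = legendreSym p 2)
    (i : ℤ)
    (hni : (Even n ∧ 2 * p < n * (2 * T + 1) ∧ n * (2 * T - 1) < 2 * p ∧
              i = (((p : ℤ) + 1) / 2 - (T : ℤ)) * (n : ℤ) - ((n : ℤ) / 2 - 1) * (p : ℤ)) ∨
           (Odd n ∧ p < n * (2 * T + 1) ∧ n * (2 * T - 1) < p ∧
              i = (((p : ℤ) + 1) / 2 - (T : ℤ)) * (n : ℤ) - (((n : ℤ) - 1) / 2) * (p : ℤ))) :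
    ∀ x ∈ IclassZ p n i, fmap p (legendreSym p (2 * n)) ((p + 1) / 2) x = x := by
  intro x hx
  simp only [IclassZ, Finset.mem_filter, Finset.mem_Icc] at hx
  obtain ⟨⟨hx0, hxp⟩, hmod⟩ := hx
  have hp1 := hp.out.two_le
  obtain ⟨m, hm0, hi, hm⟩ : ∃ m : ℤ, 0 ≤ m ∧
      i = (((p : ℤ) + 1) / 2 - (T : ℤ)) * (n : ℤ) - m * (p : ℤ) ∧
      (((n : ℤ) = 2 * m + 2 ∧ 2 * (p : ℤ) < n * (2 * T + 1)) ∨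
        ((n : ℤ) = 2 * m + 1 ∧ (p : ℤ) < n * (2 * T + 1))) := by
    rcases hni with ⟨he, h1, -, h3⟩ | ⟨ho, h1, -, h3⟩
    · obtain ⟨c, rfl⟩ := he
      exact ⟨_, by omega, h3, Or.inl ⟨by omega, by exact_mod_cast h1⟩⟩
    · obtain ⟨c, rfl⟩ := ho
      exact ⟨_, by omega, h3, Or.inr ⟨by omega, by exact_mod_cast h1⟩⟩
  obtain ⟨k, hk⟩ := Int.ModEq.dvd (show i ≡ (x : ℤ) [ZMOD n] from hmod.symm)
  obtain ⟨b, hb⟩ : ∃ b : ℤ, (x : ℤ) = b * n - m * p :=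
    ⟨((p : ℤ) + 1) / 2 - (T : ℤ) + k, by rw [hi] at hk; linear_combination hk⟩
  have hxp' : (x : ℤ) < p := by omega
  obtain ⟨hbpos, hlow, hupp⟩ := near_half_of_mul_bounds (p := p) (T := T) (n := n) (m := m) (b := b)
    (by omega) hm0 (by omega) (by omega) (by omega) (by linarith) hm
  lift b to ℕ using hbpos.le
  have hxsym : legendreSym p x = legendreSym p (2 * n) := by
    rw [legendreSym.mul, ← hleg b hlow hupp, ← legendreSym.mul, legendreSym.mod p (x : ℤ),
      legendreSym.mod p ((b : ℤ) * n), hb, Int.sub_mul_emod_self_right]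
  rw [← hxsym]
  exact fmap_legendreSym_self p (by omega) hx0 (by omega)
end

section
/- Let p ≡ 1 (mod 3) be prime, T a positive integer, t = 2T, a = (p+1)/2 − T, and suppose that x^{(p−1)/3} ≡ a^{(p−1)/3} (mod p) for all x with a ≤ x ≤ (p−1)/2 + T. Let n ≥ 2 and i be as follows: either n is even with 2p/(t+1) < n < 2p/(t−1) and i = a·n − (n/2 − 1)·p, or n is odd with p/(t+1) < n < p/(t−1) and i = a·n − ((n−1)/2)·p. Then: (1) for k = j(p−1)/3 + 1 with j ∈ {1, 2} and gcd(k, p−1) = 1, the map f(x) = ((an)^{2(k−1)} x^k mod p) satisfies f(x) = x for every x ∈ I_i; (2) if moreover n is odd, then for k = j(p−1)/6 + 1 with j ∈ {1, 5} and gcd(k, p−1) = 1, the map f(x) = ((an)^{2(k−1)} x^k mod p) satisfies f(I_i) = I_i. -/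
theorem mem_IclassZ_iff {p n : ℕ} {i : ℤ} {x : ℕ} :
    x ∈ IclassZ p n i ↔ (1 ≤ x ∧ x ≤ p - 1) ∧ (x : ℤ) ≡ i [ZMOD n] := by
  simp [IclassZ, Int.ModEq]

/-- If the progression `n * y - h * p` leaves the interval `(0, p)` outside `a ≤ y ≤ b`, then every
element of the class of `a * n - h * p` comes from some `y` with `a ≤ y ≤ b`. -/
theorem exists_eq_mul_sub_of_mem_IclassZ {p n x : ℕ} {a b h : ℤ} (hn : 0 < n)
    (hlow : n * (a - 1) ≤ h * p) (hhigh : (h + 1) * p ≤ n * (b + 1))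
    (hx : x ∈ IclassZ p n (a * n - h * p)) :
    ∃ y : ℤ, a ≤ y ∧ y ≤ b ∧ (x : ℤ) = n * y - h * p := by
  obtain ⟨⟨h1, h2⟩, h3⟩ := mem_IclassZ_iff.1 hx
  obtain ⟨m, hm⟩ := h3.symm.dvd
  have hn' : (0 : ℤ) < n := by exact_mod_cast hn
  have hxp : (x : ℤ) < p := by omega
  have hx0 : (0 : ℤ) < x := by omega
  have hxy : (x : ℤ) = n * (a + m) - h * p := by linear_combination hm
  refine ⟨a + m, ?_, ?_, hxy⟩
  · have : a - 1 < a + m := lt_of_mul_lt_mul_left (a := (n : ℤ)) (by linarith) hn'.le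
    omega
  · have : a + m < b + 1 := lt_of_mul_lt_mul_left (a := (n : ℤ)) (by linarith) hn'.le
    omega

theorem ZMod.natCast_ne_zero_of_mem_Icc {p x : ℕ} (h1 : 1 ≤ x) (h2 : x ≤ p - 1) :
    (x : ZMod p) ≠ 0 := by
  rw [Ne, ZMod.natCast_eq_zero_iff]
  exact Nat.not_dvd_of_pos_of_lt h1 (by omega)

theorem fmap_eq_of_eq_natCast {p k x z : ℕ} {A : ℤ} (hz : z < p)
    (h : (A : ZMod p) * (x : ZMod p) ^ k = z) : fmap p A k x = z := by
  rw [fmap, h, ZMod.val_cast_of_lt hz]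

theorem sub_mem_IclassZ {p n x : ℕ} {i : ℤ} (hi : (p : ℤ) ≡ 2 * i [ZMOD n])
    (hx : x ∈ IclassZ p n i) : p - x ∈ IclassZ p n i := by
  obtain ⟨⟨h1, h2⟩, h3⟩ := mem_IclassZ_iff.1 hx
  refine mem_IclassZ_iff.2 ⟨by omega, ?_⟩
  rw [Nat.cast_sub (by omega)]
  simpa [two_mul] using hi.sub h3

theorem fmap_image_IclassZ_eq {p n k : ℕ} {i A : ℤ} (hk : Odd k)
    (hi : (p : ℤ) ≡ 2 * i [ZMOD n])
    (hf : ∀ x ∈ IclassZ p n i, (A : ZMod p) * (x : ZMod p) ^ k = x ∨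
      (A : ZMod p) * (x : ZMod p) ^ k = -x) :
    (IclassZ p n i).image (fmap p A k) = IclassZ p n i := by
  have key : ∀ x ∈ IclassZ p n i, 1 ≤ x ∧ x < p ∧ ((p - x : ℕ) : ZMod p) = -x := by
    intro x hx
    obtain ⟨⟨h1, h2⟩, -⟩ := mem_IclassZ_iff.1 hx
    refine ⟨h1, by omega, ?_⟩
    rw [Nat.cast_sub (by omega)]
    simp
  ext z
  rw [Finset.mem_image]
  constructor
  · rintro ⟨x, hx, rfl⟩
    obtain ⟨h1, h2, h3⟩ := key x hx
    rcases hf x hx with h | h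
    · rwa [fmap_eq_of_eq_natCast h2 h]
    · rw [fmap_eq_of_eq_natCast (z := p - x) (by omega) (by rw [h, h3])]
      exact sub_mem_IclassZ hi hx
  · intro hz
    obtain ⟨h1, h2, h3⟩ := key z hz
    rcases hf z hz with h | h
    · exact ⟨z, hz, fmap_eq_of_eq_natCast h2 h⟩
    · refine ⟨p - z, sub_mem_IclassZ hi hz, fmap_eq_of_eq_natCast h2 ?_⟩
      rw [h3, hk.neg_pow, mul_neg, h, neg_neg]

/-- On the class of `a * n - h * p`, the `m`-th power is constant if it is constant on the integers
from `a` to `b`. -/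
theorem natCast_pow_eq_of_mem_IclassZ {p n m x : ℕ} {a b h : ℤ} [Fact p.Prime] (hm : m ≠ 0)
    (hn : 0 < n) (hb : 1 ≤ b)
    (hpow : ∀ x : ℕ, a ≤ (x : ℤ) → (x : ℤ) ≤ b → (x : ZMod p) ^ m = (a : ZMod p) ^ m)
    (hlow : n * (a - 1) ≤ h * p) (hhigh : (h + 1) * p ≤ n * (b + 1))
    (hx : x ∈ IclassZ p n (a * n - h * p)) :
    (x : ZMod p) ^ m = (a * n : ZMod p) ^ m := by
  have ha : 0 < a := by
    by_contra! hle
    have h0 := hpow 0 (by simpa using hle) (by push_cast; omega)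
    have h1 := hpow 1 (by push_cast; omega) (by simpa using hb)
    rw [← h0] at h1
    simp [hm] at h1
  obtain ⟨y, hay, hyb, hxy⟩ := exists_eq_mul_sub_of_mem_IclassZ hn hlow hhigh hx
  lift y to ℕ using by omega
  have hcast : (x : ZMod p) = n * y := by
    have := congrArg (Int.cast : ℤ → ZMod p) hxy
    simpa using this
  rw [hcast, mul_pow, hpow y hay hyb, mul_pow, mul_comm]

theorem stmt_12 (p T n : ℕ) (hp : p.Prime) (hp3 : p % 3 = 1) (hT : 1 ≤ T) (hn : 2 ≤ n)
    (a : ℤ) (ha : a = ((p : ℤ) + 1) / 2 - (T : ℤ))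
    (hpow : ∀ x : ℕ, a ≤ (x : ℤ) → (x : ℤ) ≤ ((p : ℤ) - 1) / 2 + (T : ℤ) →
      (x : ZMod p) ^ ((p - 1) / 3) = (a : ZMod p) ^ ((p - 1) / 3))
    (i : ℤ)
    (hni : (Even n ∧ 2 * p < n * (2 * T + 1) ∧ n * (2 * T - 1) < 2 * p ∧
              i = a * (n : ℤ) - ((n : ℤ) / 2 - 1) * (p : ℤ)) ∨
           (Odd n ∧ p < n * (2 * T + 1) ∧ n * (2 * T - 1) < p ∧
              i = a * (n : ℤ) - (((n : ℤ) - 1) / 2) * (p : ℤ))) :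
    -- (1) exponents `k = j(p-1)/3 + 1`, `j ∈ {1,2}`: `f` is the identity on `I_i`
    (∀ j ∈ ({1, 2} : Finset ℕ), ∀ k : ℕ, k = j * (p - 1) / 3 + 1 →
      Nat.gcd k (p - 1) = 1 →
      ∀ x ∈ IclassZ p n i, fmap p ((a * (n : ℤ)) ^ (2 * (k - 1))) k x = x) ∧
    -- (2) for odd `n`, exponents `k = j(p-1)/6 + 1`, `j ∈ {1,5}`: `f(I_i) = I_i`
    (Odd n → ∀ j ∈ ({1, 5} : Finset ℕ), ∀ k : ℕ, k = j * (p - 1) / 6 + 1 →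
      Nat.gcd k (p - 1) = 1 →
      (IclassZ p n i).image (fmap p ((a * (n : ℤ)) ^ (2 * (k - 1))) k) = IclassZ p n i) := by
  have : Fact p.Prime := ⟨hp⟩
  obtain ⟨q, hq, hpq⟩ : ∃ q : ℕ, q ≠ 0 ∧ p = 6 * q + 1 := by
    have h2 := hp.two_le
    have hodd : p % 2 = 1 := hp.eq_two_or_odd.resolve_left (by rintro rfl; omega)
    exact ⟨p / 6, by omega, by omega⟩
  have hpz : (p : ℤ) = 6 * q + 1 := by exact_mod_cast hpq
  have ha' : a = 3 * q + 1 - T := by omega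
  have hb : ((p : ℤ) - 1) / 2 + T = 3 * q + T := by omega
  have hthird : (p - 1) / 3 = 2 * q := by omega
  rw [hb, hthird] at hpow
  obtain ⟨h, hi, hlow, hhigh, hpar⟩ : ∃ h : ℤ, i = a * n - h * p ∧ n * (a - 1) ≤ h * p ∧
      (h + 1) * p ≤ n * ((3 * q + T : ℤ) + 1) ∧ (Odd n → (n : ℤ) = 2 * h + 1) := by
    rcases hni with ⟨he, h1, -, hi⟩ | ⟨ho, h1, -, hi⟩
    · refine ⟨_, hi, ?_, ?_, fun ho => absurd he (Nat.not_even_iff_odd.2 ho)⟩ <;>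
      · obtain ⟨c, rfl⟩ := he
        have hc : ((c + c : ℕ) : ℤ) / 2 = c := by omega
        rw [hc, ha', hpz] at *
        zify at h1
        push_cast
        nlinarith
    · refine ⟨_, hi, ?_, ?_, fun _ => by obtain ⟨c, rfl⟩ := ho; omega⟩ <;>
      · obtain ⟨c, rfl⟩ := ho
        have hc : (((2 * c + 1 : ℕ) : ℤ) - 1) / 2 = c := by omega
        rw [hc, ha', hpz] at *
        zify at h1
        push_cast
        nlinarith
  have hx0 : ∀ x ∈ IclassZ p n i, (x : ZMod p) ≠ 0 := fun x hx =>
    have hx' := (mem_IclassZ_iff.1 hx).1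
    ZMod.natCast_ne_zero_of_mem_Icc hx'.1 hx'.2
  have hconst : ∀ x ∈ IclassZ p n i, (a * n : ZMod p) ^ (2 * q) = (x : ZMod p) ^ (2 * q) := by
    intro x hx
    rw [hi] at hx
    exact (natCast_pow_eq_of_mem_IclassZ (by omega) (by omega) (by omega) hpow hlow hhigh hx).symm
  have hfermat : ∀ x ∈ IclassZ p n i, (x : ZMod p) ^ (6 * q) = 1 := fun x hx => by
    simpa [hpq] using ZMod.pow_card_sub_one_eq_one (hx0 x hx)
  refine ⟨?_, ?_⟩
  · intro j _ k hk _ x hx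
    have hk' : k = 2 * q * j + 1 := by
      rw [hk, hpq, show j * (6 * q + 1 - 1) = 3 * (2 * q * j) by rw [Nat.add_sub_cancel]; ring,
        Nat.mul_div_cancel_left _ (by norm_num)]
    have hxp := (mem_IclassZ_iff.1 hx).1
    refine fmap_eq_of_eq_natCast (by omega) ?_
    rw [hk', Nat.add_sub_cancel]
    push_cast
    calc (a * n : ZMod p) ^ (2 * (2 * q * j)) * (x : ZMod p) ^ (2 * q * j + 1)
        = ((a * n : ZMod p) ^ (2 * q)) ^ (2 * j) * (x : ZMod p) ^ (2 * q * j + 1) := by ring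
      _ = ((x : ZMod p) ^ (6 * q)) ^ j * x := by rw [hconst x hx]; ring
      _ = x := by rw [hfermat x hx, one_pow, one_mul]
  · intro ho j _ k hk hgcd
    have hk' : k = q * j + 1 := by
      rw [hk, hpq, show j * (6 * q + 1 - 1) = 6 * (q * j) by rw [Nat.add_sub_cancel]; ring,
        Nat.mul_div_cancel_left _ (by norm_num)]
    have hkodd : Odd k := by
      rw [← Nat.not_even_iff_odd]
      intro he
      have := Nat.dvd_gcd he.two_dvd (show 2 ∣ p - 1 by omega)
      omega
    refine fmap_image_IclassZ_eq hkodd ?_ fun x hx => ?_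
    · refine Int.modEq_iff_dvd.2 ⟨2 * a - p, ?_⟩
      rw [hi]
      linear_combination (p : ℤ) * hpar ho
    have hsq : ((x : ZMod p) ^ (3 * q * j)) ^ 2 = 1 := by
      rw [← one_pow j, ← hfermat x hx]
      ring
    have hval : (((a * n) ^ (2 * (k - 1)) : ℤ) : ZMod p) * (x : ZMod p) ^ k
        = (x : ZMod p) ^ (3 * q * j) * x := by
      rw [hk', Nat.add_sub_cancel]
      push_cast
      calc (a * n : ZMod p) ^ (2 * (q * j)) * (x : ZMod p) ^ (q * j + 1)
          = ((a * n : ZMod p) ^ (2 * q)) ^ j * (x : ZMod p) ^ (q * j + 1) := by ring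
        _ = (x : ZMod p) ^ (3 * q * j) * x := by rw [hconst x hx]; ring
    rw [hval]
    rcases sq_eq_sq_iff_eq_or_eq_neg.1 (hsq.trans (one_pow 2).symm) with h | h <;> simp [h]
end
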